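/- Let α be an irrational number whose continued-fraction denominators q_n satisfy β(α) := limsup_{n→∞} (log q_{n+1})/q_n < ∞ (α is finite-Liouvillean). Then for every positive integer ℓ the Lyapunov exponent is discontinuous at some point of C^ℓ(S¹, SL(2,ℝ)): there exist D ∈ C^ℓ(S¹, SL(2,ℝ)) with L(α,D) > 0 and a sequence A_j ∈ C^ℓ(S¹, SL(2,ℝ)) such that ‖A_j − D‖_{C^ℓ} → 0 as j → ∞ but limsup_{j→∞} L(α, A_j) < L(α, D). -/

import Mathlib

open Filter MeasureTheory

noncomputable section

attribute [local instance] Matrix.normedAddCommGroup Matrix.normedSpace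

/-- The Euclidean operator norm of a 2×2 real matrix. -/
def opNorm (M : Matrix (Fin 2) (Fin 2) ℝ) : ℝ :=
  ‖Matrix.toEuclideanCLM (𝕜 := ℝ) M‖

/-- The iterated cocycle `A^n(x) = A(x + (n-1)α) ⋯ A(x + α) A(x)` over the rotation by `α`. -/
def cocIter (α : ℝ) (A : ℝ → Matrix (Fin 2) (Fin 2) ℝ) :
    ℕ → ℝ → Matrix (Fin 2) (Fin 2) ℝ
  | 0, _ => 1
  | n + 1, x => A (x + (n : ℝ) * α) * cocIter α A n x

/-- The Lyapunov exponent `L(α, A) = lim_n (1/n) ∫_{S¹} log ‖A^n(x)‖ dx` (the limit exists by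
subadditivity, so it agrees with the `limsup` used here). -/
def lyap (α : ℝ) (A : ℝ → Matrix (Fin 2) (Fin 2) ℝ) : ℝ :=
  limsup (fun n : ℕ =>
    (n : ℝ)⁻¹ * ∫ x in (0 : ℝ)..1, Real.log (opNorm (cocIter α A n x))) atTop

/-- The `C^l` norm `max_{0 ≤ k ≤ l} sup_x ‖∂^k A(x)‖` of a matrix-valued map on the circle. -/
def cNorm (l : ℕ) (A : ℝ → Matrix (Fin 2) (Fin 2) ℝ) : ℝ :=
  ⨆ k : Fin (l + 1), ⨆ x : ℝ, ‖iteratedDeriv (k : ℕ) A x‖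

/-- Gauss map iterates of `α`: `x₀ = {α}`, `x_{n+1} = {1/x_n}`. -/
def gaussIter (α : ℝ) : ℕ → ℝ
  | 0 => Int.fract α
  | n + 1 => Int.fract (gaussIter α n)⁻¹

/-- `cfa α n` is the partial quotient `a_{n+1} = ⌊1/x_n⌋` of the continued fraction of `α`. -/
def cfa (α : ℝ) (n : ℕ) : ℕ := ⌊(gaussIter α n)⁻¹⌋₊

/-- Denominators `q_n` of the continued fraction convergents of `α`:
`q₀ = 1`, `q₁ = a₁`, `q_{n+2} = a_{n+2} q_{n+1} + q_n`. -/
def cfq (α : ℝ) : ℕ → ℕ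
  | 0 => 1
  | 1 => cfa α 0
  | n + 2 => cfa α (n + 1) * cfq α (n + 1) + cfq α n



/-- Schrödinger-type cocycle with potential `P`. -/
def Sc (P : ℝ → ℝ) (x : ℝ) : Matrix (Fin 2) (Fin 2) ℝ := !![P x, -1; 1, 0]

def ea (α : ℝ) (P : ℝ → ℝ) (n : ℕ) (x : ℝ) : ℝ := cocIter α (Sc P) n x 0 0
def eb (α : ℝ) (P : ℝ → ℝ) (n : ℕ) (x : ℝ) : ℝ := cocIter α (Sc P) n x 0 1
def ec (α : ℝ) (P : ℝ → ℝ) (n : ℕ) (x : ℝ) : ℝ := cocIter α (Sc P) n x 1 0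
def ed (α : ℝ) (P : ℝ → ℝ) (n : ℕ) (x : ℝ) : ℝ := cocIter α (Sc P) n x 1 1

/-- right ratio -/
def Rr (α : ℝ) (P : ℝ → ℝ) (n : ℕ) (z : ℝ) : ℝ := -eb α P n (z + α) / ea α P n (z + α)

lemma coc_add (α : ℝ) (A : ℝ → Matrix (Fin 2) (Fin 2) ℝ) (m n : ℕ) (x : ℝ) :
    cocIter α A (m + n) x = cocIter α A m (x + n * α) * cocIter α A n x := by
  induction m with
  | zero => simp [cocIter]
  | succ m ih =>
    rw [show m + 1 + n = (m + n) + 1 by ring, cocIter, cocIter, ih, Matrix.mul_assoc]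
    congr 2
    push_cast; ring

lemma coc_det (α : ℝ) (A : ℝ → Matrix (Fin 2) (Fin 2) ℝ) (h : ∀ x, (A x).det = 1) (n : ℕ) (x : ℝ) :
    (cocIter α A n x).det = 1 := by
  induction n with
  | zero => simp [cocIter]
  | succ n ih => rw [cocIter, Matrix.det_mul, h, ih, one_mul]

lemma Sc_det (P : ℝ → ℝ) (x : ℝ) : (Sc P x).det = 1 := by
  simp [Sc, Matrix.det_fin_two]

lemma e_det (α : ℝ) (P : ℝ → ℝ) (n : ℕ) (x : ℝ) :
    ea α P n x * ed α P n x - eb α P n x * ec α P n x = 1 := by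
  have := coc_det α (Sc P) (Sc_det P) n x
  rw [Matrix.det_fin_two] at this
  exact this

lemma ea_zero (α : ℝ) (P : ℝ → ℝ) (x : ℝ) : ea α P 0 x = 1 := by simp [ea, cocIter]
lemma eb_zero (α : ℝ) (P : ℝ → ℝ) (x : ℝ) : eb α P 0 x = 0 := by simp [eb, cocIter]
lemma ec_zero (α : ℝ) (P : ℝ → ℝ) (x : ℝ) : ec α P 0 x = 0 := by simp [ec, cocIter]
lemma ed_zero (α : ℝ) (P : ℝ → ℝ) (x : ℝ) : ed α P 0 x = 1 := by simp [ed, cocIter]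

lemma ea_succ (α : ℝ) (P : ℝ → ℝ) (n : ℕ) (x : ℝ) :
    ea α P (n+1) x = P (x + n * α) * ea α P n x - ec α P n x := by
  simp [ea, ec, cocIter, Sc, Matrix.mul_apply, Fin.sum_univ_two]; ring
lemma eb_succ (α : ℝ) (P : ℝ → ℝ) (n : ℕ) (x : ℝ) :
    eb α P (n+1) x = P (x + n * α) * eb α P n x - ed α P n x := by
  simp [eb, ed, cocIter, Sc, Matrix.mul_apply, Fin.sum_univ_two]; ring
lemma ec_succ (α : ℝ) (P : ℝ → ℝ) (n : ℕ) (x : ℝ) :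
    ec α P (n+1) x = ea α P n x := by
  simp [ea, ec, cocIter, Sc, Matrix.mul_apply, Fin.sum_univ_two]
lemma ed_succ (α : ℝ) (P : ℝ → ℝ) (n : ℕ) (x : ℝ) :
    ed α P (n+1) x = eb α P n x := by
  simp [eb, ed, cocIter, Sc, Matrix.mul_apply, Fin.sum_univ_two]

lemma coc_succ' (α : ℝ) (A : ℝ → Matrix (Fin 2) (Fin 2) ℝ) (n : ℕ) (x : ℝ) :
    cocIter α A (n+1) x = cocIter α A n (x + α) * A x := by
  rw [coc_add]; simp [cocIter]

lemma ea_succ' (α : ℝ) (P : ℝ → ℝ) (n : ℕ) (x : ℝ) :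
    ea α P (n+1) x = ea α P n (x + α) * P x + eb α P n (x + α) := by
  rw [ea, coc_succ']; simp [ea, eb, Sc, Matrix.mul_apply, Fin.sum_univ_two]
lemma eb_succ' (α : ℝ) (P : ℝ → ℝ) (n : ℕ) (x : ℝ) :
    eb α P (n+1) x = - ea α P n (x + α) := by
  rw [eb, coc_succ']; simp [ea, Sc, Matrix.mul_apply, Fin.sum_univ_two]
lemma ec_succ' (α : ℝ) (P : ℝ → ℝ) (n : ℕ) (x : ℝ) :
    ec α P (n+1) x = ec α P n (x + α) * P x + ed α P n (x + α) := by
  rw [ec, coc_succ']; simp [ec, ed, Sc, Matrix.mul_apply, Fin.sum_univ_two]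
lemma ed_succ' (α : ℝ) (P : ℝ → ℝ) (n : ℕ) (x : ℝ) :
    ed α P (n+1) x = - ec α P n (x + α) := by
  rw [ed, coc_succ']; simp [ec, Sc, Matrix.mul_apply, Fin.sum_univ_two]

lemma coc_split (α : ℝ) (A : ℝ → Matrix (Fin 2) (Fin 2) ℝ) (m n : ℕ) (x : ℝ) :
    cocIter α A (m + 1 + n) x =
      cocIter α A m (x + n * α + α) * (A (x + n * α) * cocIter α A n x) := by
  rw [coc_add, coc_succ', Matrix.mul_assoc]

lemma split_raw (α : ℝ) (P : ℝ → ℝ) (m n : ℕ) (x : ℝ) :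
    ea α P (m + 1 + n) x = ea α P m (x + n * α + α) * (P (x + n * α) * ea α P n x - ec α P n x)
      + eb α P m (x + n * α + α) * ea α P n x ∧
    eb α P (m + 1 + n) x = ea α P m (x + n * α + α) * (P (x + n * α) * eb α P n x - ed α P n x)
      + eb α P m (x + n * α + α) * eb α P n x ∧
    ec α P (m + 1 + n) x = ec α P m (x + n * α + α) * (P (x + n * α) * ea α P n x - ec α P n x)
      + ed α P m (x + n * α + α) * ea α P n x ∧
    ed α P (m + 1 + n) x = ec α P m (x + n * α + α) * (P (x + n * α) * eb α P n x - ed α P n x)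
      + ed α P m (x + n * α + α) * eb α P n x := by
  have e : x + ((n + 1 : ℕ) : ℝ) * α = x + n * α + α := by push_cast; ring
  have h : cocIter α (Sc P) (m + 1 + n) x =
      cocIter α (Sc P) m (x + n * α + α) * cocIter α (Sc P) (n + 1) x := by
    rw [← e, ← coc_add, add_assoc, add_comm 1 n]
  rw [← ea_succ, ← eb_succ, ← ec_succ α P n x, ← ed_succ α P n x]
  simp only [ea, eb, ec, ed]
  rw [h]
  simp only [Matrix.mul_apply, Fin.sum_univ_two, and_self]

/-- pivot at position `n` of the box of length `m+1+n` at `x` -/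
def piv (α : ℝ) (P : ℝ → ℝ) (m n : ℕ) (x : ℝ) : ℝ :=
  P (x + n * α) - ec α P n x / ea α P n x - Rr α P m (x + n * α)

lemma split_piv (α : ℝ) (P : ℝ → ℝ) (m n : ℕ) (x : ℝ) (h1 : ea α P n x ≠ 0)
    (h2 : ea α P m (x + n * α + α) ≠ 0) :
    ea α P (m + 1 + n) x = ea α P n x * ea α P m (x + n * α + α) * piv α P m n x ∧
    eb α P (m + 1 + n) x = eb α P n x * ea α P m (x + n * α + α) * piv α P m n x
      - ea α P m (x + n * α + α) / ea α P n x ∧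
    ec α P (m + 1 + n) x = ea α P n x * ec α P m (x + n * α + α) * piv α P m n x
      + ea α P n x / ea α P m (x + n * α + α) ∧
    ed α P (m + 1 + n) x = eb α P n x * ec α P m (x + n * α + α) * piv α P m n x
      - ec α P m (x + n * α + α) / ea α P n x + eb α P n x / ea α P m (x + n * α + α) := by
  obtain ⟨r1, r2, r3, r4⟩ := split_raw α P m n x
  have d1 := e_det α P n x
  have d2 := e_det α P m (x + n * α + α)
  rw [r1, r2, r3, r4]
  simp only [piv, Rr]
  generalize ea α P m (x + n * α + α) = a' at *
  generalize eb α P m (x + n * α + α) = b' at *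
  generalize ec α P m (x + n * α + α) = c' at *
  generalize ed α P m (x + n * α + α) = d' at *
  generalize ea α P n x = a at *
  generalize eb α P n x = b at *
  generalize ec α P n x = c at *
  generalize ed α P n x = d at *
  generalize P (x + n * α) = p
  have hd : d = (1 + b * c) / a := by field_simp; linarith
  have hd' : d' = (1 + b' * c') / a' := by field_simp; linarith
  subst hd hd'
  refine ⟨?_, ?_, ?_, ?_⟩ <;> field_simp <;> ring

lemma Rr_zero (α : ℝ) (P : ℝ → ℝ) (z : ℝ) : Rr α P 0 z = 0 := by simp [Rr, eb_zero]

lemma wronsk (α : ℝ) (P : ℝ → ℝ) (n : ℕ) (x : ℝ) :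
    eb α P n x * ea α P (n+1) x - eb α P (n+1) x * ea α P n x = 1 := by
  have := e_det α P n x
  rw [ea_succ, eb_succ]; linarith

lemma Rr_step (α : ℝ) (P : ℝ → ℝ) (n : ℕ) (z : ℝ) (h1 : ea α P n (z + α) ≠ 0)
    (h2 : ea α P (n+1) (z + α) ≠ 0) :
    Rr α P (n+1) z - Rr α P n z = 1 / (ea α P n (z + α) * ea α P (n+1) (z + α)) := by
  have := wronsk α P n (z + α)
  simp only [Rr]
  field_simp
  linarith

lemma Rr_split (α : ℝ) (P : ℝ → ℝ) (m k : ℕ) (z : ℝ) (h1 : ea α P k (z + α) ≠ 0)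
    (h2 : ea α P m (z + α + k * α + α) ≠ 0) (h3 : piv α P m k (z + α) ≠ 0) :
    Rr α P (m + 1 + k) z = Rr α P k z + 1 / (ea α P k (z + α) ^ 2 * piv α P m k (z + α)) := by
  obtain ⟨r1, r2, _⟩ := split_piv α P m k (z + α) h1 h2
  simp only [Rr]
  rw [r1, r2]
  generalize ea α P m (z + α + k * α + α) = a' at *
  field_simp
  ring

lemma reflect (α : ℝ) (P : ℝ → ℝ) (hP : ∀ x, P (-x) = P x) (n : ℕ) : ∀ x : ℝ,
    ea α P n (-(x + n * α) + α) = ea α P n x ∧ eb α P n (-(x + n * α) + α) = - ec α P n x ∧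
    ec α P n (-(x + n * α) + α) = - eb α P n x ∧ ed α P n (-(x + n * α) + α) = ed α P n x := by
  induction n with
  | zero => intro x; simp [ea_zero, eb_zero, ec_zero, ed_zero]
  | succ n ih =>
    intro x
    obtain ⟨h1, h2, h3, h4⟩ := ih x
    have e : -(x + ((n+1 : ℕ) : ℝ) * α) + α = -(x + n * α) := by push_cast; ring
    rw [e, ea_succ', eb_succ', ec_succ' α P n (-(x + n * α)), ed_succ' α P n (-(x + n * α)), h1, h2, h3, h4, hP, ea_succ,
      eb_succ, ec_succ, ed_succ]
    refine ⟨by ring, by ring, by ring, by ring⟩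

lemma ratio_reflect (α : ℝ) (P : ℝ → ℝ) (hP : ∀ x, P (-x) = P x) (n : ℕ) (x : ℝ) :
    ec α P n x / ea α P n x = Rr α P n (-(x + n * α)) := by
  obtain ⟨h1, h2, _⟩ := reflect α P hP n x
  simp only [Rr]
  rw [h1, h2, neg_neg]

lemma coc_congr (α : ℝ) (A A' : ℝ → Matrix (Fin 2) (Fin 2) ℝ) (n : ℕ) (x : ℝ)
    (h : ∀ i < n, A (x + i * α) = A' (x + i * α)) : cocIter α A n x = cocIter α A' n x := by
  induction n with
  | zero => rfl
  | succ n ih => rw [cocIter, cocIter, ih (fun i hi => h i (by omega)), h n (by omega)]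

lemma Sc_congr (α : ℝ) (P P' : ℝ → ℝ) (n : ℕ) (x : ℝ)
    (h : ∀ i < n, P (x + i * α) = P' (x + i * α)) :
    cocIter α (Sc P) n x = cocIter α (Sc P') n x :=
  coc_congr α _ _ n x (fun i hi => by simp [Sc, h i hi])

lemma Rr_congr (α : ℝ) (P P' : ℝ → ℝ) (n : ℕ) (z : ℝ)
    (h : ∀ k, 1 ≤ k → k ≤ n → P (z + k * α) = P' (z + k * α)) :
    Rr α P n z = Rr α P' n z := by
  simp only [Rr, ea, eb]
  rw [Sc_congr α P P' n (z + α)]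
  intro i hi
  have := h (i+1) (by omega) (by omega)
  push_cast at this
  rw [show z + α + i * α = z + (i + 1) * α by ring]; exact this




/-- no return to `I` among `z + kα`, `1 ≤ k ≤ n` -/
def NoRet (α : ℝ) (I : ℝ → Prop) (z : ℝ) (n : ℕ) : Prop :=
  ∀ k : ℕ, 1 ≤ k → k ≤ n → ¬ I (z + k * α)

lemma NoRet.mono {α : ℝ} {I : ℝ → Prop} {z : ℝ} {n m : ℕ} (h : NoRet α I z n) (hm : m ≤ n) :
    NoRet α I z m := fun k h1 h2 => h k h1 (h2.trans hm)

/-- exponential growth after starting in `I` -/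
def Grow (α : ℝ) (P : ℝ → ℝ) (I : ℝ → Prop) (G : ℝ) : Prop :=
  ∀ z n, I z → NoRet α I z n → G ^ n ≤ ea α P n (z + α)

lemma Rr_tele {α : ℝ} {P : ℝ → ℝ} {I : ℝ → Prop} {G : ℝ} (hG : 2 ≤ G) (hgr : Grow α P I G)
    {z : ℝ} (hz : I z) (i n : ℕ) (hin : i ≤ n) (h : NoRet α I z n) :
    Rr α P i z ≤ Rr α P n z ∧ Rr α P n z ≤ Rr α P i z + 2 / G ^ (2 * i) - 2 / G ^ (2 * n) := by
  induction n, hin using Nat.le_induction with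
  | base => constructor <;> simp
  | succ n hn ih =>
    obtain ⟨h1, h2⟩ := ih (h.mono (by omega))
    have g1 := hgr z n hz (h.mono (by omega))
    have g2 := hgr z (n+1) hz h
    have p1 : 0 < G ^ n := by positivity
    have p2 : 0 < G ^ (n+1) := by positivity
    have q1 := p1.trans_le g1
    have q2 := p2.trans_le g2
    have hs := Rr_step α P n z q1.ne' q2.ne'
    have hpos : 0 < 1 / (ea α P n (z + α) * ea α P (n+1) (z + α)) := by positivity
    have hle : 1 / (ea α P n (z + α) * ea α P (n+1) (z + α)) ≤ 1 / (G ^ n * G ^ (n+1)) := by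
      gcongr
    have hgeo : 1 / (G ^ n * G ^ (n+1)) ≤ 2 / G ^ (2 * n) - 2 / G ^ (2 * (n+1)) := by
      have e1 : G ^ (2 * n) = G ^ n * G ^ n := by ring
      have e2 : G ^ (2 * (n+1)) = G ^ n * G ^ n * (G * G) := by ring
      rw [e1, e2, pow_succ]
      generalize G ^ n = g at *
      have : 2 / (g * g) - 2 / (g * g * (G * G)) - 1 / (g * (g * G)) =
          (2 * G * G - 2 - G) / (g * g * (G * G)) := by
        field_simp
      have h3 : 0 ≤ (2 * G * G - 2 - G) / (g * g * (G * G)) := by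
        apply div_nonneg
        · nlinarith
        · positivity
      linarith
    constructor
    · linarith
    · linarith

/-- First-hit split. -/
lemma first_hit (p : ℕ → Prop) (n : ℕ) :
    (∀ k < n, ¬ p k) ∨ ∃ i < n, p i ∧ ∀ k < i, ¬ p k := by
  classical
  by_cases h : ∃ k, k < n ∧ p k
  · right
    have hs := Nat.find_spec h
    refine ⟨Nat.find h, hs.1, hs.2, fun k hk hpk => Nat.find_min h hk ⟨hk.trans hs.1, hpk⟩⟩
  · left
    push Not at h
    exact h

structure Stage (α : ℝ) (P P' : ℝ → ℝ) (I : ℝ → Prop) (N : ℕ) (G η : ℝ) (h w w' : ℝ → ℝ) : Prop where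
  hPe : ∀ x, P (-x) = P x
  hI : ∀ x, I x → I (-x)
  hret : ∀ z (k : ℕ), I z → I (z + k * α) → 1 ≤ k → N + 1 ≤ k
  hgr : Grow α P I G
  hG : 2 ≤ G
  hη : 0 < η
  hη1 : η ≤ 1
  hGN : 16 / η ^ 2 ≤ G ^ (2 * N)
  hprod : ∀ x n, ∏ i ∈ Finset.range n, w (x + i * α) ≤ ea α P n x
  hw : ∀ x, 0 < w x
  hw' : ∀ x, 0 < w' x
  hww : ∀ x, w' x ≤ w x
  hwI : ∀ x, I x → w' x ≤ h x + η / 2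
  hh : ∀ x, 0 ≤ h x
  hPe' : ∀ x, P' (-x) = P' x
  hoff : ∀ x, ¬ I x → P' x = P x
  hon : ∀ x, I x → Rr α P N x + Rr α P N (-x) + h x + η ≤ P' x

namespace Stage
variable {α : ℝ} {P P' : ℝ → ℝ} {I : ℝ → Prop} {N : ℕ} {G η : ℝ} {h w w' : ℝ → ℝ}

lemma noretN (S : Stage α P P' I N G η h w w') {z : ℝ} (hz : I z) : NoRet α I z N := by
  intro k h1 h2 h3
  have := S.hret z k hz h3 h1
  omega

lemma c0 (S : Stage α P P' I N G η h w w') {z : ℝ} (hz : I z) (n : ℕ) (hn : NoRet α I z n) :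
    Rr α P n z ≤ Rr α P N z + η / 8 := by
  have hη := S.hη
  rcases le_total n N with h1 | h1
  · have := (Rr_tele S.hG S.hgr hz n N h1 (S.noretN hz)).1
    linarith
  · have h2 := (Rr_tele S.hG S.hgr hz N n h1 hn).2
    have hG := S.hG
    have p1 : 0 < 2 / G ^ (2 * n) := by positivity
    have p2 : 2 / G ^ (2 * N) ≤ η / 8 := by
      have := S.hGN
      have h16 : 0 < 16 / η ^ 2 := by positivity
      calc 2 / G ^ (2 * N) ≤ 2 / (16 / η ^ 2) := by gcongr
        _ = η * η / 8 := by field_simp; norm_num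
        _ ≤ η / 8 := by nlinarith [S.hη1]
    linarith

/-- lower bound on the pivot -/
lemma pivot (S : Stage α P P' I N G η h w w') (m i : ℕ) (x : ℝ)
    (hx : ∀ k < i, ¬ I (x + k * α)) (hz : I (x + i * α))
    (hR : Rr α P' m (x + i * α) ≤ Rr α P N (x + i * α) + η / 4) :
    h (x + i * α) + η / 2 ≤ piv α P' m i x := by
  have e : ec α P' i x / ea α P' i x = Rr α P i (-(x + i * α)) := by
    rw [← ratio_reflect α P S.hPe]
    simp only [ec, ea]
    rw [Sc_congr α P' P i x (fun k hk => S.hoff _ (hx k hk))]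
  have h1 : Rr α P i (-(x + i * α)) ≤ Rr α P N (-(x + i * α)) + η / 8 := by
    apply S.c0 (S.hI _ hz)
    intro k hk1 hk2 hk
    have := S.hI _ hk
    apply hx (i - k) (by omega)
    convert this using 1
    rw [Nat.cast_sub hk2]; ring
  have := S.hon _ hz
  have := S.hη
  rw [piv, e]
  linarith

lemma c (S : Stage α P P' I N G η h w w') (n : ℕ) : ∀ z, I z →
    0 < ea α P' n (z + α) ∧ Rr α P' n z ≤ Rr α P N z + η / 4 := by
  have hη := S.hη
  have hG := S.hG
  induction n using Nat.strong_induction_on with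
  | _ n ih =>
  intro z hz
  rcases first_hit (fun k => I (z + α + k * α)) n with h1 | ⟨k, hk, hIk, hno⟩
  · have hn : NoRet α I z n := by
      intro k hk1 hk2 hk
      apply h1 (k-1) (by omega)
      convert hk using 1
      rw [Nat.cast_sub hk1]; push_cast; ring
    have e : cocIter α (Sc P') n (z + α) = cocIter α (Sc P) n (z + α) :=
      Sc_congr α P' P n _ (fun k hk => S.hoff _ (h1 k hk))
    have e1 : ea α P' n (z + α) = ea α P n (z + α) := by simp only [ea, e]
    have e2 : Rr α P' n z = Rr α P n z := by simp only [Rr, ea, eb, e]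
    rw [e1, e2]
    refine ⟨lt_of_lt_of_le (by positivity) (S.hgr z n hz hn), ?_⟩
    have := S.c0 hz n hn
    linarith
  · obtain ⟨m, rfl⟩ : ∃ m, n = m + 1 + k := ⟨n - 1 - k, by omega⟩
    have hn : NoRet α I z k := by
      intro j hk1 hk2 hk
      apply hno (j-1) (by omega)
      convert hk using 1
      rw [Nat.cast_sub hk1]; push_cast; ring
    have hkN : N ≤ k := by
      have := S.hret z (k+1) hz (by convert hIk using 1; push_cast; ring) (by omega)
      omega
    have e : cocIter α (Sc P') k (z + α) = cocIter α (Sc P) k (z + α) :=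
      Sc_congr α P' P k _ (fun k hk => S.hoff _ (hno k hk))
    have e1 : ea α P' k (z + α) = ea α P k (z + α) := by simp only [ea, e]
    have e2 : Rr α P' k z = Rr α P k z := by simp only [Rr, ea, eb, e]
    have hGk : G ^ k ≤ ea α P' k (z + α) := by rw [e1]; exact S.hgr z k hz hn
    have hpk : 0 < ea α P' k (z + α) := lt_of_lt_of_le (by positivity) hGk
    obtain ⟨i1, i2⟩ := ih m (by omega) _ hIk
    have hp := S.pivot m k (z + α) hno hIk i2
    have hh := S.hh (z + α + k * α)
    have hpp : 0 < piv α P' m k (z + α) := by linarith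
    rw [Rr_split α P' m k z hpk.ne' i1.ne' hpp.ne', (split_piv α P' m k (z + α) hpk.ne' i1.ne').1]
    refine ⟨by positivity, ?_⟩
    rw [e2]
    have h0 := S.c0 hz k hn
    have : 1 / (ea α P' k (z + α) ^ 2 * piv α P' m k (z + α)) ≤ η / 8 := by
      have hb : 16 / η ^ 2 ≤ ea α P' k (z + α) ^ 2 := by
        calc 16 / η ^ 2 ≤ G ^ (2 * N) := S.hGN
          _ ≤ G ^ (2 * k) := by
            apply pow_le_pow_right₀ (by linarith); omega
          _ = (G ^ k) ^ 2 := by ring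
          _ ≤ _ := by gcongr
      calc 1 / (ea α P' k (z + α) ^ 2 * piv α P' m k (z + α)) ≤ 1 / (16 / η ^ 2 * (η / 2)) := by
            gcongr; linarith
        _ = η / 8 := by field_simp; norm_num
    linarith

lemma prod (S : Stage α P P' I N G η h w w') (n : ℕ) : ∀ x,
    ∏ i ∈ Finset.range n, w' (x + i * α) ≤ ea α P' n x := by
  have hη := S.hη
  induction n using Nat.strong_induction_on with
  | _ n ih =>
  intro x
  rcases first_hit (fun k => I (x + k * α)) n with h1 | ⟨k, hk, hIk, hno⟩
  · have e1 : ea α P' n x = ea α P n x := by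
      simp only [ea]; rw [Sc_congr α P' P n _ (fun k hk => S.hoff _ (h1 k hk))]
    rw [e1]
    refine le_trans ?_ (S.hprod x n)
    exact Finset.prod_le_prod (fun i _ => (S.hw' _).le) (fun i _ => S.hww _)
  · obtain ⟨m, rfl⟩ : ∃ m, n = m + 1 + k := ⟨n - 1 - k, by omega⟩
    have i1 := ih k (by omega) x
    have i2 := ih m (by omega) (x + k * α + α)
    have p1 : 0 < ∏ i ∈ Finset.range k, w' (x + i * α) := Finset.prod_pos (fun i _ => S.hw' _)
    have p2 : 0 < ∏ i ∈ Finset.range m, w' (x + k * α + α + i * α) :=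
      Finset.prod_pos (fun i _ => S.hw' _)
    obtain ⟨j1, j2⟩ := S.c m _ hIk
    have hp := S.pivot m k x hno hIk j2
    have hwk := S.hwI _ hIk
    have p3 := S.hw' (x + k * α)
    rw [(split_piv α P' m k x (p1.trans_le i1).ne' j1.ne').1]
    have e : ∏ i ∈ Finset.range (m + 1 + k), w' (x + i * α) =
        (∏ i ∈ Finset.range k, w' (x + i * α)) * (∏ i ∈ Finset.range m, w' (x + k * α + α + i * α))
          * w' (x + k * α) := by
      rw [show m + 1 + k = k + (m + 1) by ring, Finset.prod_range_add, Finset.prod_range_succ', mul_assoc]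
      congr 3
      funext i
      congr 1; push_cast; ring
    rw [e]
    have := (p1.trans_le i1).le
    gcongr
    linarith

end Stage




namespace CF

lemma gauss_irr {α : ℝ} (hα : Irrational α) (n : ℕ) : Irrational (gaussIter α n) := by
  induction n with
  | zero => 
    rw [gaussIter, Int.fract]
    exact hα.sub_intCast _
  | succ n ih =>
    rw [gaussIter, Int.fract]
    exact ih.inv.sub_intCast _

lemma gauss_pos {α : ℝ} (hα : Irrational α) (n : ℕ) : 0 < gaussIter α n := by
  have h0 : 0 ≤ gaussIter α n := by cases n <;> exact Int.fract_nonneg _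
  have := (gauss_irr hα n).ne_zero
  positivity

lemma gauss_lt (α : ℝ) (n : ℕ) : gaussIter α n < 1 := by
  cases n <;> exact Int.fract_lt_one _

lemma gauss_inv {α : ℝ} (hα : Irrational α) (n : ℕ) :
    1 = (cfa α n) * gaussIter α n + gaussIter α n * gaussIter α (n+1) := by
  have hp := gauss_pos hα n
  have : (gaussIter α n)⁻¹ = cfa α n + gaussIter α (n+1) := by
    rw [gaussIter, cfa, natCast_floor_eq_intCast_floor (by positivity), Int.floor_add_fract]
  have h2 : (gaussIter α n)⁻¹ * gaussIter α n = 1 := inv_mul_cancel₀ hp.ne'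
  rw [this] at h2
  linarith

lemma cfa_pos {α : ℝ} (hα : Irrational α) (n : ℕ) : 1 ≤ cfa α n := by
  have hp := gauss_pos hα n
  rw [cfa, Nat.one_le_floor_iff]
  exact (one_lt_inv₀ hp).2 (gauss_lt α n) |>.le

lemma q_pos {α : ℝ} (hα : Irrational α) (n : ℕ) : 1 ≤ cfq α n ∧ 1 ≤ cfq α (n+1) := by
  induction n with
  | zero => exact ⟨by simp [cfq], by simpa [cfq] using cfa_pos hα 0⟩
  | succ n ih =>
    refine ⟨ih.2, ?_⟩
    rw [cfq]; omega

lemma q_add {α : ℝ} (hα : Irrational α) (n : ℕ) : cfq α (n+1) + cfq α n ≤ cfq α (n+2) := by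
  rw [cfq]
  have := cfa_pos hα (n+1)
  nlinarith

lemma q_mono {α : ℝ} (hα : Irrational α) (n : ℕ) : cfq α n ≤ cfq α (n+1) := by
  cases n with
  | zero => simpa [cfq] using cfa_pos hα 0
  | succ n => have := q_add hα n; rw [show n + 1 + 1 = n + 2 from rfl]; omega

lemma q_ge {α : ℝ} (hα : Irrational α) (n : ℕ) : n ≤ cfq α n := by
  induction n with
  | zero => omega
  | succ n ih =>
    cases n with
    | zero => exact (q_pos hα 0).2
    | succ n => have := q_add hα n; have := (q_pos hα n).1; rw [show n + 1 + 1 = n + 2 from rfl]; omega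

/-- `θ_n = x_0 ⋯ x_n` -/
def th (α : ℝ) (n : ℕ) : ℝ := ∏ i ∈ Finset.range (n+1), gaussIter α i

lemma th_succ (α : ℝ) (n : ℕ) : th α (n+1) = th α n * gaussIter α (n+1) := by
  rw [th, Finset.prod_range_succ]; rfl

lemma th_pos {α : ℝ} (hα : Irrational α) (n : ℕ) : 0 < th α n :=
  Finset.prod_pos (fun i _ => gauss_pos hα i)

lemma th_le {α : ℝ} (hα : Irrational α) (n : ℕ) : th α (n+1) ≤ th α n := by
  rw [th_succ]
  have := th_pos hα n
  nlinarith [gauss_lt α (n+1)]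

lemma th_rec {α : ℝ} (hα : Irrational α) (n : ℕ) :
    th α n = cfa α (n+1) * th α (n+1) + th α (n+2) := by
  rw [th_succ α (n+1), th_succ]
  have := gauss_inv hα (n+1)
  linear_combination (th α n) * this

lemma q_th {α : ℝ} (hα : Irrational α) (n : ℕ) :
    (cfq α (n+1) : ℝ) * th α n + cfq α n * th α (n+1) = 1 := by
  induction n with
  | zero =>
    have := gauss_inv hα 0
    simp [cfq, th, Finset.prod_range_succ]
    linarith
  | succ n ih =>
    have := th_rec hα n
    rw [cfq]; push_cast
    rw [this] at ih
    linarith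

lemma exists_p {α : ℝ} (hα : Irrational α) (n : ℕ) :
    (∃ p : ℤ, (cfq α n : ℝ) * α - p = (-1) ^ n * th α n) ∧
    (∃ p : ℤ, (cfq α (n+1) : ℝ) * α - p = (-1) ^ (n+1) * th α (n+1)) := by
  induction n with
  | zero =>
    have := gauss_inv hα 0
    refine ⟨⟨⌊α⌋, ?_⟩, ⟨cfa α 0 * ⌊α⌋ + 1, ?_⟩⟩
    · simp [cfq, th, gaussIter]
    · have h0 : gaussIter α 0 = α - ⌊α⌋ := rfl
      simp [cfq, th, Finset.prod_range_succ]
      rw [h0, zero_add] at this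
      rw [h0]
      linarith
  | succ n ih =>
    refine ⟨ih.2, ?_⟩
    obtain ⟨⟨p, hp⟩, ⟨p', hp'⟩⟩ := ih
    refine ⟨cfa α (n+1) * p' + p, ?_⟩
    have := th_rec hα n
    rw [cfq]; push_cast
    have e : (-1 : ℝ) ^ (n+1+1) = (-1) ^ n := by ring
    have e' : (-1 : ℝ) ^ (n+1) = -(-1) ^ n := by ring
    rw [e]; rw [e'] at hp'
    linear_combination hp + (cfa α (n+1) : ℝ) * hp' + (-1) ^ n * this

lemma best {α : ℝ} (hα : Irrational α) (n : ℕ) (k : ℕ) (hk : 1 ≤ k) (hk2 : k < cfq α (n+1)) (r : ℤ) :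
    th α n ≤ |(k : ℝ) * α - r| := by
  obtain ⟨⟨p, hp⟩, ⟨p', hp'⟩⟩ := exists_p hα n
  have hdet := q_th hα n
  set q := cfq α n
  set q' := cfq α (n+1)
  have hq : 1 ≤ q := (q_pos hα n).1
  have t1 := th_pos hα n
  have t2 := th_pos hα (n+1)
  obtain ⟨s, hs, hs2⟩ : ∃ s : ℤ, (s : ℝ) = (-1) ^ n ∧ s * s = 1 := by
    refine ⟨(-1) ^ n, by push_cast; ring, ?_⟩
    rw [← mul_pow]; norm_num
  rw [pow_succ, ← hs] at hp'
  rw [← hs] at hp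
  have hs2r : (s : ℝ) * s = 1 := by exact_mod_cast hs2
  have det : (q : ℤ) * p' - q' * p = s := by
    have : (q : ℝ) * p' - q' * p = s := by
      linear_combination (q' : ℝ) * hp - (q : ℝ) * hp' + s * hdet
    exact_mod_cast this
  -- coordinates
  obtain ⟨a, b, ha, hb⟩ : ∃ a b : ℤ, (k : ℤ) = a * q + b * q' ∧ r = a * p + b * p' := by
    refine ⟨s * (k * p' - r * q'), s * (r * q - k * p), ?_, ?_⟩
    · linear_combination (-(k : ℤ)) * hs2 - s * k * det
    · linear_combination (-r) * hs2 - s * r * det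
  have hkey : (k : ℝ) * α - r = s * (a * th α n - b * th α (n+1)) := by
    have h1 : (k : ℝ) = a * q + b * q' := by exact_mod_cast ha
    have h2 : (r : ℝ) = a * p + b * p' := by exact_mod_cast hb
    rw [h1, h2]
    linear_combination (a : ℝ) * hp + b * hp'
  have habs : |(s : ℝ)| = 1 := by
    have h3 : |(s : ℝ)| * |(s : ℝ)| = 1 := by rw [← abs_mul, hs2r, abs_one]
    nlinarith [abs_nonneg (s : ℝ)]
  rw [hkey, abs_mul, habs, one_mul]
  have hkz : (1 : ℤ) ≤ k := by exact_mod_cast hk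
  have hkz2 : (k : ℤ) < q' := by exact_mod_cast hk2
  have hqz : (1 : ℤ) ≤ q := by exact_mod_cast hq
  have hq'z : (0 : ℤ) < q' := by linarith
  rcases lt_trichotomy b 0 with hb0 | hb0 | hb0
  · have : 1 ≤ a := by
      by_contra hcon
      have : a ≤ 0 := by omega
      nlinarith
    have h1 : (1 : ℝ) ≤ a := by exact_mod_cast this
    have h2 : (b : ℝ) ≤ 0 := by exact_mod_cast hb0.le
    apply le_trans _ (le_abs_self _)
    nlinarith
  · subst hb0
    have : 1 ≤ a := by
      by_contra hcon
      have : a ≤ 0 := by omega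
      nlinarith
    have h1 : (1 : ℝ) ≤ a := by exact_mod_cast this
    apply le_trans _ (le_abs_self _)
    push_cast
    nlinarith
  · have : a ≤ -1 := by
      by_contra hcon
      have : 0 ≤ a := by omega
      nlinarith
    have h1 : (a : ℝ) ≤ -1 := by exact_mod_cast this
    have h2 : (0 : ℝ) ≤ b := by exact_mod_cast hb0.le
    apply le_trans _ (neg_le_abs _)
    nlinarith

lemma sep {α : ℝ} (hα : Irrational α) (n : ℕ) (k : ℕ) (hk : 1 ≤ k) (hk2 : k < cfq α (n+1)) (r : ℤ) :
    1 / (2 * (cfq α (n+1) : ℝ)) ≤ |(k : ℝ) * α - r| := by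
  refine le_trans ?_ (best hα n k hk hk2 r)
  have h1 := q_th hα n
  have h2 : (cfq α n : ℝ) ≤ cfq α (n+1) := by exact_mod_cast q_mono hα n
  have h3 := th_le hα n
  have h4 := th_pos hα (n+1)
  have h5 : (1 : ℝ) ≤ cfq α (n+1) := by exact_mod_cast (q_pos hα n).2
  rw [div_le_iff₀ (by positivity)]
  nlinarith

def nxt (α : ℝ) (n : ℕ) : ℕ := if 2 * cfq α n ≤ cfq α (n+1) then n + 1 else n + 2

def sub (α : ℝ) (n0 : ℕ) : ℕ → ℕ
  | 0 => n0
  | j + 1 => nxt α (sub α n0 j)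

lemma nxt_gt (α : ℝ) (n : ℕ) : n < nxt α n := by unfold nxt; split_ifs <;> omega

lemma sub_ge (α : ℝ) (n0 j : ℕ) : n0 ≤ sub α n0 j := by
  induction j with
  | zero => simp [sub]
  | succ j ih => rw [sub]; exact ih.trans (nxt_gt α _).le

end CF

open CF in
lemma arith (α : ℝ) (hα : Irrational α)
    (hFL : ∃ β : ℝ, ∀ᶠ n in atTop, Real.log (cfq α (n + 1) : ℝ) ≤ β * (cfq α n : ℝ)) :
    ∃ β : ℝ, 1 ≤ β ∧ ∀ Q0 : ℕ, ∃ q : ℕ → ℕ, Q0 ≤ q 0 ∧ ∀ j, 2 * q j ≤ q (j+1) ∧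
      (q (j+1) : ℝ) ≤ Real.exp (β * q j) ∧
      ∀ k : ℕ, 1 ≤ k → k < q j → ∀ r : ℤ, 1 / (2 * (q j : ℝ)) ≤ |(k : ℝ) * α - r| := by
  obtain ⟨β, hβ⟩ := hFL
  obtain ⟨n1, hn1⟩ := eventually_atTop.1 hβ
  set γ := max β 1
  have hγ : 1 ≤ γ := le_max_right _ _
  refine ⟨2 * γ, by linarith, fun Q0 => ?_⟩
  set n0 := max (max n1 Q0) 1
  refine ⟨fun j => cfq α (sub α n0 j), ?_, fun j => ?_⟩
  · simp only [sub]
    refine le_trans ?_ (q_ge hα n0)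
    omega
  · have hge := sub_ge α n0 j
    simp only [sub]
    set n := sub α n0 j
    have hb : ∀ m, n ≤ m → (cfq α (m+1) : ℝ) ≤ Real.exp (γ * cfq α m) := by
      intro m hm
      have h1 := hn1 m (by omega)
      have h5 : (1 : ℝ) ≤ cfq α (m+1) := by exact_mod_cast (q_pos hα m).2
      rw [← Real.log_le_iff_le_exp (by linarith)]
      refine h1.trans ?_
      gcongr
      exact le_max_left _ _
    refine ⟨?_, ?_, ?_⟩
    · unfold nxt
      split_ifs with h
      · exact h
      · have := q_add hα n
        have := q_mono hα n
        omega
    · unfold nxt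
      split_ifs with h
      · refine (hb n le_rfl).trans ?_
        apply Real.exp_le_exp.2
        have : (0 : ℝ) ≤ cfq α n := by positivity
        nlinarith
      · refine (hb (n+1) (by omega)).trans ?_
        apply Real.exp_le_exp.2
        have : (cfq α (n+1) : ℝ) ≤ 2 * cfq α n := by
          have : cfq α (n+1) ≤ 2 * cfq α n := by omega
          exact_mod_cast this
        nlinarith
    · obtain ⟨m, hm⟩ : ∃ m, n = m + 1 := ⟨n - 1, by omega⟩
      rw [hm]
      exact fun k h1 h2 r => sep hα m k h1 h2 r




/-- the basic bump profile -/
def us (x : ℝ) : ℝ := Real.sin (Real.pi * x) ^ 2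

lemma us_nonneg (x : ℝ) : 0 ≤ us x := sq_nonneg _
lemma us_le_one (x : ℝ) : us x ≤ 1 := Real.sin_sq_le_one _
lemma us_neg (x : ℝ) : us (-x) = us x := by simp [us]
lemma us_add_int (x : ℝ) (r : ℤ) : us (x + r) = us x := by
  rw [us, us, mul_add, mul_comm Real.pi (r : ℝ), Real.sin_add_int_mul_pi, mul_pow, ← zpow_natCast, ← zpow_mul,
    mul_comm r, zpow_mul]
  norm_num
lemma us_per (x : ℝ) : us (x + 1) = us x := by simpa using us_add_int x 1

lemma us_lower_aux (y : ℝ) (hy : |y| ≤ 1 / 2) : 4 * y ^ 2 ≤ us y := by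
  wlog h : 0 ≤ y with H
  · have := H (-y) (by simpa using hy) (by linarith)
    rw [us_neg] at this
    simpa using this
  · rw [abs_of_nonneg h] at hy
    have := Real.mul_le_sin (x := Real.pi * y) (by positivity) (by nlinarith [Real.pi_pos])
    have e : 2 / Real.pi * (Real.pi * y) = 2 * y := by field_simp
    rw [e] at this
    rw [us]
    nlinarith

lemma us_lower (x : ℝ) : 4 * (x - round x) ^ 2 ≤ us x := by
  have h := us_lower_aux (x - round x) (abs_sub_round x)
  have := us_add_int x (-round x)
  rw [← this]
  push_cast
  simpa [sub_eq_add_neg] using h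

lemma us_near {x : ℝ} {Q : ℝ} (hQ : 0 < Q) (h : us x < 1 / (16 * Q ^ 2)) :
    |x - round x| < 1 / (8 * Q) := by
  have h1 := us_lower x
  rw [← sq_lt_sq₀ (abs_nonneg _) (by positivity), sq_abs]
  have : (1 / (8 * Q)) ^ 2 = 1 / (16 * Q ^ 2) / 4 := by field_simp; norm_num
  rw [this]; linarith

def SepQ (α : ℝ) (q : ℕ) : Prop :=
  ∀ k : ℕ, 1 ≤ k → k < q → ∀ r : ℤ, 1 / (2 * (q : ℝ)) ≤ |(k : ℝ) * α - r|

lemma sep_ret {α : ℝ} {q : ℕ} (hq : 1 ≤ q) (hs : SepQ α q) {z : ℝ} {k : ℕ} (hk : 1 ≤ k)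
    (h1 : us z < 1 / (16 * (q : ℝ) ^ 2)) (h2 : us (z + k * α) < 1 / (16 * (q : ℝ) ^ 2)) : q ≤ k := by
  by_contra hcon
  have hq' : (0 : ℝ) < q := by exact_mod_cast hq
  have n1 := us_near hq' h1
  have n2 := us_near hq' h2
  have := hs k hk (by omega) (round (z + k * α) - round z)
  push_cast at this
  have e : (k : ℝ) * α - (round (z + k * α) - round z) =
     (z + k * α - round (z + k * α)) - (z - round z) := by ring
  rw [e] at this
  have h3 := abs_sub (z + k * α - round (z + k * α)) (z - round z)
  have h4 : 1 / (2 * (q : ℝ)) = 4 * (1 / (8 * (q : ℝ))) := by field_simp; norm_num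
  have h5 : 0 < 1 / (8 * (q : ℝ)) := by positivity
  linarith

lemma sum_log_fact (q : ℕ) (hq : 1 ≤ q) :
    ∑ b ∈ Finset.range q, 2 * Real.log (q / ((b : ℝ) + 1)) ≤ 2 * q := by
  have hq' : (0 : ℝ) < q := by exact_mod_cast hq
  rw [← Finset.mul_sum]
  have : ∑ b ∈ Finset.range q, Real.log (q / ((b : ℝ) + 1)) = Real.log ((q : ℝ) ^ q / (q.factorial : ℝ)) := by
    rw [← Real.log_prod (fun b _ => by positivity), Finset.prod_div_distrib, Finset.prod_const, Finset.card_range,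
      ← Finset.prod_range_add_one_eq_factorial]
    push_cast; rfl
  rw [this]
  have h2 := Real.pow_div_factorial_le_exp (q : ℝ) hq'.le q
  have := Real.log_le_log (by positivity) h2
  rw [Real.log_exp] at this
  linarith

lemma sum_inj_le {S : Finset ℕ} {b : ℕ → ℕ} {f F : ℕ → ℝ} {M : ℕ}
    (hb : ∀ i ∈ S, b i < M) (hinj : Set.InjOn b S) (hf : ∀ i ∈ S, f i ≤ F (b i))
    (hF : ∀ k < M, 0 ≤ F k) : ∑ i ∈ S, f i ≤ ∑ k ∈ Finset.range M, F k := by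
  calc ∑ i ∈ S, f i ≤ ∑ i ∈ S, F (b i) := Finset.sum_le_sum hf
    _ = ∑ k ∈ S.image b, F k := (Finset.sum_image hinj).symm
    _ ≤ _ := by
      apply Finset.sum_le_sum_of_subset_of_nonneg
      · intro k hk
        obtain ⟨i, hi, rfl⟩ := Finset.mem_image.1 hk
        exact Finset.mem_range.2 (hb i hi)
      · intro k hk _
        exact hF k (Finset.mem_range.1 hk)

lemma window_half {α : ℝ} {q : ℕ} (hq : 1 ≤ q) (hs : SepQ α q) (x K : ℝ) (hK : 0 ≤ K)
    (S : Finset ℕ) (hS : ∀ i ∈ S, i < q) (hk : ∀ i ∈ S, 0 < us (x + i * α))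
    (hKu : ∀ i ∈ S, -Real.log (us (x + i * α)) ≤ K)
    (hsign : (∀ i ∈ S, 0 ≤ x + i * α - round (x + i * α)) ∨
      (∀ i ∈ S, x + i * α - round (x + i * α) ≤ 0)) :
    ∑ i ∈ S, -Real.log (us (x + i * α)) ≤ K + 2 * q := by
  have hq' : (0 : ℝ) < q := by exact_mod_cast hq
  set d : ℕ → ℝ := fun i => x + i * α - round (x + i * α) with hd
  have hsep : ∀ i ∈ S, ∀ j ∈ S, i < j → 1 / (2 * (q : ℝ)) ≤ |d j - d i| := by
    intro i hi j hj hij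
    have := hs (j - i) (by omega) (by have := hS j hj; omega) (round (x + j * α) - round (x + i * α))
    rw [Nat.cast_sub hij.le] at this
    push_cast at this
    convert this using 2
    simp only [hd]; ring
  have habs : ∀ i ∈ S, ∀ j ∈ S, |d j - d i| = abs (abs (d j) - abs (d i)) := by
    intro i hi j hj
    rcases hsign with h | h
    · rw [abs_of_nonneg (h i hi), abs_of_nonneg (h j hj)]
    · rw [abs_of_nonpos (h i hi), abs_of_nonpos (h j hj), ← abs_neg]
      congr 1; ring
  have hinj0 : ∀ i ∈ S, ∀ j ∈ S, i < j → ⌊2 * (q : ℝ) * |d i|⌋₊ ≠ ⌊2 * (q : ℝ) * |d j|⌋₊ := by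
    intro i hi j hj hij he
    have h1 := hsep i hi j hj hij
    rw [habs i hi j hj, div_le_iff₀ (by positivity)] at h1
    have a1 := Nat.floor_le (show 0 ≤ 2 * (q : ℝ) * |d i| by positivity)
    have a2 := Nat.lt_floor_add_one (2 * (q : ℝ) * |d i|)
    have b1 := Nat.floor_le (show 0 ≤ 2 * (q : ℝ) * |d j| by positivity)
    have b2 := Nat.lt_floor_add_one (2 * (q : ℝ) * |d j|)
    rw [he] at a1 a2
    rcases le_total |d j| |d i| with h | h
    · rw [abs_of_nonpos (by linarith)] at h1; linarith
    · rw [abs_of_nonneg (by linarith)] at h1; linarith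
  set F : ℕ → ℝ := fun b => if b = 0 then K else 2 * Real.log (q / (b : ℝ)) with hF
  have hmain := sum_inj_le (S := S) (b := fun i => ⌊2 * (q : ℝ) * |d i|⌋₊)
    (f := fun i => -Real.log (us (x + i * α))) (F := F) (M := q + 1) ?_ ?_ ?_ ?_
  · refine hmain.trans ?_
    rw [Finset.sum_range_succ']
    have := sum_log_fact q hq
    simp only [hF]
    simp only [Nat.add_eq_zero_iff, one_ne_zero, and_false, if_false, if_true]
    push_cast
    linarith
  · intro i hi
    rw [Nat.lt_succ_iff]
    apply Nat.floor_le_of_le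
    have : |d i| ≤ 1 / 2 := abs_sub_round _
    nlinarith
  · intro i hi j hj he
    by_contra hne
    rcases lt_or_gt_of_ne hne with h | h
    · exact hinj0 i hi j hj h he
    · exact hinj0 j hj i hi h he.symm
  · intro i hi
    simp only [hF]
    split_ifs with h
    · exact hKu i hi
    · set b := ⌊2 * (q : ℝ) * |d i|⌋₊
      have hb : 1 ≤ b := by omega
      have hb' : (1 : ℝ) ≤ b := by exact_mod_cast hb
      have a1 := Nat.floor_le (show 0 ≤ 2 * (q : ℝ) * |d i| by positivity)
      have hu : ((b : ℝ) / q) ^ 2 ≤ us (x + i * α) := by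
        refine le_trans ?_ (us_lower _)
        have : (b : ℝ) / q ≤ 2 * |d i| := by
          rw [div_le_iff₀ hq']; linarith
        calc ((b : ℝ) / q) ^ 2 ≤ (2 * |d i|) ^ 2 := by gcongr
          _ = _ := by rw [mul_pow, sq_abs]; norm_num [hd]
      have h3 := Real.log_le_log (by positivity) hu
      rw [Real.log_pow] at h3
      have h4 : Real.log ((b : ℝ) / q) = - Real.log (q / b) := by rw [← Real.log_inv, inv_div]
      push_cast at h3
      rw [h4] at h3
      linarith
  · intro k hk
    simp only [hF]
    split_ifs with h
    · exact hK
    · have : (1 : ℝ) ≤ k := by exact_mod_cast Nat.one_le_iff_ne_zero.2 h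
      have h2 : (k : ℝ) ≤ q := by exact_mod_cast Nat.lt_succ_iff.1 hk
      have := Real.log_nonneg (show 1 ≤ (q : ℝ) / k by rw [le_div_iff₀ (by linarith)]; linarith)
      linarith

lemma window {α : ℝ} {q : ℕ} (hq : 1 ≤ q) (hs : SepQ α q) (x K : ℝ) (hK : 0 ≤ K) (w : ℕ) (hw : w ≤ q)
    (hk : ∀ i < w, 0 < us (x + i * α))
    (hKu : ∀ i < w, -Real.log (us (x + i * α)) ≤ K) :
    ∑ i ∈ Finset.range w, -Real.log (us (x + i * α)) ≤ 2 * K + 4 * q := by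
  classical
  rw [← Finset.sum_filter_add_sum_filter_not (Finset.range w) (fun i => 0 ≤ x + i * α - round (x + i * α))]
  have h1 := window_half hq hs x K hK
    ((Finset.range w).filter (fun i : ℕ => 0 ≤ x + i * α - round (x + i * α))) ?_ ?_ ?_ ?_
  · have h2 := window_half hq hs x K hK
      ((Finset.range w).filter (fun i : ℕ => ¬ (0 ≤ x + i * α - round (x + i * α)))) ?_ ?_ ?_ ?_
    · linarith
    all_goals simp only [Finset.mem_filter, Finset.mem_range]
    · intro i hi; omega
    · intro i hi; exact hk i hi.1
    · intro i hi; exact hKu i hi.1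
    · right; intro i hi; exact (not_le.1 hi.2).le
  all_goals simp only [Finset.mem_filter, Finset.mem_range]
  · intro i hi; omega
  · intro i hi; exact hk i hi.1
  · intro i hi; exact hKu i hi.1
  · left; intro i hi; exact hi.2

lemma windows {α : ℝ} {q : ℕ} (hq : 1 ≤ q) (hs : SepQ α q) (K : ℝ) (hK : 0 ≤ K) (n : ℕ) : ∀ x : ℝ,
    (∀ i < n, 0 < us (x + i * α)) → (∀ i < n, -Real.log (us (x + i * α)) ≤ K) →
    ∑ i ∈ Finset.range n, -Real.log (us (x + i * α)) ≤ (n / q + 1) * (2 * K + 4 * q) := by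
  have hq' : (0 : ℝ) < q := by exact_mod_cast hq
  induction n using Nat.strong_induction_on with
  | _ n ih =>
  intro x h1 h2
  by_cases hn : n ≤ q
  · refine (window hq hs x K hK n hn h1 h2).trans ?_
    have : (0 : ℝ) ≤ n / q := by positivity
    nlinarith
  · obtain ⟨m, rfl⟩ : ∃ m, n = q + m := ⟨n - q, by omega⟩
    rw [Finset.sum_range_add]
    have hw := window hq hs x K hK q le_rfl (fun i hi => h1 i (by omega)) (fun i hi => h2 i (by omega))
    have e : ∀ i : ℕ, x + ((q + i : ℕ) : ℝ) * α = (x + q * α) + i * α := by intro i; push_cast; ring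
    simp only [e]
    have := ih m (by omega) (x + q * α) (fun i hi => by rw [← e]; exact h1 _ (by omega))
      (fun i hi => by rw [← e]; exact h2 _ (by omega))
    have e2 : (((q + m : ℕ) : ℝ) / q + 1) = 1 + (m / q + 1) := by push_cast; field_simp; ring
    rw [e2, add_mul]
    linarith

/-- the arithmetic data -/
structure QS (α β : ℝ) (q : ℕ → ℕ) : Prop where
  h0 : 1 ≤ q 0
  hβ : 1 ≤ β
  dbl : ∀ j, 2 * q j ≤ q (j+1)
  ex : ∀ j, (q (j+1) : ℝ) ≤ Real.exp (β * q j)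
  sep : ∀ j, SepQ α (q j)

def eps (q : ℕ → ℕ) (j : ℕ) : ℝ := 1 / (16 * (q j : ℝ) ^ 2)
def Ij (q : ℕ → ℕ) (j : ℕ) (x : ℝ) : Prop := us x < eps q j

namespace QS
variable {α β : ℝ} {q : ℕ → ℕ}

lemma mono (Q : QS α β q) {i j : ℕ} (h : i ≤ j) : q i ≤ q j := by
  induction j, h using Nat.le_induction with
  | base => exact le_rfl
  | succ n hn ih => have := Q.dbl n; omega

lemma pos (Q : QS α β q) (j : ℕ) : 1 ≤ q j := Q.h0.trans (Q.mono (Nat.zero_le j))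

lemma posR (Q : QS α β q) (j : ℕ) : (1 : ℝ) ≤ q j := by exact_mod_cast Q.pos j

lemma two_pow (Q : QS α β q) (j : ℕ) : 2 ^ j ≤ q j := by
  induction j with
  | zero => simpa using Q.h0
  | succ j ih => have := Q.dbl j; rw [pow_succ]; omega

lemma eps_pos (Q : QS α β q) (j : ℕ) : 0 < eps q j := by
  have := Q.posR j
  unfold eps; positivity

lemma eps_anti (Q : QS α β q) {i j : ℕ} (h : i ≤ j) : eps q j ≤ eps q i := by
  have h1 := Q.posR i
  have h2 : (q i : ℝ) ≤ q j := by exact_mod_cast Q.mono h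
  unfold eps; gcongr

lemma eps_le (Q : QS α β q) (j : ℕ) : eps q j ≤ 1 / 16 := by
  have h1 := Q.posR j
  unfold eps
  apply div_le_div_of_nonneg_left <;> nlinarith

lemma Ij_anti (Q : QS α β q) {i j : ℕ} (h : i ≤ j) {x : ℝ} (hx : Ij q j x) : Ij q i x :=
  lt_of_lt_of_le hx (Q.eps_anti h)

lemma eps_lower (Q : QS α β q) (j : ℕ) : -Real.log (eps q (j+1)) ≤ 3 + 2 * β * q j := by
  have h1 := Q.posR (j+1)
  have h2 := Q.ex j
  unfold eps
  rw [one_div, Real.log_inv, neg_neg, Real.log_mul (by norm_num) (by positivity), Real.log_pow]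
  have h3 := Real.log_le_log (by positivity) h2
  rw [Real.log_exp] at h3
  have h4 : Real.log 16 ≤ 3 := by
    rw [show (16 : ℝ) = 2 ^ 4 by norm_num, Real.log_pow]
    have := Real.log_two_lt_d9
    push_cast; linarith
  push_cast
  linarith

lemma ret (Q : QS α β q) (j : ℕ) {z : ℝ} {k : ℕ} (hz : Ij q j z) (hz' : Ij q j (z + k * α)) (hk : 1 ≤ k) :
    q j ≤ k := sep_ret (Q.pos j) (Q.sep j) hk hz hz'

/-- constant in the log sum bound -/
def Cs (β : ℝ) (q : ℕ → ℕ) : ℝ := 20 + 8 * β + (-Real.log (eps q 0))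

lemma Cs_pos (Q : QS α β q) : 0 < Cs β q := by
  have := Real.log_nonpos (Q.eps_pos 0).le ((Q.eps_le 0).trans (by norm_num))
  have := Q.hβ
  unfold Cs; linarith

lemma sumlog (Q : QS α β q) (j : ℕ) (z : ℝ) (n : ℕ) (hz : Ij q j z) (hn : NoRet α (Ij q j) z n) :
    ∑ i ∈ Finset.range n, -Real.log (us (z + α + i * α)) ≤ Cs β q * n := by
  have hβ := Q.hβ
  have hl0 : 0 ≤ -Real.log (eps q 0) := by
    have := Real.log_nonpos (Q.eps_pos 0).le ((Q.eps_le 0).trans (by norm_num))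
    linarith
  -- lower bound for `us` before time `q s`
  have e : ∀ i : ℕ, z + α + i * α = z + ((i + 1 : ℕ) : ℝ) * α := by intro i; push_cast; ring
  have hlow : ∀ s ≤ j, n < q s → ∀ i < n, eps q s ≤ us (z + α + i * α) := by
    intro s hs hns i hi
    by_contra hcon
    push Not at hcon
    rw [e] at hcon
    have := Q.ret s (Q.Ij_anti hs hz) hcon (by omega)
    omega
  have hlowj : ∀ i < n, eps q j ≤ us (z + α + i * α) := by
    intro i hi
    have := hn (i+1) (by omega) (by omega)
    rw [← e] at this
    exact not_lt.1 this
  have hpos : ∀ i < n, 0 < us (z + α + i * α) := fun i hi => (Q.eps_pos j).trans_le (hlowj i hi)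
  by_cases hn0 : n < q 0
  · have : ∀ i ∈ Finset.range n, -Real.log (us (z + α + i * α)) ≤ -Real.log (eps q 0) := by
      intro i hi
      have hi := Finset.mem_range.1 hi
      have := Real.log_le_log (Q.eps_pos 0) (hlow 0 (Nat.zero_le _) hn0 i hi)
      linarith
    refine (Finset.sum_le_sum this).trans ?_
    rw [Finset.sum_const, Finset.card_range, nsmul_eq_mul, mul_comm]
    gcongr
    unfold Cs; linarith
  · obtain ⟨s, hsn, hK⟩ : ∃ s, q s ≤ n ∧ ∀ i < n, -Real.log (us (z + α + i * α)) ≤ 3 + 2 * β * q s := by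
      rcases first_hit (fun s => n < q (s + 1)) j with h | ⟨s, hs, hp, hno⟩
      · refine ⟨j, ?_, fun i hi => ?_⟩
        · cases j with
          | zero => omega
          | succ j => exact not_lt.1 (h j (by omega))
        · have h1 := Real.log_le_log (Q.eps_pos (j+1)) ((Q.eps_anti (Nat.le_succ j)).trans (hlowj i hi))
          have := Q.eps_lower j
          linarith
      · refine ⟨s, ?_, fun i hi => ?_⟩
        · cases s with
          | zero => omega
          | succ j => exact not_lt.1 (hno j (by omega))
        · have h1 := Real.log_le_log (Q.eps_pos (s+1)) (hlow (s+1) (by omega) hp i hi)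
          have := Q.eps_lower s
          linarith
    have h1 := Q.posR s
    have := windows (Q.pos s) (Q.sep s) (3 + 2 * β * q s) (by positivity) n (z + α) hpos hK
    refine this.trans ?_
    have h2 : (1 : ℝ) ≤ n / q s := by
      rw [le_div_iff₀ (by linarith), one_mul]; exact_mod_cast hsn
    calc ((n : ℝ) / q s + 1) * (2 * (3 + 2 * β * q s) + 4 * q s)
        ≤ (2 * (n / q s)) * (2 * (3 * q s + 2 * β * q s) + 4 * q s) := by
          gcongr
          · linarith
          · linarith
      _ = (20 + 8 * β) * n := by field_simp; ring
      _ ≤ Cs β q * n := by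
          gcongr
          unfold Cs; linarith

lemma visits (Q : QS α β q) (z : ℝ) (n : ℕ) (hz : Ij q 0 z) [DecidablePred (fun i : ℕ => Ij q 0 (z + α + i * α))] :
    (((Finset.range n).filter (fun i : ℕ => Ij q 0 (z + α + i * α))).card : ℝ) ≤ n / q 0 := by
  have hq := Q.posR 0
  have hq1 := Q.pos 0
  have e : ∀ i : ℕ, z + α + i * α = z + ((i + 1 : ℕ) : ℝ) * α := by intro i; push_cast; ring
  have hgap : ∀ i i' : ℕ, Ij q 0 (z + α + i * α) → Ij q 0 (z + α + i' * α) → i < i' → q 0 + i ≤ i' := by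
    intro i i' h1 h2 h
    have := Q.ret 0 (k := i' - i) h1 (by convert h2 using 1; rw [Nat.cast_sub h.le]; ring) (by omega)
    omega
  have : ((Finset.range n).filter (fun i : ℕ => Ij q 0 (z + α + i * α))).card ≤ n / q 0 := by
    have h1 := Finset.card_le_card_of_injOn (s := (Finset.range n).filter (fun i : ℕ => Ij q 0 (z + α + i * α)))
      (t := Finset.Icc 1 (n / q 0)) (fun i => (i + 1) / q 0) ?_ ?_
    · simpa using h1
    · intro i hi
      simp only [Finset.coe_filter, Finset.mem_range, Set.mem_setOf_eq] at hi
      simp only [Finset.coe_Icc, Set.mem_Icc]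
      constructor
      · rw [Nat.le_div_iff_mul_le (by omega), one_mul]
        have h2 := hi.2
        rw [e] at h2
        exact Q.ret 0 hz h2 (by omega)
      · apply Nat.div_le_div_right; omega
    · intro i hi i' hi' he
      simp only [Finset.coe_filter, Finset.mem_range, Set.mem_setOf_eq] at hi hi'
      simp only at he
      by_contra hne
      have key : ∀ a b : ℕ, q 0 + a ≤ b → (a + 1) / q 0 < (b + 1) / q 0 := by
        intro a b hab
        have : (a + 1 + q 0) / q 0 ≤ (b + 1) / q 0 := Nat.div_le_div_right (by omega)
        rw [Nat.add_div_right _ (by omega)] at this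
        omega
      rcases lt_or_gt_of_ne hne with h | h
      · have := key _ _ (hgap i i' hi.2 hi'.2 h); omega
      · have := key _ _ (hgap i' i hi'.2 hi.2 h); omega
  calc _ ≤ ((n / q 0 : ℕ) : ℝ) := by exact_mod_cast this
    _ ≤ _ := Nat.cast_div_le

end QS





lemma opNorm_mul (M N : Matrix (Fin 2) (Fin 2) ℝ) : opNorm (M * N) ≤ opNorm M * opNorm N := by
  unfold opNorm
  rw [map_mul]
  exact norm_mul_le _ _

lemma opNorm_entry (M : Matrix (Fin 2) (Fin 2) ℝ) (i j : Fin 2) : |M i j| ≤ opNorm M := by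
  unfold opNorm
  have h := (Matrix.toEuclideanCLM (𝕜 := ℝ) M).le_opNorm (EuclideanSpace.single j (1 : ℝ))
  rw [show ‖EuclideanSpace.single j (1 : ℝ)‖ = 1 by simp, mul_one] at h
  refine le_trans ?_ h
  have h2 := PiLp.norm_apply_le (Matrix.toEuclideanCLM (𝕜 := ℝ) M (EuclideanSpace.single j (1 : ℝ))) i
  refine le_trans (le_of_eq ?_) h2
  rw [Real.norm_eq_abs]
  congr 1
  simp [Matrix.ofLp_toEuclideanCLM]

lemma opNorm_le_sum (M : Matrix (Fin 2) (Fin 2) ℝ) :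
    opNorm M ≤ |M 0 0| + |M 0 1| + |M 1 0| + |M 1 1| := by
  unfold opNorm
  apply ContinuousLinearMap.opNorm_le_bound _ (by positivity)
  intro v
  have h0 : |v 0| ≤ ‖v‖ := PiLp.norm_apply_le v 0
  have h1 : |v 1| ≤ ‖v‖ := PiLp.norm_apply_le v 1
  have e0 : (Matrix.toEuclideanCLM (𝕜 := ℝ) M v) 0 = M 0 0 * v 0 + M 0 1 * v 1 := by
    simp [Matrix.ofLp_toEuclideanCLM, Matrix.mulVec, dotProduct, Fin.sum_univ_two]
  have e1 : (Matrix.toEuclideanCLM (𝕜 := ℝ) M v) 1 = M 1 0 * v 0 + M 1 1 * v 1 := by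
    simp [Matrix.ofLp_toEuclideanCLM, Matrix.mulVec, dotProduct, Fin.sum_univ_two]
  have hn : ‖Matrix.toEuclideanCLM (𝕜 := ℝ) M v‖ ≤ |(Matrix.toEuclideanCLM (𝕜 := ℝ) M v) 0| + |(Matrix.toEuclideanCLM (𝕜 := ℝ) M v) 1| := by
    rw [EuclideanSpace.norm_eq, Fin.sum_univ_two]
    apply Real.sqrt_le_iff.2
    refine ⟨by positivity, ?_⟩
    simp only [Real.norm_eq_abs]
    nlinarith [abs_nonneg ((Matrix.toEuclideanCLM (𝕜 := ℝ) M v) 0), abs_nonneg ((Matrix.toEuclideanCLM (𝕜 := ℝ) M v) 1)]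
  refine hn.trans ?_
  rw [e0, e1]
  have a0 := abs_add_le (M 0 0 * v 0) (M 0 1 * v 1)
  have a1 := abs_add_le (M 1 0 * v 0) (M 1 1 * v 1)
  rw [abs_mul, abs_mul] at a0 a1
  have b0 := mul_le_mul_of_nonneg_left h0 (abs_nonneg (M 0 0))
  have b1 := mul_le_mul_of_nonneg_left h1 (abs_nonneg (M 0 1))
  have b2 := mul_le_mul_of_nonneg_left h0 (abs_nonneg (M 1 0))
  have b3 := mul_le_mul_of_nonneg_left h1 (abs_nonneg (M 1 1))
  linarith

lemma opNorm_nonneg (M : Matrix (Fin 2) (Fin 2) ℝ) : 0 ≤ opNorm M := norm_nonneg _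

lemma opNorm_ge_one (M : Matrix (Fin 2) (Fin 2) ℝ) (h : M.det = 1) : 1 ≤ opNorm M := by
  -- if opNorm < 1 then columns `M^n → 0` but det = 1
  by_contra hcon
  push Not at hcon
  have hpow : ∀ n : ℕ, opNorm (M ^ n) ≤ (opNorm M) ^ n := by
    intro n
    unfold opNorm
    rw [map_pow]
    cases n with
    | zero => 
      rw [pow_zero, pow_zero]
      exact ContinuousLinearMap.norm_id_le
    | succ n => exact norm_pow_le' _ (Nat.succ_pos n)
  have hdet : ∀ n : ℕ, 1 ≤ 2 * ((opNorm M) ^ n) ^ 2 := by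
    intro n
    have h1 : (M ^ n).det = 1 := by rw [Matrix.det_pow, h, one_pow]
    rw [Matrix.det_fin_two] at h1
    have k := fun i j => (opNorm_entry (M ^ n) i j).trans (hpow n)
    have p := pow_nonneg (opNorm_nonneg M) n
    have a1 := mul_le_mul (k 0 0) (k 1 1) (abs_nonneg _) p
    have a2 := mul_le_mul (k 0 1) (k 1 0) (abs_nonneg _) p
    rw [← abs_mul] at a1 a2
    have a3 := le_abs_self ((M ^ n) 0 0 * (M ^ n) 1 1)
    have a4 := neg_le_abs ((M ^ n) 0 1 * (M ^ n) 1 0)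
    nlinarith
  have ht := tendsto_pow_atTop_nhds_zero_of_lt_one (opNorm_nonneg M) hcon
  have ht2 : Tendsto (fun n : ℕ => 2 * ((opNorm M) ^ n) ^ 2) atTop (nhds (2 * 0 ^ 2)) :=
    (ht.pow 2).const_mul 2
  have := ge_of_tendsto' ht2 hdet
  norm_num at this

lemma opNorm_cont : Continuous opNorm := by
  unfold opNorm
  apply continuous_norm.comp
  exact LinearMap.continuous_of_finiteDimensional
    ({ toFun := fun M => Matrix.toEuclideanCLM (n := Fin 2) (𝕜 := ℝ) M
       map_add' := fun a b => map_add _ a b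
       map_smul' := fun c a => map_smul _ c a } :
      Matrix (Fin 2) (Fin 2) ℝ →ₗ[ℝ] (EuclideanSpace ℝ (Fin 2) →L[ℝ] EuclideanSpace ℝ (Fin 2)))

lemma coc_cont (α : ℝ) (A : ℝ → Matrix (Fin 2) (Fin 2) ℝ) (hA : Continuous A) (n : ℕ) :
    Continuous (cocIter α A n) := by
  induction n with
  | zero => simpa [cocIter] using continuous_const
  | succ n ih =>
    have : cocIter α A (n+1) = fun x => A (x + n * α) * cocIter α A n x := by
      funext x; rfl
    rw [this]
    exact (hA.comp (by fun_prop)).matrix_mul ih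

lemma coc_per (α : ℝ) (A : ℝ → Matrix (Fin 2) (Fin 2) ℝ) (hA : Function.Periodic A 1) (n : ℕ) :
    Function.Periodic (cocIter α A n) 1 := by
  induction n with
  | zero => intro x; rfl
  | succ n ih =>
    intro x
    rw [cocIter, cocIter, ih x]
    rw [show x + 1 + n * α = x + n * α + 1 by ring, hA]

/-- the integrals -/
def lint (α : ℝ) (A : ℝ → Matrix (Fin 2) (Fin 2) ℝ) (n : ℕ) : ℝ :=
  ∫ x in (0 : ℝ)..1, Real.log (opNorm (cocIter α A n x))

structure GoodC (α : ℝ) (A : ℝ → Matrix (Fin 2) (Fin 2) ℝ) : Prop where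
  c : Continuous A
  p : Function.Periodic A 1
  d : ∀ x, (A x).det = 1

namespace GoodC
variable {α : ℝ} {A : ℝ → Matrix (Fin 2) (Fin 2) ℝ}

lemma one_le (g : GoodC α A) (n : ℕ) (x : ℝ) : 1 ≤ opNorm (cocIter α A n x) :=
  opNorm_ge_one _ (coc_det α A g.d n x)

lemma log_cont (g : GoodC α A) (n : ℕ) : Continuous (fun x => Real.log (opNorm (cocIter α A n x))) := by
  apply Continuous.log
  · exact opNorm_cont.comp (coc_cont α A g.c n)
  · intro x; have := g.one_le n x; linarith

lemma log_per (g : GoodC α A) (n : ℕ) :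
    Function.Periodic (fun x => Real.log (opNorm (cocIter α A n x))) 1 := by
  intro x
  simp only
  rw [coc_per α A g.p n x]

lemma int_shift {f : ℝ → ℝ} (hp : Function.Periodic f 1) (c : ℝ) :
    ∫ x in (0 : ℝ)..1, f (x + c) = ∫ x in (0 : ℝ)..1, f x := by
  rw [intervalIntegral.integral_comp_add_right]
  have := hp.intervalIntegral_add_eq (0 + c) 0
  rw [zero_add] at this
  rw [zero_add, add_comm 1 c, this, zero_add]

lemma lint_nonneg (g : GoodC α A) (n : ℕ) : 0 ≤ lint α A n := by
  apply intervalIntegral.integral_nonneg (by norm_num)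
  intro x _
  exact Real.log_nonneg (g.one_le n x)

lemma subadd (g : GoodC α A) : Subadditive (lint α A) := by
  intro m n
  have h1 := int_shift (g.log_per m) (n * α)
  rw [lint, lint, lint, ← h1, ← intervalIntegral.integral_add]
  · apply intervalIntegral.integral_mono (by norm_num)
    · exact (g.log_cont _).intervalIntegrable _ _
    · exact (((g.log_cont m).comp (continuous_add_const (n * α))).add (g.log_cont n)).intervalIntegrable _ _
    · intro x
      simp only
      have p1 := g.one_le m (x + n * α)
      have p2 := g.one_le n x
      rw [← Real.log_mul (by linarith) (by linarith), coc_add]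
      apply Real.log_le_log
      · rw [← coc_add]; have := g.one_le (m + n) x; linarith
      · exact opNorm_mul _ _
  · exact ((g.log_cont m).comp (continuous_add_const (n * α))).intervalIntegrable _ _
  · exact (g.log_cont n).intervalIntegrable _ _

lemma bdd (g : GoodC α A) : BddBelow (Set.range fun n : ℕ => lint α A n / n) := by
  refine ⟨0, ?_⟩
  rintro _ ⟨n, rfl⟩
  exact div_nonneg (g.lint_nonneg n) (by positivity)

lemma lyap_tendsto (g : GoodC α A) : Tendsto (fun n : ℕ => lint α A n / n) atTop (nhds (lyap α A)) := by
  have h := g.subadd.tendsto_lim g.bdd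
  have : lyap α A = g.subadd.lim := by
    unfold lyap
    apply Tendsto.limsup_eq
    refine h.congr (fun n => ?_)
    rw [div_eq_inv_mul]; rfl
  rw [this]; exact h

lemma lyap_le (g : GoodC α A) {n : ℕ} (hn : n ≠ 0) : lyap α A ≤ lint α A n / n := by
  have h := g.subadd.lim_le_div g.bdd hn
  rwa [tendsto_nhds_unique (g.subadd.tendsto_lim g.bdd) g.lyap_tendsto] at h

lemma le_lyap (g : GoodC α A) {c : ℝ} (h : ∀ n : ℕ, c * n ≤ lint α A n) : c ≤ lyap α A := by
  apply ge_of_tendsto g.lyap_tendsto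
  filter_upwards [eventually_gt_atTop 0] with n hn
  have : (0 : ℝ) < n := by exact_mod_cast hn
  rw [le_div_iff₀ this]
  exact h n

lemma lyap_nonneg (g : GoodC α A) : 0 ≤ lyap α A :=
  g.le_lyap (fun n => by simpa using g.lint_nonneg n)

end GoodC




/-- normalised jet coefficient -/
def jc (r : ℝ) (f : ℝ → ℝ) (x : ℝ) (i : ℕ) : ℝ := |iteratedDeriv i f x| / (i.factorial : ℝ) * r ^ i

/-- weighted jet norm of order `l` at `x` -/
def jn (l : ℕ) (r : ℝ) (f : ℝ → ℝ) (x : ℝ) : ℝ := ∑ i ∈ Finset.range (l + 1), jc r f x i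

lemma jc_nonneg {r : ℝ} (hr : 0 ≤ r) (f : ℝ → ℝ) (x : ℝ) (i : ℕ) : 0 ≤ jc r f x i := by
  unfold jc; positivity

lemma jn_nonneg (l : ℕ) {r : ℝ} (hr : 0 ≤ r) (f : ℝ → ℝ) (x : ℝ) : 0 ≤ jn l r f x :=
  Finset.sum_nonneg fun i _ => jc_nonneg hr f x i

lemma jc_le_jn {l : ℕ} {r : ℝ} (hr : 0 ≤ r) (f : ℝ → ℝ) (x : ℝ) {i : ℕ} (hi : i ≤ l) :
    jc r f x i ≤ jn l r f x :=
  Finset.single_le_sum (f := fun i => jc r f x i) (fun i _ => jc_nonneg hr f x i)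
    (Finset.mem_range.2 (by omega))

lemma abs_le_jn (l : ℕ) {r : ℝ} (hr : 0 ≤ r) (f : ℝ → ℝ) (x : ℝ) : |f x| ≤ jn l r f x := by
  have := jc_le_jn (l := l) hr f x (Nat.zero_le l)
  simpa [jc] using this

lemma deriv_le_jn {l : ℕ} (f : ℝ → ℝ) (x : ℝ) {i : ℕ} (hi : i ≤ l) :
    |iteratedDeriv i f x| ≤ (l.factorial : ℝ) * jn l 1 f x := by
  have h := jc_le_jn (l := l) zero_le_one f x hi
  simp only [jc, one_pow, mul_one] at h
  have h1 : (0 : ℝ) < i.factorial := by positivity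
  rw [div_le_iff₀ h1] at h
  have h2 : (i.factorial : ℝ) ≤ l.factorial := by exact_mod_cast Nat.factorial_le hi
  have := jn_nonneg l zero_le_one f x
  nlinarith

lemma jn_of_le {l : ℕ} {r : ℝ} {C : ℝ} (hr : 0 ≤ r) (f : ℝ → ℝ) (x : ℝ)
    (h : ∀ i ≤ l, |iteratedDeriv i f x| * r ^ i ≤ C) : jn l r f x ≤ (l + 1) * C := by
  unfold jn
  calc ∑ i ∈ Finset.range (l + 1), jc r f x i ≤ ∑ i ∈ Finset.range (l + 1), C := by
        apply Finset.sum_le_sum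
        intro i hi
        refine le_trans ?_ (h i (by simpa [Nat.lt_succ_iff] using hi))
        unfold jc
        gcongr
        apply div_le_self (abs_nonneg _)
        exact_mod_cast Nat.one_le_iff_ne_zero.2 (Nat.factorial_ne_zero i)
    _ = _ := by simp

lemma jn_congr {l : ℕ} {r : ℝ} {f g : ℝ → ℝ} {x : ℝ} (h : f =ᶠ[nhds x] g) :
    jn l r f x = jn l r g x := by
  unfold jn jc
  refine Finset.sum_congr rfl fun i _ => ?_
  rw [h.iteratedDeriv_eq]

lemma jn_add {l : ℕ} {r : ℝ} (hr : 0 ≤ r) {f g : ℝ → ℝ} (hf : ContDiff ℝ l f) (hg : ContDiff ℝ l g)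
    (x : ℝ) : jn l r (fun y => f y + g y) x ≤ jn l r f x + jn l r g x := by
  unfold jn
  rw [← Finset.sum_add_distrib]
  refine Finset.sum_le_sum fun i hi => ?_
  have hi' : i ≤ l := by simpa [Nat.lt_succ_iff] using hi
  have e : iteratedDeriv i (fun y => f y + g y) x = iteratedDeriv i f x + iteratedDeriv i g x :=
    iteratedDeriv_fun_add ((hf.of_le (by exact_mod_cast hi')).contDiffAt)
      ((hg.of_le (by exact_mod_cast hi')).contDiffAt)
  unfold jc
  rw [e, ← add_mul, ← add_div]
  gcongr
  exact abs_add_le _ _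

lemma jn_neg {l : ℕ} {r : ℝ} (f : ℝ → ℝ) (x : ℝ) : jn l r (fun y => - f y) x = jn l r f x := by
  unfold jn jc
  refine Finset.sum_congr rfl fun i _ => ?_
  rw [iteratedDeriv_fun_neg, abs_neg]

lemma jn_sub {l : ℕ} {r : ℝ} (hr : 0 ≤ r) {f g : ℝ → ℝ} (hf : ContDiff ℝ l f) (hg : ContDiff ℝ l g)
    (x : ℝ) : jn l r (fun y => f y - g y) x ≤ jn l r f x + jn l r g x := by
  have := jn_add hr hf hg.neg x
  rw [jn_neg] at this
  simpa [sub_eq_add_neg] using this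

lemma jn_const {l : ℕ} {r : ℝ} (c x : ℝ) : jn l r (fun _ => c) x = |c| := by
  unfold jn jc
  rw [Finset.sum_eq_single 0]
  · simp
  · intro i _ hi
    simp [iteratedDeriv_const, hi]
  · simp

lemma jn_shift {l : ℕ} {r : ℝ} (f : ℝ → ℝ) (c x : ℝ) :
    jn l r (fun y => f (y + c)) x = jn l r f (x + c) := by
  unfold jn jc
  refine Finset.sum_congr rfl fun i _ => ?_
  rw [iteratedDeriv_comp_add_const]

lemma jn_comp_neg {l : ℕ} {r : ℝ} (f : ℝ → ℝ) (x : ℝ) :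
    jn l r (fun y => f (-y)) x = jn l r f (-x) := by
  unfold jn jc
  refine Finset.sum_congr rfl fun i _ => ?_
  rw [iteratedDeriv_comp_neg]
  simp [abs_mul]

lemma sum_conv_le (F G : ℕ → ℝ) (hF : ∀ i, 0 ≤ F i) (hG : ∀ i, 0 ≤ G i) (l : ℕ) :
    ∑ i ∈ Finset.range (l + 1), ∑ k ∈ Finset.range (i + 1), F k * G (i - k) ≤
      (∑ i ∈ Finset.range (l + 1), F i) * ∑ i ∈ Finset.range (l + 1), G i := by
  rw [Finset.sum_comm' (t' := Finset.range (l+1)) (s' := fun k => Finset.Ico k (l+1))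
    (by intro a b; simp only [Finset.mem_range, Finset.mem_Ico]; omega), Finset.sum_mul]
  refine Finset.sum_le_sum fun k hk => ?_
  rw [← Finset.mul_sum]
  refine mul_le_mul_of_nonneg_left ?_ (hF k)
  rw [Finset.sum_Ico_eq_sum_range]
  simp only [Nat.add_sub_cancel_left]
  exact Finset.sum_le_sum_of_subset_of_nonneg (by intro a; simp only [Finset.mem_range]; omega)
    fun i _ _ => hG i

lemma jc_mul_le {l : ℕ} {r : ℝ} (hr : 0 ≤ r) {f g : ℝ → ℝ} (hf : ContDiff ℝ l f)
    (hg : ContDiff ℝ l g) (x : ℝ) {i : ℕ} (hi : i ≤ l) :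
    jc r (fun y => f y * g y) x i ≤ ∑ k ∈ Finset.range (i + 1), jc r f x k * jc r g x (i - k) := by
  have e : iteratedDeriv i (fun y => f y * g y) x = _ :=
    iteratedDeriv_mul ((hf.of_le (by exact_mod_cast hi)).contDiffAt (x := x))
      ((hg.of_le (by exact_mod_cast hi)).contDiffAt (x := x))
  unfold jc
  rw [e]
  calc _ ≤ (∑ k ∈ Finset.range (i+1), |(i.choose k : ℝ) * iteratedDeriv k f x * iteratedDeriv (i-k) g x|)
        / (i.factorial : ℝ) * r ^ i := by
        gcongr
        exact Finset.abs_sum_le_sum_abs _ _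
    _ = _ := by
        rw [Finset.sum_div, Finset.sum_mul]
        refine Finset.sum_congr rfl fun k hk => ?_
        have hk' : k ≤ i := by simpa [Nat.lt_succ_iff] using hk
        rw [Nat.cast_choose ℝ hk', abs_mul, abs_mul, abs_of_nonneg (by positivity)]
        have : r ^ i = r ^ k * r ^ (i - k) := by rw [← pow_add]; congr 1; omega
        rw [this]
        have h1 : (i.factorial : ℝ) ≠ 0 := by positivity
        have h2 : (k.factorial : ℝ) ≠ 0 := by positivity
        have h3 : ((i-k).factorial : ℝ) ≠ 0 := by positivity
        field_simp

lemma jn_mul {l : ℕ} {r : ℝ} (hr : 0 ≤ r) {f g : ℝ → ℝ} (hf : ContDiff ℝ l f) (hg : ContDiff ℝ l g)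
    (x : ℝ) : jn l r (fun y => f y * g y) x ≤ jn l r f x * jn l r g x := by
  refine le_trans (Finset.sum_le_sum fun i hi => jc_mul_le hr hf hg x
    (by simpa [Nat.lt_succ_iff] using hi)) ?_
  exact sum_conv_le _ _ (jc_nonneg hr f x) (jc_nonneg hr g x) l

lemma jn_pow {l : ℕ} {r : ℝ} (hr : 0 ≤ r) {f : ℝ → ℝ} (hf : ContDiff ℝ l f) (x : ℝ) (m : ℕ) :
    jn l r (fun y => f y ^ m) x ≤ jn l r f x ^ m := by
  induction m with
  | zero => simp [jn_const]
  | succ m ih =>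
    simp only [pow_succ]
    refine (jn_mul hr (hf.pow m) hf x).trans ?_
    gcongr
    exact jn_nonneg l hr f x

lemma jn_inv {l : ℕ} {f : ℝ → ℝ} (hf : ContDiff ℝ l f) (h0 : ∀ x, f x ≠ 0) (x : ℝ) :
    jn l 1 (fun y => (f y)⁻¹) x ≤ (l + 1) * ((jn l 1 f x / |f x|) ^ l / |f x|) := by
  have hfp : 0 < |f x| := abs_pos.2 (h0 x)
  have hg : ContDiff ℝ l (fun y => (f y)⁻¹) := hf.inv h0
  set g := fun y => (f y)⁻¹ with hgd
  set M := jn l 1 f x / |f x| with hM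
  have hM1 : 1 ≤ M := by
    rw [hM, le_div_iff₀ hfp, one_mul]; exact abs_le_jn l zero_le_one f x
  have key : ∀ i ≤ l, jc 1 g x i ≤ M ^ i / |f x| := by
    intro i
    induction i using Nat.strong_induction_on with
    | _ i ih =>
    intro hi
    rcases Nat.eq_zero_or_pos i with rfl | hpos
    · simp [jc, hgd, abs_inv]
    · have e : iteratedDeriv i (fun y => f y * g y) x = _ :=
        iteratedDeriv_mul ((hf.of_le (by exact_mod_cast hi)).contDiffAt (x := x))
          ((hg.of_le (by exact_mod_cast hi)).contDiffAt (x := x))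
      have e0 : (fun y => f y * g y) = fun _ => (1:ℝ) := by
        funext y; simp [hgd, h0 y]
      rw [e0, iteratedDeriv_const, if_neg hpos.ne', Finset.sum_range_succ'] at e
      simp only [Nat.choose_zero_right, Nat.cast_one, one_mul, iteratedDeriv_zero, Nat.sub_zero] at e
      have e1 : f x * iteratedDeriv i g x = - ∑ k ∈ Finset.range i, ((i.choose (k+1) : ℕ) : ℝ) *
          iteratedDeriv (k+1) f x * iteratedDeriv (i - (k+1)) g x := by linarith
      have e2 : |f x| * jc 1 g x i ≤ ∑ k ∈ Finset.range i, jc 1 f x (k+1) * jc 1 g x (i - (k+1)) := by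
        unfold jc
        simp only [one_pow, mul_one]
        rw [← mul_div_assoc, ← abs_mul, e1, abs_neg]
        calc _ ≤ (∑ k ∈ Finset.range i, |((i.choose (k+1) : ℕ) : ℝ) *
          iteratedDeriv (k+1) f x * iteratedDeriv (i - (k+1)) g x|) / (i.factorial : ℝ) := by
              gcongr
              exact Finset.abs_sum_le_sum_abs _ _
          _ = _ := by
              rw [Finset.sum_div]
              refine Finset.sum_congr rfl fun k hk => ?_
              have hk' : k + 1 ≤ i := by simpa using hk
              rw [Nat.cast_choose ℝ hk', abs_mul, abs_mul, abs_of_nonneg (by positivity)]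
              have h1 : (i.factorial : ℝ) ≠ 0 := by positivity
              have h2 : ((k+1).factorial : ℝ) ≠ 0 := by positivity
              have h3 : ((i-(k+1)).factorial : ℝ) ≠ 0 := by positivity
              field_simp
      have e3 : ∑ k ∈ Finset.range i, jc 1 f x (k+1) * jc 1 g x (i - (k+1)) ≤
          ∑ k ∈ Finset.range i, jc 1 f x (k+1) * (M ^ (i-1) / |f x|) := by
        refine Finset.sum_le_sum fun k hk => ?_
        have hk' : k + 1 ≤ i := by simpa using hk
        refine mul_le_mul_of_nonneg_left ?_ (jc_nonneg zero_le_one f x _)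
        refine (ih (i-(k+1)) (by omega) (by omega)).trans ?_
        gcongr
        omega
      have e4 : ∑ k ∈ Finset.range i, jc 1 f x (k+1) ≤ jn l 1 f x := by
        unfold jn
        rw [Finset.sum_range_succ' _ l]
        have := jc_nonneg zero_le_one f x 0
        have : ∑ k ∈ Finset.range i, jc 1 f x (k+1) ≤ ∑ k ∈ Finset.range l, jc 1 f x (k+1) :=
          Finset.sum_le_sum_of_subset_of_nonneg (by intro a; simp only [Finset.mem_range]; omega)
            fun i _ _ => jc_nonneg zero_le_one f x _
        linarith
      rw [← Finset.sum_mul] at e3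
      have e5 : |f x| * jc 1 g x i ≤ jn l 1 f x * (M ^ (i-1) / |f x|) :=
        e2.trans (e3.trans (by gcongr))
      have e6 : jn l 1 f x = M * |f x| := by rw [hM]; field_simp
      rw [e6] at e5
      have : M ^ i = M ^ (i-1) * M := by rw [← pow_succ]; congr 1; omega
      rw [this]
      have e7 : M * |f x| * (M ^ (i-1) / |f x|) = |f x| * (M ^ (i - 1) * M / |f x|) := by field_simp
      rw [e7] at e5
      exact le_of_mul_le_mul_left e5 hfp
  calc jn l 1 g x ≤ ∑ i ∈ Finset.range (l+1), M ^ l / |f x| := by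
        refine Finset.sum_le_sum fun i hi => ?_
        have hi' : i ≤ l := by simpa [Nat.lt_succ_iff] using hi
        refine (key i hi').trans ?_
        gcongr
    _ = _ := by simp

lemma jn_rescale {l : ℕ} {r : ℝ} (hr : 0 < r) (hr1 : r ≤ 1) (f : ℝ → ℝ) (x : ℝ) :
    jn l 1 f x ≤ (r⁻¹) ^ l * jn l r f x := by
  unfold jn
  rw [Finset.mul_sum]
  refine Finset.sum_le_sum fun i hi => ?_
  have hi' : i ≤ l := by simpa [Nat.lt_succ_iff] using hi
  unfold jc
  have h1 : (1:ℝ) ≤ r⁻¹ := (one_le_inv₀ hr).2 hr1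
  have h2 : 1 ≤ (r⁻¹) ^ l * r ^ i := by
    calc (1:ℝ) = (r⁻¹)^i * r ^ i := by rw [← mul_pow, inv_mul_cancel₀ hr.ne', one_pow]
      _ ≤ _ := by gcongr
  have h3 : 0 ≤ |iteratedDeriv i f x| / (i.factorial : ℝ) := by positivity
  rw [one_pow, mul_one]
  nlinarith

lemma jn_sum {l : ℕ} {r : ℝ} (hr : 0 ≤ r) (s : Finset ℕ) {f : ℕ → ℝ → ℝ} (hf : ∀ n ∈ s, ContDiff ℝ l (f n))
    (x : ℝ) : jn l r (fun y => ∑ n ∈ s, f n y) x ≤ ∑ n ∈ s, jn l r (f n) x := by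
  classical
  induction s using Finset.induction_on with
  | empty => simp [jn_const]
  | insert a s ha ih =>
    simp only [Finset.sum_insert ha]
    refine (jn_add hr (hf a (by simp)) (ContDiff.sum fun i hi => hf i (by simp [hi])) x).trans ?_
    gcongr
    exact ih fun n hn => hf n (by simp [hn])




lemma abs_iteratedDeriv_cos (i : ℕ) (y : ℝ) : |iteratedDeriv i Real.cos y| ≤ 1 := by
  rcases Nat.even_or_odd' i with ⟨k, rfl | rfl⟩
  · rw [Real.iteratedDeriv_even_cos]
    simp [abs_mul, Real.abs_cos_le_one]
  · rw [Real.iteratedDeriv_odd_cos]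
    simp [abs_mul, Real.abs_sin_le_one]

lemma us_eq (x : ℝ) : us x = 1/2 - (1/2) * Real.cos ((2 * Real.pi) * x) := by
  unfold us
  rw [Real.sin_sq_eq_half_sub]
  ring_nf

lemma us_contDiff {n : WithTop ℕ∞} : ContDiff ℝ n us := by
  unfold us; fun_prop

lemma us_iter (i : ℕ) (hi : 1 ≤ i) (x : ℝ) : |iteratedDeriv i us x| ≤ 7 ^ i := by
  have e : us = fun x => 1/2 + (-(1/2)) * Real.cos ((2 * Real.pi) * x) := by
    funext x; rw [us_eq]; ring
  rw [e, iteratedDeriv_const_add (by omega), iteratedDeriv_const_mul_field,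
    iteratedDeriv_comp_const_mul Real.contDiff_cos]
  have h1 := abs_iteratedDeriv_cos i (2 * Real.pi * x)
  have h2 : |2 * Real.pi| ^ i ≤ 7 ^ i := by
    rw [abs_of_nonneg (by positivity)]
    gcongr
    have := Real.pi_lt_d2
    norm_num at this; linarith
  simp only [abs_mul, abs_pow]
  have h4 : 0 ≤ |2 * Real.pi| ^ i := by positivity
  have h5 : (|2| * |Real.pi|) ^ i * |iteratedDeriv i Real.cos (2 * Real.pi * x)| ≤ 7 ^ i * 1 := by
    rw [← abs_mul]
    gcongr
  have h6 : |-(1/2 : ℝ)| = 1/2 := by norm_num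
  rw [h6]
  have : (0:ℝ) ≤ 7 ^ i := by positivity
  generalize (|2| * |Real.pi|) ^ i * |iteratedDeriv i Real.cos (2 * Real.pi * x)| = X at *
  generalize (7:ℝ) ^ i = Y at *
  linarith

lemma us_deriv (x : ℝ) : |iteratedDeriv 1 us x| ≤ 7 * Real.sqrt (us x) := by
  have h : HasDerivAt us (2 * Real.sin (Real.pi * x) * (Real.cos (Real.pi * x) * Real.pi)) x := by
    unfold us
    have h1 : HasDerivAt (fun x => Real.pi * x) Real.pi x := by
      simpa using (hasDerivAt_id x).const_mul Real.pi
    have := (h1.sin).pow 2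
    refine this.congr_deriv ?_
    simp
  rw [iteratedDeriv_one, h.deriv]
  have e : Real.sqrt (us x) = |Real.sin (Real.pi * x)| := Real.sqrt_sq_eq_abs _
  rw [e]
  simp only [abs_mul]
  have h1 := Real.abs_cos_le_one (Real.pi * x)
  have h2 : |Real.pi| ≤ 3.5 := by
    rw [abs_of_pos Real.pi_pos]; have := Real.pi_lt_d2; norm_num at *; linarith
  have h3 : |Real.cos (Real.pi * x)| * |Real.pi| ≤ 1 * 3.5 := by gcongr
  have h4 := abs_nonneg (Real.sin (Real.pi * x))
  rw [abs_of_pos (by norm_num : (0:ℝ) < 2)]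
  nlinarith

/-- jets of `us` near the zero -/
lemma jn_us (l : ℕ) {r : ℝ} (hr : 0 < r) (hr1 : r ≤ 1) {x : ℝ} (hx : us x ≤ r ^ 2) :
    jn l r us x ≤ (l + 1) * (7 ^ (l + 1) * r ^ 2) := by
  apply jn_of_le hr.le
  intro i hi
  have h7 : (1:ℝ) ≤ 7 ^ (l+1) := one_le_pow₀ (by norm_num)
  have hr2 : 0 < r ^ 2 := by positivity
  rcases i with _ | _ | i
  · simp only [iteratedDeriv_zero, pow_zero, mul_one]
    rw [abs_of_nonneg (us_nonneg x)]
    nlinarith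
  · simp only [zero_add, pow_one]
    have h1 := us_deriv x
    have h2 : Real.sqrt (us x) ≤ r := by
      rw [Real.sqrt_le_left hr.le]; exact hx
    have h77 : (7:ℝ) ≤ 7 ^ (l+1) := by
      calc (7:ℝ) = 7 ^ 1 := by norm_num
        _ ≤ _ := pow_le_pow_right₀ (by norm_num) (by omega)
    calc |iteratedDeriv 1 us x| * r ≤ (7 * r) * r := by gcongr; linarith
      _ = 7 * r ^ 2 := by ring
      _ ≤ _ := by gcongr
  · have h1 := us_iter (i+1+1) (by omega) x
    have h2 : r ^ (i+1+1) ≤ r ^ 2 := pow_le_pow_of_le_one hr.le hr1 (by omega)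
    have h3 : (7:ℝ) ^ (i+1+1) ≤ 7 ^ (l+1) := pow_le_pow_right₀ (by norm_num) (by omega)
    gcongr
    exact h1.trans h3

lemma sT_contDiff (n : ℕ) : ContDiff ℝ n Real.smoothTransition := by
  exact_mod_cast Real.smoothTransition.contDiff (n := (n : ℕ∞))

lemma sT_neg (i : ℕ) (y : ℝ) (hy : y ≤ 0) : iteratedDeriv i Real.smoothTransition y = 0 := by
  have hc : Continuous (iteratedDeriv i Real.smoothTransition) :=
    (sT_contDiff i).continuous_iteratedDeriv i le_rfl
  have hcl : IsClosed {y | iteratedDeriv i Real.smoothTransition y = 0} :=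
    isClosed_eq hc continuous_const
  have hsub : Set.Iio (0:ℝ) ⊆ {y | iteratedDeriv i Real.smoothTransition y = 0} := by
    intro z hz
    have : Real.smoothTransition =ᶠ[nhds z] fun _ => 0 := by
      filter_upwards [Iio_mem_nhds hz] with t ht
      exact Real.smoothTransition.zero_of_nonpos (le_of_lt ht)
    show iteratedDeriv i Real.smoothTransition z = 0
    rw [this.iteratedDeriv_eq, iteratedDeriv_const]
    simp
  have := closure_minimal hsub hcl
  rw [closure_Iio] at this
  exact this hy

lemma sT_bdd (l : ℕ) : ∃ C : ℝ, 1 ≤ C ∧ ∀ i ≤ l, ∀ y, |iteratedDeriv i Real.smoothTransition y| ≤ C := by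
  have h1 : ∀ i : ℕ, ∃ C : ℝ, ∀ y, |iteratedDeriv i Real.smoothTransition y| ≤ C := by
    intro i
    have hc : Continuous (iteratedDeriv i Real.smoothTransition) :=
      (sT_contDiff i).continuous_iteratedDeriv i le_rfl
    obtain ⟨C, hC⟩ := (isCompact_Icc (a := (0:ℝ)) (b := 1)).exists_bound_of_continuousOn hc.continuousOn
    refine ⟨max C 1, fun y => ?_⟩
    rcases le_or_gt y 0 with h | h
    · rw [sT_neg i y h]; simp
    rcases le_or_gt y 1 with h' | h'
    · exact (hC y ⟨h.le, h'⟩).trans (le_max_left _ _)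
    · have : Real.smoothTransition =ᶠ[nhds y] fun _ => 1 := by
        filter_upwards [Ioi_mem_nhds h'] with t ht
        exact Real.smoothTransition.one_of_one_le (le_of_lt ht)
      rw [this.iteratedDeriv_eq, iteratedDeriv_const]
      refine le_trans ?_ (le_max_right _ _)
      split_ifs <;> simp
  choose C hC using h1
  refine ⟨1 + ∑ i ∈ Finset.range (l+1), |C i|, ?_, fun i hi y => ?_⟩
  · have := Finset.sum_nonneg (s := Finset.range (l+1)) (f := fun i => |C i|) fun i _ => abs_nonneg _
    linarith
  · have := Finset.single_le_sum (s := Finset.range (l+1)) (f := fun i => |C i|) (fun i _ => abs_nonneg _)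
      (Finset.mem_range.2 (Nat.lt_succ_of_le hi))
    have h2 := le_abs_self (C i)
    have h3 := hC i y
    linarith

/-- cutoff -/
def chi (q : ℕ → ℕ) (j : ℕ) (x : ℝ) : ℝ := Real.smoothTransition (2 - 2 * us x / eps q j)

lemma chi_contDiff (q : ℕ → ℕ) (j n : ℕ) : ContDiff ℝ n (chi q j) := by
  unfold chi
  exact (sT_contDiff n).comp (contDiff_const.sub ((contDiff_const.mul us_contDiff).div_const _))

lemma chi_nonneg (q : ℕ → ℕ) (j : ℕ) (x : ℝ) : 0 ≤ chi q j x := Real.smoothTransition.nonneg _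
lemma chi_le_one (q : ℕ → ℕ) (j : ℕ) (x : ℝ) : chi q j x ≤ 1 := Real.smoothTransition.le_one _
lemma chi_neg (q : ℕ → ℕ) (j : ℕ) (x : ℝ) : chi q j (-x) = chi q j x := by simp [chi, us_neg]
lemma chi_per (q : ℕ → ℕ) (j : ℕ) (x : ℝ) : chi q j (x+1) = chi q j x := by simp [chi, us_per]

lemma chi_core {q : ℕ → ℕ} {j : ℕ} (he : 0 < eps q j) {x : ℝ} (hx : us x ≤ eps q j / 2) :
    chi q j x = 1 := by
  apply Real.smoothTransition.one_of_one_le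
  have : 2 * us x / eps q j ≤ 1 := by rw [div_le_one he]; linarith
  linarith

lemma chi_arg_off {q : ℕ → ℕ} {j : ℕ} (he : 0 < eps q j) {x : ℝ} (hx : ¬ Ij q j x) :
    2 - 2 * us x / eps q j ≤ 0 := by
  have : 2 ≤ 2 * us x / eps q j := by
    rw [le_div_iff₀ he]; unfold Ij at hx; linarith
  linarith

lemma chi_off {q : ℕ → ℕ} {j : ℕ} (he : 0 < eps q j) {x : ℝ} (hx : ¬ Ij q j x) :
    chi q j x = 0 := Real.smoothTransition.zero_of_nonpos (chi_arg_off he hx)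

lemma chi_iter_gen {q : ℕ → ℕ} {j : ℕ} (he : 0 < eps q j) (he1 : eps q j ≤ 1) (n : ℕ) (x C : ℝ)
    (hC : ∀ i ≤ n, |iteratedDeriv i Real.smoothTransition (2 - 2 * us x / eps q j)| ≤ C) :
    |iteratedDeriv n (chi q j) x| ≤ n.factorial * C * (14 / eps q j) ^ n := by
  have hf : ContDiff ℝ n (fun x => 2 - 2 * us x / eps q j) :=
    contDiff_const.sub ((contDiff_const.mul us_contDiff).div_const _)
  have := norm_iteratedFDeriv_comp_le (sT_contDiff n) hf le_rfl x (C := C) (D := 14 / eps q j)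
    (by
      intro i hi
      rw [norm_iteratedFDeriv_eq_norm_iteratedDeriv]
      exact hC i hi)
    (by
      intro i h1 hi
      rw [norm_iteratedFDeriv_eq_norm_iteratedDeriv, Real.norm_eq_abs]
      have e : (fun x => 2 - 2 * us x / eps q j) = fun x => 2 + (-(2 / eps q j)) * us x := by
        funext x; ring
      rw [e, iteratedDeriv_const_add (by omega), iteratedDeriv_const_mul_field, abs_mul, abs_neg,
        abs_of_pos (by positivity)]
      calc 2 / eps q j * |iteratedDeriv i us x| ≤ (2 / eps q j) ^ i * 7 ^ i := by
            gcongr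
            · apply le_self_pow₀ _ (by omega)
              rw [le_div_iff₀ he]; linarith
            · exact us_iter i h1 x
        _ = _ := by rw [← mul_pow]; congr 1; ring)
  rw [norm_iteratedFDeriv_eq_norm_iteratedDeriv] at this
  exact this

lemma jn_chi_off {q : ℕ → ℕ} {j : ℕ} (he : 0 < eps q j) (he1 : eps q j ≤ 1) (l : ℕ) {x : ℝ}
    (hx : ¬ Ij q j x) : jn l 1 (chi q j) x = 0 := by
  unfold jn
  refine Finset.sum_eq_zero fun i _ => ?_
  have := chi_iter_gen he he1 i x 0 (fun k _ => by rw [sT_neg k _ (chi_arg_off he hx)]; simp)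
  have h2 : |iteratedDeriv i (chi q j) x| = 0 := le_antisymm (by simpa using this) (abs_nonneg _)
  simp [jc, h2]

lemma jn_chi (l : ℕ) : ∃ C : ℝ, 1 ≤ C ∧ ∀ (q : ℕ → ℕ) (j : ℕ), 0 < eps q j → eps q j ≤ 1 →
    ∀ x, jn l 1 (chi q j) x ≤ C / eps q j ^ l := by
  obtain ⟨C, hC1, hC⟩ := sT_bdd l
  have hf1 : (1:ℝ) ≤ l.factorial := by exact_mod_cast Nat.one_le_iff_ne_zero.2 (Nat.factorial_ne_zero l)
  refine ⟨(l+1) * (l.factorial * C * 14 ^ l), ?_, fun q j he he1 x => ?_⟩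
  · have : (1:ℝ) ≤ 14 ^ l := one_le_pow₀ (by norm_num)
    have h1 : (1:ℝ) ≤ l + 1 := by have : (0:ℝ) ≤ l := Nat.cast_nonneg l; linarith
    exact one_le_mul_of_one_le_of_one_le h1
      (one_le_mul_of_one_le_of_one_le (one_le_mul_of_one_le_of_one_le hf1 hC1) this)
  · rw [mul_div_assoc]
    apply jn_of_le zero_le_one
    intro i hi
    have := chi_iter_gen he he1 i x C (fun k hk => hC k (hk.trans hi) _)
    rw [one_pow, mul_one]
    refine this.trans ?_
    rw [mul_div_assoc, ← div_pow]
    gcongr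
    rw [le_div_iff₀ he]; linarith

/-- geometric limits in `C^l` -/
lemma limit_lemma (l : ℕ) (f : ℕ → ℝ → ℝ) (c : ℝ) (hf : ∀ j, ContDiff ℝ l (f j))
    (h : ∀ j, ∀ i ≤ l, ∀ x, |iteratedDeriv i (fun y => f (j+1) y - f j y) x| ≤ c * (1/2) ^ j) :
    ∃ g : ℝ → ℝ, ContDiff ℝ l g ∧ ∀ j, ∀ i ≤ l, ∀ x,
      |iteratedDeriv i (fun y => f j y - g y) x| ≤ 2 * c * (1/2) ^ j := by
  set d : ℕ → ℝ → ℝ := fun j y => f (j+1) y - f j y with hd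
  have hdc : ∀ j, ContDiff ℝ ((l : ℕ∞) : WithTop ℕ∞) (d j) := fun j => (hf (j+1)).sub (hf j)
  have hsum : ∀ j : ℕ, Summable (fun k : ℕ => c * (1/2 : ℝ) ^ (k + j)) := by
    intro j
    have := ((summable_geometric_of_lt_one (by norm_num : (0:ℝ) ≤ 1/2) (by norm_num)).mul_left c)
    exact (summable_nat_add_iff j).2 this
  have hb : ∀ (j k i : ℕ) (x : ℝ), (k : ℕ∞) ≤ (l : ℕ∞) →
      ‖iteratedFDeriv ℝ k (d (i + j)) x‖ ≤ c * (1/2) ^ (i + j) := by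
    intro j k i x hk
    rw [norm_iteratedFDeriv_eq_norm_iteratedDeriv]
    exact h (i+j) k (by exact_mod_cast hk) x
  have hpt : ∀ y, Summable fun k => d k y := by
    intro y
    refine Summable.of_norm_bounded (hsum 0) fun k => ?_
    have := h k 0 (Nat.zero_le _) y
    simpa using this
  refine ⟨fun y => f 0 y + ∑' k, d k y, ?_, ?_⟩
  · refine (hf 0).add ?_
    exact contDiff_tsum (N := (l : ℕ∞)) hdc (fun k _ => hsum 0) (fun k i x hk => hb 0 k i x hk)
  · intro j i hi x
    have e : (fun y => f j y - (f 0 y + ∑' k, d k y)) = fun y => - ∑' k, d (k + j) y := by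
      funext y
      have h1 := (hpt y).sum_add_tsum_nat_add j
      have h2 : ∑ k ∈ Finset.range j, d k y = f j y - f 0 y := Finset.sum_range_sub (fun k => f k y) j
      linarith
    rw [e, iteratedDeriv_fun_neg, abs_neg, ← Real.norm_eq_abs,
      ← norm_iteratedFDeriv_eq_norm_iteratedDeriv (𝕜 := ℝ)]
    rw [iteratedFDeriv_tsum (N := (l : ℕ∞)) (v := fun _ k => c * (1/2 : ℝ) ^ (k + j))
      (fun k => hdc (k+j)) (fun k _ => hsum j) (fun k i x hk => hb j k i x hk) (by exact_mod_cast hi)]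
    have h3 : HasSum (fun k : ℕ => c * (1/2 : ℝ) ^ (k + j)) (2 * c * (1/2) ^ j) := by
      have := (hasSum_geometric_two).mul_left (c * (1/2 : ℝ) ^ j)
      have e1 : (fun k : ℕ => c * (1/2 : ℝ) ^ (k + j)) = fun k => c * (1/2 : ℝ) ^ j * (1/2) ^ k := by
        funext k; ring
      have e2 : 2 * c * (1/2) ^ j = c * (1/2 : ℝ) ^ j * 2 := by ring
      rw [e1, e2]
      exact this
    exact tsum_of_norm_bounded h3 fun k => hb j i k x (by exact_mod_cast hi)




def gg (β : ℝ) (q : ℕ → ℕ) (m : ℕ) (t : ℝ) : ℝ := t * (1 - 1 / (q 0 : ℝ)) - m * QS.Cs β q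
def GG (β : ℝ) (q : ℕ → ℕ) (m : ℕ) (t : ℝ) : ℝ := Real.exp (gg β q m t)
def eta (B : ℝ) (q : ℕ → ℕ) (j : ℕ) : ℝ := Real.exp (-B * q j)
def Lam (t : ℝ) : ℝ := Real.exp t + 1

lemma growth {α β : ℝ} {q : ℕ → ℕ} (Q : QS α β q) {m : ℕ} {t : ℝ} (ht : 0 ≤ t) {P w : ℝ → ℝ}
    (hw : ∀ x, 0 < w x) (hw1 : ∀ x, Ij q 0 x → us x ^ m ≤ w x) (hw2 : ∀ x, ¬ Ij q 0 x → Real.exp t ≤ w x)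
    (hprod : ∀ x n, ∏ i ∈ Finset.range n, w (x + i * α) ≤ ea α P n x) (j : ℕ) :
    Grow α P (Ij q j) (GG β q m t) := by
  classical
  intro z n hz hn
  refine le_trans ?_ (hprod (z + α) n)
  have hpp : 0 < ∏ i ∈ Finset.range n, w (z + α + i * α) := Finset.prod_pos fun i _ => hw _
  rw [GG, ← Real.exp_nat_mul, ← Real.le_log_iff_exp_le hpp, Real.log_prod (fun i _ => (hw _).ne')]
  have h1 := Q.sumlog j z n hz hn
  have h2 := Q.visits z n (Q.Ij_anti (Nat.zero_le j) hz)
  have h3 : ∑ i ∈ Finset.range n, ((if Ij q 0 (z + α + i * α) then 0 else t) -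
      m * (-Real.log (us (z + α + i * α)))) ≤ ∑ i ∈ Finset.range n, Real.log (w (z + α + i * α)) := by
    refine Finset.sum_le_sum fun i hi => ?_
    have hi' : i < n := by simpa using hi
    have hnI := hn (i+1) (by omega) (by omega)
    have e : z + ((i + 1 : ℕ) : ℝ) * α = z + α + i * α := by push_cast; ring
    rw [e] at hnI
    have hup : 0 < us (z + α + i * α) := by
      unfold Ij at hnI
      have := Q.eps_pos j
      linarith
    have hl : Real.log (us (z + α + i * α)) ≤ 0 := Real.log_nonpos hup.le (us_le_one _)
    split_ifs with hI
    · have := Real.log_le_log (by positivity) (hw1 _ hI)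
      rw [Real.log_pow] at this
      linarith
    · have := Real.log_le_log (by positivity) (hw2 _ hI)
      rw [Real.log_exp] at this
      have : (m:ℝ) * Real.log (us (z + α + i * α)) ≤ 0 :=
        mul_nonpos_of_nonneg_of_nonpos (Nat.cast_nonneg m) hl
      linarith
  rw [Finset.sum_sub_distrib, ← Finset.mul_sum] at h3
  have h4 : ∑ i ∈ Finset.range n, (if Ij q 0 (z + α + i * α) then 0 else t) =
      t * n - t * (((Finset.range n).filter (fun i : ℕ => Ij q 0 (z + α + i * α))).card : ℝ) := by
    have : ∀ i ∈ Finset.range n, (if Ij q 0 (z + α + i * α) then 0 else t) =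
        t - (if Ij q 0 (z + α + i * α) then t else 0) := by
      intro i _; split_ifs <;> simp
    rw [Finset.sum_congr rfl this, Finset.sum_sub_distrib, ← Finset.sum_filter]
    simp; ring
  rw [h4] at h3
  refine le_trans ?_ h3
  have h5 := mul_le_mul_of_nonneg_left h2 ht
  have h6 := mul_le_mul_of_nonneg_left h1 (Nat.cast_nonneg (α := ℝ) m)
  unfold gg
  have e : (n:ℝ) * (t * (1 - 1 / (q 0 : ℝ)) - m * QS.Cs β q) =
    t * n - t * (n / q 0) - m * (QS.Cs β q * n) := by ring
  rw [e]
  linarith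

/-- The inductive construction. -/
def PP (α : ℝ) (q : ℕ → ℕ) (m : ℕ) (B t : ℝ) : ℕ → ℝ → ℝ
  | 0, _ => Lam t
  | j + 1, x => PP α q m B t j x + chi q j x *
      (Rr α (PP α q m B t j) (q j - 1) x + Rr α (PP α q m B t j) (q j - 1) (-x) + us x ^ m + eta B q j
        - PP α q m B t j x)

def ww (q : ℕ → ℕ) (m : ℕ) (B t : ℝ) (j : ℕ) (x : ℝ) : ℝ :=
  if us x < eps q 0 then us x ^ m + eta B q j / 2 else Real.exp t

structure Par (α β : ℝ) (q : ℕ → ℕ) (m : ℕ) (B t : ℝ) : Prop where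
  Q : QS α β q
  hq : 2 ≤ q 0
  hB : 1 ≤ B
  ht : 2 ≤ t
  hg : 2 * B + 4 ≤ gg β q m t

structure Invt (α : ℝ) (q : ℕ → ℕ) (m : ℕ) (B t : ℝ) (j : ℕ) : Prop where
  even : ∀ x, PP α q m B t j (-x) = PP α q m B t j x
  per : ∀ x, PP α q m B t j (x + 1) = PP α q m B t j x
  nonneg : ∀ x, 0 ≤ PP α q m B t j x
  le : ∀ x, PP α q m B t j x ≤ Lam t
  smooth : ∀ n : ℕ, ContDiff ℝ n (PP α q m B t j)
  prod : ∀ x n, ∏ i ∈ Finset.range n, ww q m B t j (x + i * α) ≤ ea α (PP α q m B t j) n x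
  cond : ∀ z, Ij q j z → Rr α (PP α q m B t j) (q j - 1) z + Rr α (PP α q m B t j) (q j - 1) (-z)
    + us z ^ m + eta B q j ≤ PP α q m B t j z

lemma ea_contDiff {α : ℝ} {P : ℝ → ℝ} {l : ℕ} (hP : ContDiff ℝ l P) (n : ℕ) :
    ContDiff ℝ l (ea α P n) ∧ ContDiff ℝ l (ec α P n) := by
  induction n with
  | zero =>
    constructor
    · have : ea α P 0 = fun _ => 1 := funext (ea_zero α P)
      rw [this]; exact contDiff_const
    · have : ec α P 0 = fun _ => 0 := funext (ec_zero α P)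
      rw [this]; exact contDiff_const
  | succ n ih =>
    constructor
    · have : ea α P (n+1) = fun x => P (x + n * α) * ea α P n x - ec α P n x := funext (ea_succ α P n)
      rw [this]
      exact ((hP.comp (contDiff_id.add contDiff_const)).mul ih.1).sub ih.2
    · have : ec α P (n+1) = ea α P n := funext (ec_succ α P n)
      rw [this]; exact ih.1

lemma eb_contDiff {α : ℝ} {P : ℝ → ℝ} {l : ℕ} (hP : ContDiff ℝ l P) (n : ℕ) :
    ContDiff ℝ l (eb α P n) := by
  rcases n with _ | n
  · have : eb α P 0 = fun _ => 0 := funext (eb_zero α P)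
    rw [this]; exact contDiff_const
  · have : eb α P (n+1) = fun x => - ea α P n (x + α) := funext (eb_succ' α P n)
    rw [this]
    exact ((ea_contDiff hP n).1.comp (contDiff_id.add contDiff_const)).neg

lemma Rr_contDiff {α : ℝ} {P : ℝ → ℝ} {l : ℕ} (hP : ContDiff ℝ l P) (n : ℕ)
    (h0 : ∀ x, ea α P n x ≠ 0) : ContDiff ℝ l (Rr α P n) := by
  have : Rr α P n = fun z => - eb α P n (z + α) / ea α P n (z + α) := rfl
  rw [this]
  exact ((eb_contDiff hP n).comp (contDiff_id.add contDiff_const)).neg.div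
    ((ea_contDiff hP n).1.comp (contDiff_id.add contDiff_const)) fun x => h0 _

lemma Sc_per {P : ℝ → ℝ} (hP : ∀ x, P (x+1) = P x) : Function.Periodic (Sc P) 1 := by
  intro x; simp [Sc, hP]

lemma Rr_per {α : ℝ} {P : ℝ → ℝ} (hP : ∀ x, P (x+1) = P x) (n : ℕ) (z : ℝ) :
    Rr α P n (z + 1) = Rr α P n z := by
  unfold Rr ea eb
  rw [show z + 1 + α = z + α + 1 by ring, coc_per α _ (Sc_per hP) n]

namespace Par
variable {α β : ℝ} {q : ℕ → ℕ} {m : ℕ} {B t : ℝ}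

lemma eta_pos (j : ℕ) : 0 < eta B q j := Real.exp_pos _

lemma eta_le_one (p : Par α β q m B t) (j : ℕ) : eta B q j ≤ 1 := by
  unfold eta
  rw [Real.exp_le_one_iff]
  have := p.hB; have := p.Q.posR j
  nlinarith

lemma eta_half (p : Par α β q m B t) (j : ℕ) : eta B q (j+1) ≤ eta B q j / 2 := by
  have hB := p.hB
  have h1 : (2 * q j : ℝ) ≤ q (j+1) := by exact_mod_cast p.Q.dbl j
  have h2 := p.Q.posR j
  unfold eta
  calc Real.exp (-B * q (j+1)) ≤ Real.exp (-B * q j - 1) := by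
        rw [Real.exp_le_exp]; nlinarith
    _ = Real.exp (-B * q j) / Real.exp 1 := Real.exp_sub _ _
    _ ≤ _ := by
        gcongr
        have := Real.add_one_le_exp (1:ℝ); linarith

lemma exp_t (p : Par α β q m B t) : 3 ≤ Real.exp t := by
  have := Real.add_one_le_exp t; have := p.ht; linarith

lemma ww_pos (j : ℕ) (x : ℝ) : 0 < ww q m B t j x := by
  unfold ww
  split_ifs
  · have := eta_pos (B := B) (q := q) j
    have := pow_nonneg (us_nonneg x) m
    linarith
  · exact Real.exp_pos _

lemma hG2 (p : Par α β q m B t) : 2 ≤ GG β q m t := by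
  have := Real.add_one_le_exp (gg β q m t)
  have := p.hg; have := p.hB
  unfold GG; linarith

lemma grow (p : Par α β q m B t) (i : ℕ) (iv : Invt α q m B t i) (j : ℕ) :
    Grow α (PP α q m B t i) (Ij q j) (GG β q m t) := by
  refine growth p.Q (by linarith [p.ht]) (ww_pos (m := m) (t := t) (B := B) i) ?_ ?_ iv.prod j
  · intro x hx
    unfold Ij at hx
    simp only [ww, if_pos hx]
    have := eta_pos (B := B) (q := q) i
    linarith
  · intro x hx
    unfold Ij at hx
    simp only [ww, if_neg hx]; exact le_rfl

lemma ea_pos {j : ℕ} (iv : Invt α q m B t j) (n : ℕ) (x : ℝ) : 0 < ea α (PP α q m B t j) n x :=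
  lt_of_lt_of_le (Finset.prod_pos fun i _ => ww_pos j _) (iv.prod x n)

lemma noret (p : Par α β q m B t) (j : ℕ) {z : ℝ} (hz : Ij q j z) : NoRet α (Ij q j) z (q j - 1) := by
  intro k h1 h2 h3
  have := p.Q.ret j hz h3 h1
  have := p.Q.pos j
  omega

lemma R_nonneg (p : Par α β q m B t) (i : ℕ) (iv : Invt α q m B t i) (j n : ℕ) {z : ℝ} (hz : Ij q j z)
    (hn : NoRet α (Ij q j) z n) : 0 ≤ Rr α (PP α q m B t i) n z := by
  have := (Rr_tele p.hG2 (p.grow i iv j) hz 0 n (Nat.zero_le _) hn).1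
  rwa [Rr_zero] at this

lemma Ij_neg {j : ℕ} {x : ℝ} (h : Ij q j x) : Ij q j (-x) := by
  unfold Ij at *; rwa [us_neg]

lemma GN (p : Par α β q m B t) (j : ℕ) : 16 / eta B q j ^ 2 ≤ GG β q m t ^ (2 * (q j - 1)) := by
  have hB := p.hB
  have hg := p.hg
  have hqj : (2:ℝ) ≤ q j := by exact_mod_cast p.hq.trans (p.Q.mono (Nat.zero_le j))
  have hq1 : 1 ≤ q j := p.Q.pos j
  have e16 : (16:ℝ) ≤ Real.exp 4 := by
    have h := Real.add_one_le_exp (1:ℝ)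
    have : Real.exp 4 = Real.exp 1 ^ 4 := by rw [← Real.exp_nat_mul]; norm_num
    rw [this]
    calc (16:ℝ) = 2 ^ 4 := by norm_num
      _ ≤ _ := by gcongr; linarith
  rw [div_le_iff₀ (by have := eta_pos (B := B) (q := q) j; positivity)]
  unfold GG eta
  rw [← Real.exp_nat_mul, ← Real.exp_nat_mul, ← Real.exp_add]
  refine e16.trans ?_
  rw [Real.exp_le_exp]
  push_cast [Nat.cast_sub hq1]
  nlinarith [mul_le_mul_of_nonneg_left hg (by linarith : (0:ℝ) ≤ 2 * (q j - 1))]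

lemma succ_eq (j : ℕ) (x : ℝ) : PP α q m B t (j+1) x = PP α q m B t j x + chi q j x *
      (Rr α (PP α q m B t j) (q j - 1) x + Rr α (PP α q m B t j) (q j - 1) (-x) + us x ^ m + eta B q j
        - PP α q m B t j x) := rfl

lemma succ_off (p : Par α β q m B t) (j : ℕ) {x : ℝ} (hx : ¬ Ij q j x) :
    PP α q m B t (j+1) x = PP α q m B t j x := by
  rw [succ_eq, chi_off (p.Q.eps_pos j) hx]; ring

lemma succ_core (p : Par α β q m B t) (j : ℕ) {x : ℝ} (hx : us x ≤ eps q j / 2) :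
    PP α q m B t (j+1) x =
      Rr α (PP α q m B t j) (q j - 1) x + Rr α (PP α q m B t j) (q j - 1) (-x) + us x ^ m + eta B q j := by
  rw [succ_eq, chi_core (p.Q.eps_pos j) hx]; ring

lemma succ_on (p : Par α β q m B t) (j : ℕ) (iv : Invt α q m B t j) {x : ℝ} (hx : Ij q j x) :
    Rr α (PP α q m B t j) (q j - 1) x + Rr α (PP α q m B t j) (q j - 1) (-x) + us x ^ m + eta B q j ≤
    PP α q m B t (j+1) x ∧ PP α q m B t (j+1) x ≤ PP α q m B t j x := by
  have h := iv.cond x hx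
  rw [succ_eq]
  have h1 := chi_nonneg q j x
  have h2 := chi_le_one q j x
  constructor <;> nlinarith

lemma even_succ (j : ℕ) (iv : Invt α q m B t j) (x : ℝ) :
    PP α q m B t (j+1) (-x) = PP α q m B t (j+1) x := by
  rw [succ_eq, succ_eq, iv.even, chi_neg, us_neg, neg_neg]; ring

lemma stage (p : Par α β q m B t) (j : ℕ) (iv : Invt α q m B t j) :
    Stage α (PP α q m B t j) (PP α q m B t (j+1)) (Ij q j) (q j - 1) (GG β q m t) (eta B q j)
      (fun x => us x ^ m) (ww q m B t j) (ww q m B t (j+1)) where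
  hPe := iv.even
  hI x hx := Ij_neg hx
  hret z k h1 h2 h3 := by
    have := p.Q.ret j h1 h2 h3
    have := p.Q.pos j
    omega
  hgr := p.grow j iv j
  hG := p.hG2
  hη := eta_pos j
  hη1 := p.eta_le_one j
  hGN := p.GN j
  hprod := iv.prod
  hw := ww_pos j
  hw' := ww_pos (j+1)
  hww x := by
    unfold ww
    have := p.eta_half j
    have := eta_pos (B := B) (q := q) j
    split_ifs
    · linarith
    · exact le_rfl
  hwI x hx := by
    have h0 := p.Q.Ij_anti (Nat.zero_le j) hx
    unfold Ij at h0
    have := p.eta_half j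
    have := eta_pos (B := B) (q := q) j
    simp only [ww, if_pos h0]
    linarith
  hh x := pow_nonneg (us_nonneg x) m
  hPe' := even_succ j iv
  hoff x hx := p.succ_off j hx
  hon x hx := (p.succ_on j iv hx).1

lemma base_ea (p : Par α β q m B t) (n : ℕ) (x : ℝ) :
    0 < ea α (PP α q m B t 0) n x ∧ 0 ≤ ec α (PP α q m B t 0) n x ∧
      ec α (PP α q m B t 0) n x ≤ ea α (PP α q m B t 0) n x := by
  have ht := p.exp_t
  induction n with
  | zero => rw [ea_zero, ec_zero]; norm_num
  | succ n ih =>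
    obtain ⟨h1, h2, h3⟩ := ih
    rw [ea_succ, ec_succ]
    have e : PP α q m B t 0 (x + n * α) = Real.exp t + 1 := rfl
    rw [e]
    refine ⟨by nlinarith, h1.le, by nlinarith⟩

lemma base_R (p : Par α β q m B t) (n : ℕ) (z : ℝ) :
    0 ≤ Rr α (PP α q m B t 0) n z ∧ Rr α (PP α q m B t 0) n z ≤ 1 := by
  have h := ratio_reflect α (PP α q m B t 0) (fun x => rfl) n (-z - n * α)
  have e : -(-z - (n:ℝ) * α + n * α) = z := by ring
  rw [e] at h
  obtain ⟨h1, h2, h3⟩ := p.base_ea n (-z - n * α)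
  rw [← h]
  exact ⟨div_nonneg h2 h1.le, (div_le_one h1).2 h3⟩

lemma inv_zero (p : Par α β q m B t) : Invt α q m B t 0 where
  even x := rfl
  per x := rfl
  nonneg x := by
    show 0 ≤ Lam t
    have := p.exp_t; unfold Lam; linarith
  le x := le_rfl
  smooth n := contDiff_const
  prod x n := by
    have ht := p.exp_t
    induction n with
    | zero => simp [ea_zero]
    | succ n ih =>
      rw [Finset.prod_range_succ, ea_succ]
      obtain ⟨h1, h2, h3⟩ := p.base_ea n x
      have e : PP α q m B t 0 (x + n * α) = Real.exp t + 1 := rfl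
      rw [e]
      have hw : ww q m B t 0 (x + n * α) ≤ Real.exp t := by
        unfold ww
        split_ifs
        · have := pow_le_one₀ (n := m) (us_nonneg (x + n * α)) (us_le_one (x + n * α))
          have := p.eta_le_one 0
          linarith
        · exact le_rfl
      calc _ ≤ ea α (PP α q m B t 0) n x * Real.exp t := by
            gcongr
            exact (ww_pos 0 _).le
        _ ≤ _ := by linarith
  cond z hz := by
    have h1 := (p.base_R (q 0 - 1) z).2
    have h2 := (p.base_R (q 0 - 1) (-z)).2
    have := pow_le_one₀ (n := m) (us_nonneg z) (us_le_one z)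
    have := p.eta_le_one 0
    have ht := p.exp_t
    have e : PP α q m B t 0 z = Real.exp t + 1 := rfl
    rw [e]; linarith

lemma eps_step (p : Par α β q m B t) (j : ℕ) : eps q (j+1) ≤ eps q j / 4 := by
  have h1 : (2 * q j : ℝ) ≤ q (j+1) := by exact_mod_cast p.Q.dbl j
  have h2 := p.Q.posR j
  unfold eps
  rw [div_div]
  apply one_div_le_one_div_of_le (by positivity)
  nlinarith

lemma inv_succ (p : Par α β q m B t) (j : ℕ) (iv : Invt α q m B t j) : Invt α q m B t (j+1) where
  even := even_succ j iv
  per x := by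
    rw [succ_eq, succ_eq, iv.per, chi_per, us_per, Rr_per iv.per]
    have : Rr α (PP α q m B t j) (q j - 1) (-(x+1)) = Rr α (PP α q m B t j) (q j - 1) (-x) := by
      rw [← Rr_per iv.per]; congr 1; ring
    rw [this]
  nonneg x := by
    by_cases hx : Ij q j x
    · have h1 := (p.succ_on j iv hx).1
      have h2 := p.R_nonneg j iv j _ hx (p.noret j hx)
      have h3 := p.R_nonneg j iv j _ (Ij_neg hx) (p.noret j (Ij_neg hx))
      have h4 := pow_nonneg (us_nonneg x) m
      have h5 := eta_pos (B := B) (q := q) j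
      linarith
    · rw [p.succ_off j hx]; exact iv.nonneg x
  le x := by
    by_cases hx : Ij q j x
    · exact (p.succ_on j iv hx).2.trans (iv.le x)
    · rw [p.succ_off j hx]; exact iv.le x
  smooth n := by
    have e : PP α q m B t (j+1) = fun x => PP α q m B t j x + chi q j x *
      (Rr α (PP α q m B t j) (q j - 1) x + Rr α (PP α q m B t j) (q j - 1) (-x) + us x ^ m + eta B q j
        - PP α q m B t j x) := funext (succ_eq j)
    have hR : ContDiff ℝ n (Rr α (PP α q m B t j) (q j - 1)) :=
      Rr_contDiff (iv.smooth n) _ fun x => (ea_pos iv _ x).ne'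
    rw [e]
    exact (iv.smooth n).add ((chi_contDiff q j n).mul ((((hR.add (hR.comp contDiff_neg)).add
      (us_contDiff.pow m)).add contDiff_const).sub (iv.smooth n)))
  prod x n := (p.stage j iv).prod n x
  cond z hz := by
    have S := p.stage j iv
    have he := p.eps_step j
    have hep := p.Q.eps_pos j
    have hcore : us z ≤ eps q j / 2 := by unfold Ij at hz; linarith
    have hI : Ij q j z := by unfold Ij; linarith
    rw [p.succ_core j hcore]
    have h1 := (S.c (q (j+1) - 1) z hI).2
    have h2 := (S.c (q (j+1) - 1) (-z) (Ij_neg hI)).2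
    have := p.eta_half j
    linarith

lemma inv (p : Par α β q m B t) (j : ℕ) : Invt α q m B t j := by
  induction j with
  | zero => exact p.inv_zero
  | succ j ih => exact p.inv_succ j ih

end Par




lemma jn_ea {α : ℝ} {P : ℝ → ℝ} {l : ℕ} {K : ℝ} (hP : ContDiff ℝ l P) (hK : ∀ x, jn l 1 P x ≤ K)
    (n : ℕ) (x : ℝ) : jn l 1 (ea α P n) x ≤ (K+1) ^ n ∧ jn l 1 (ec α P n) x ≤ (K+1) ^ n := by
  have hK0 : 0 ≤ K := (jn_nonneg l zero_le_one P x).trans (hK x)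
  induction n with
  | zero =>
    constructor
    · have : ea α P 0 = fun _ => 1 := funext (ea_zero α P)
      rw [this, jn_const]; simp
    · have : ec α P 0 = fun _ => 0 := funext (ec_zero α P)
      rw [this, jn_const]; simp
  | succ n ih =>
    have hPs : ContDiff ℝ l (fun x => P (x + n * α)) := hP.comp (contDiff_id.add contDiff_const)
    have h1 := (ea_contDiff (α := α) hP n).1
    have h2 := (ea_contDiff (α := α) hP n).2
    constructor
    · have : ea α P (n+1) = fun x => P (x + n * α) * ea α P n x - ec α P n x := funext (ea_succ α P n)
      rw [this]
      refine (jn_sub zero_le_one (hPs.mul h1) h2 x).trans ?_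
      have h3 := jn_mul zero_le_one hPs h1 x
      rw [jn_shift P] at h3
      have h4 : jn l 1 P (x + n * α) * jn l 1 (ea α P n) x ≤ K * (K+1) ^ n := by
        apply mul_le_mul (hK _) ih.1 (jn_nonneg l zero_le_one _ _) hK0
      rw [pow_succ]
      linarith [ih.2]
    · have : ec α P (n+1) = ea α P n := funext (ec_succ α P n)
      rw [this]
      refine ih.1.trans (pow_le_pow_right₀ (by linarith) (by omega))

/-- the increment of the ratio -/
def Dn (α : ℝ) (P : ℝ → ℝ) (n : ℕ) (z : ℝ) : ℝ := (ea α P n (z + α) * ea α P (n+1) (z + α))⁻¹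

lemma Dn_contDiff {α : ℝ} {P : ℝ → ℝ} {l : ℕ} (hP : ContDiff ℝ l P) (h0 : ∀ n x, ea α P n x ≠ 0) (n : ℕ) :
    ContDiff ℝ l (Dn α P n) := by
  have h1 : ContDiff ℝ l (fun z => ea α P n (z + α)) :=
    (ea_contDiff hP n).1.comp (contDiff_id.add contDiff_const)
  have h2 : ContDiff ℝ l (fun z => ea α P (n+1) (z + α)) :=
    (ea_contDiff hP (n+1)).1.comp (contDiff_id.add contDiff_const)
  exact (h1.mul h2).inv fun x => mul_ne_zero (h0 _ _) (h0 _ _)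

lemma jn_Dn {α : ℝ} {P : ℝ → ℝ} {l : ℕ} {K G : ℝ} (hP : ContDiff ℝ l P) (hK : ∀ x, jn l 1 P x ≤ K)
    (h0 : ∀ n x, ea α P n x ≠ 0) {I : ℝ → Prop} (hG : 2 ≤ G) (hgr : Grow α P I G) {z : ℝ} (hz : I z) {n : ℕ}
    (hn : NoRet α I z (n+1)) :
    jn l 1 (Dn α P n) z ≤ (l+1) * ((K+1) ^ l / G ^ (l+1)) ^ (2 * n + 1) := by
  have hK0 : 0 ≤ K := (jn_nonneg l zero_le_one P z).trans (hK z)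
  have h1 : ContDiff ℝ l (fun z => ea α P n (z + α)) :=
    (ea_contDiff hP n).1.comp (contDiff_id.add contDiff_const)
  have h2 : ContDiff ℝ l (fun z => ea α P (n+1) (z + α)) :=
    (ea_contDiff hP (n+1)).1.comp (contDiff_id.add contDiff_const)
  have hj : jn l 1 (fun z => ea α P n (z + α) * ea α P (n+1) (z + α)) z ≤ (K+1) ^ (2*n+1) := by
    refine (jn_mul zero_le_one h1 h2 z).trans ?_
    rw [jn_shift, jn_shift]
    have e : (K+1) ^ (2*n+1) = (K+1) ^ n * (K+1) ^ (n+1) := by rw [← pow_add]; congr 1; omega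
    rw [e]
    exact mul_le_mul (jn_ea hP hK n _).1 (jn_ea hP hK (n+1) _).1 (jn_nonneg l zero_le_one _ _) (by positivity)
  have g1 := hgr z n hz (hn.mono (by omega))
  have g2 := hgr z (n+1) hz hn
  have hf : G ^ (2*n+1) ≤ ea α P n (z + α) * ea α P (n+1) (z + α) := by
    have e : G ^ (2*n+1) = G ^ n * G ^ (n+1) := by rw [← pow_add]; congr 1; omega
    rw [e]
    exact mul_le_mul g1 g2 (by positivity) (le_trans (by positivity) g1)
  have := jn_inv (l := l) (f := fun z => ea α P n (z + α) * ea α P (n+1) (z + α)) (h1.mul h2)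
    (fun x => mul_ne_zero (h0 _ _) (h0 _ _)) z
  refine (this.trans ?_)
  have hGp : 0 < G ^ (2*n+1) := by positivity
  rw [abs_of_pos (hGp.trans_le hf)]
  have hjn := jn_nonneg l zero_le_one (fun z => ea α P n (z + α) * ea α P (n+1) (z + α)) z
  calc _ ≤ (l+1 : ℝ) * (((K+1) ^ (2*n+1) / G ^ (2*n+1)) ^ l / G ^ (2*n+1)) := by
        gcongr
        exact div_nonneg hjn (hGp.le.trans hf)
    _ = _ := by
      congr 1
      rw [div_pow, div_pow, ← pow_mul, ← pow_mul, ← pow_mul, ← pow_mul, div_div, ← pow_add]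
      congr 2 <;> ring

lemma Rr_sum {α : ℝ} {P : ℝ → ℝ} (h0 : ∀ n x, ea α P n x ≠ 0) {a b : ℕ} (hab : a ≤ b) (z : ℝ) :
    Rr α P b z - Rr α P a z = ∑ n ∈ Finset.Ico a b, Dn α P n z := by
  induction b, hab using Nat.le_induction with
  | base => simp
  | succ b hb ih =>
    rw [Finset.sum_Ico_succ_top hb, ← ih]
    have := Rr_step α P b z (h0 _ _) (h0 _ _)
    unfold Dn
    rw [one_div] at this
    linarith

lemma geo_tail {ρ : ℝ} (h0 : 0 ≤ ρ) (h1 : ρ ≤ 1/2) {a b : ℕ} (hab : a ≤ b) :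
    ∑ n ∈ Finset.Ico a b, ρ ^ (2*n+1) ≤ 2 * ρ ^ (a+1) := by
  have key : ∑ n ∈ Finset.Ico a b, ρ ^ (2*n+1) ≤ 2 * ρ ^ (a+1) - 2 * ρ ^ (b+1) := by
    induction b, hab using Nat.le_induction with
    | base => simp
    | succ b hb ih =>
      rw [Finset.sum_Ico_succ_top hb]
      have e1 : ρ ^ (2*b+1) ≤ ρ ^ (b+1) := pow_le_pow_of_le_one h0 (by linarith) (by omega)
      have e2 : ρ ^ (b+1+1) ≤ ρ ^ (b+1) * (1/2) := by rw [pow_succ]; gcongr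
      linarith
  have : 0 ≤ ρ ^ (b+1) := by positivity
  linarith

lemma jn_us_one (l : ℕ) (x : ℝ) : jn l 1 us x ≤ (l+1) * 7 ^ l := by
  apply jn_of_le zero_le_one
  intro i hi
  rw [one_pow, mul_one]
  rcases Nat.eq_zero_or_pos i with rfl | h
  · rw [iteratedDeriv_zero, abs_of_nonneg (us_nonneg x)]
    exact (us_le_one x).trans (one_le_pow₀ (by norm_num))
  · exact (us_iter i h x).trans (pow_le_pow_right₀ (by norm_num) hi)

lemma Ij_open (q : ℕ → ℕ) (j : ℕ) : IsOpen {x | Ij q j x} :=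
  isOpen_lt (us_contDiff (n := 0)).continuous continuous_const

/-- bracket in the construction -/
def brk (α : ℝ) (q : ℕ → ℕ) (m : ℕ) (B t : ℝ) (j : ℕ) (x : ℝ) : ℝ :=
  Rr α (PP α q m B t j) (q j - 1) x + Rr α (PP α q m B t j) (q j - 1) (-x) + us x ^ m + eta B q j
        - PP α q m B t j x

namespace Par
variable {α β : ℝ} {q : ℕ → ℕ} {m : ℕ} {B t : ℝ}

lemma R_contDiff (p : Par α β q m B t) (j n l : ℕ) : ContDiff ℝ l (Rr α (PP α q m B t j) n) :=
  Rr_contDiff ((p.inv j).smooth l) _ fun x => (ea_pos (p.inv j) _ x).ne'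

lemma brk_contDiff (p : Par α β q m B t) (j l : ℕ) : ContDiff ℝ l (brk α q m B t j) :=
  ((((p.R_contDiff j _ l).add ((p.R_contDiff j _ l).comp contDiff_neg)).add (us_contDiff.pow m)).add
    contDiff_const).sub ((p.inv j).smooth l)

lemma brk_eq (p : Par α β q m B t) (j : ℕ) {x : ℝ} (hx : Ij q (j+1) x) :
    brk α q m B t (j+1) x =
      (∑ n ∈ Finset.Ico (q j - 1) (q (j+1) - 1), Dn α (PP α q m B t (j+1)) n x) +
      (∑ n ∈ Finset.Ico (q j - 1) (q (j+1) - 1), Dn α (PP α q m B t (j+1)) n (-x)) +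
      (eta B q (j+1) - eta B q j) := by
  have he := p.eps_step j
  have hep := p.Q.eps_pos j
  have hcore : us x ≤ eps q j / 2 := by unfold Ij at hx; linarith
  have hI : Ij q j x := by unfold Ij; linarith
  have hne : ∀ n x, ea α (PP α q m B t (j+1)) n x ≠ 0 := fun n x => (ea_pos (p.inv (j+1)) n x).ne'
  have hqq : q j - 1 ≤ q (j+1) - 1 := Nat.sub_le_sub_right (p.Q.mono (Nat.le_succ j)) 1
  have hR : ∀ z, Ij q j z → Rr α (PP α q m B t j) (q j - 1) z = Rr α (PP α q m B t (j+1)) (q j - 1) z := by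
    intro z hz
    apply Rr_congr
    intro k h1 h2
    exact (p.succ_off j (p.noret j hz k h1 h2)).symm
  unfold brk
  rw [p.succ_core j hcore]
  rw [hR x hI, hR (-x) (Ij_neg hI), ← Rr_sum hne hqq, ← Rr_sum hne hqq]
  ring

lemma jn_brk (p : Par α β q m B t) {l : ℕ} {K : ℝ} (j : ℕ) (hK : ∀ x, jn l 1 (PP α q m B t (j+1)) x ≤ K)
    (hρ : (K+1) ^ l / GG β q m t ^ (l+1) ≤ Real.exp (-B)) {x : ℝ} (hx : Ij q (j+1) x) :
    jn l 1 (brk α q m B t (j+1)) x ≤ (4 * (l+1) + 1) * eta B q j := by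
  set P := PP α q m B t (j+1) with hPd
  set ρ := (K+1) ^ l / GG β q m t ^ (l+1) with hρd
  have hK0 : 0 ≤ K := (jn_nonneg l zero_le_one P x).trans (hK x)
  have hG := p.hG2
  have hρ0 : 0 ≤ ρ := by positivity
  have hB := p.hB
  have hρ2 : ρ ≤ 1/2 := by
    refine hρ.trans ?_
    calc Real.exp (-B) ≤ Real.exp (-1) := by rw [Real.exp_le_exp]; linarith
      _ = 1 / Real.exp 1 := by rw [Real.exp_neg, one_div]
      _ ≤ 1 / 2 := by
        gcongr
        have := Real.add_one_le_exp (1:ℝ); linarith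
  have hPc : ContDiff ℝ l P := (p.inv (j+1)).smooth l
  have hne : ∀ n x, ea α P n x ≠ 0 := fun n x => (ea_pos (p.inv (j+1)) n x).ne'
  have hqq : q j - 1 ≤ q (j+1) - 1 := Nat.sub_le_sub_right (p.Q.mono (Nat.le_succ j)) 1
  set s := Finset.Ico (q j - 1) (q (j+1) - 1)
  have hDc : ∀ n ∈ s, ContDiff ℝ l (Dn α P n) := fun n _ => Dn_contDiff hPc hne n
  have hS : ContDiff ℝ l (fun y => ∑ n ∈ s, Dn α P n y) := ContDiff.sum hDc
  have hS' : ContDiff ℝ l (fun y => ∑ n ∈ s, Dn α P n (-y)) := hS.comp contDiff_neg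
  have hρe : ρ ^ (q j) ≤ eta B q j := by
    calc ρ ^ (q j) ≤ Real.exp (-B) ^ (q j) := by gcongr
      _ = eta B q j := by rw [← Real.exp_nat_mul, eta]; congr 1; ring
  have hSb : ∀ z, Ij q (j+1) z → jn l 1 (fun y => ∑ n ∈ s, Dn α P n y) z ≤ 2 * (l+1) * eta B q j := by
    intro z hz
    refine (jn_sum zero_le_one s hDc z).trans ?_
    calc ∑ n ∈ s, jn l 1 (Dn α P n) z ≤ ∑ n ∈ s, (l+1 : ℝ) * ρ ^ (2*n+1) := by
          refine Finset.sum_le_sum fun n hn => ?_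
          refine jn_Dn hPc hK hne hG (p.grow (j+1) (p.inv (j+1)) (j+1)) hz ((p.noret (j+1) hz).mono ?_)
          have := (Finset.mem_Ico.1 hn).2
          omega
      _ = (l+1) * ∑ n ∈ s, ρ ^ (2*n+1) := by rw [Finset.mul_sum]
      _ ≤ (l+1) * (2 * ρ ^ (q j - 1 + 1)) := by
          gcongr
          exact geo_tail hρ0 hρ2 hqq
      _ ≤ (l+1) * (2 * eta B q j) := by
          have := p.Q.pos j
          rw [show q j - 1 + 1 = q j by omega]
          gcongr
      _ = _ := by ring
  have hev : brk α q m B t (j+1) =ᶠ[nhds x] fun y => (∑ n ∈ s, Dn α P n y) + (∑ n ∈ s, Dn α P n (-y)) +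
      (eta B q (j+1) - eta B q j) := by
    filter_upwards [(Ij_open q (j+1)).mem_nhds hx] with y hy
    exact p.brk_eq j hy
  rw [jn_congr hev]
  refine (jn_add zero_le_one (hS.add hS') contDiff_const x).trans ?_
  have h1 := jn_add zero_le_one hS hS' x
  have h2 := hSb x hx
  have h3 := hSb (-x) (Ij_neg hx)
  rw [← jn_comp_neg] at h3
  rw [jn_const]
  have h4 : |eta B q (j+1) - eta B q j| ≤ eta B q j := by
    have a := p.eta_half j
    have b := eta_pos (B := B) (q := q) j
    have c := eta_pos (B := B) (q := q) (j+1)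
    rw [abs_le]; constructor <;> linarith
  linarith

lemma jn_chi_mul (p : Par α β q m B t) {l : ℕ} {C : ℝ} (j : ℕ)
    (hC : ∀ x, jn l 1 (chi q j) x ≤ C / eps q j ^ l) {f : ℝ → ℝ} (hf : ContDiff ℝ l f) {M : ℝ} (hM : 0 ≤ M)
    (h : ∀ x, Ij q j x → jn l 1 f x ≤ M) (x : ℝ) :
    jn l 1 (fun y => chi q j y * f y) x ≤ C / eps q j ^ l * M := by
  have hep := p.Q.eps_pos j
  have hC0 : 0 ≤ C / eps q j ^ l := (jn_nonneg l zero_le_one _ x).trans (hC x)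
  refine (jn_mul zero_le_one (chi_contDiff q j l) hf x).trans ?_
  by_cases hx : Ij q j x
  · exact mul_le_mul (hC x) (h x hx) (jn_nonneg l zero_le_one _ _) hC0
  · rw [jn_chi_off hep ((p.Q.eps_le j).trans (by norm_num)) l hx, zero_mul]
    positivity

lemma eps_inv_pow (p : Par α β q m B t) (l j : ℕ) :
    1 / eps q (j+1) ^ l ≤ 16 ^ l * Real.exp (2 * l * β * q j) := by
  unfold eps
  rw [one_div_pow, one_div_one_div]
  have h1 := p.Q.ex j
  have h2 := p.Q.posR (j+1)
  rw [mul_pow]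
  gcongr
  calc ((q (j+1) : ℝ)^2)^l ≤ (Real.exp (β * q j) ^ 2) ^ l := by gcongr
    _ = _ := by
      rw [← Real.exp_nat_mul, ← Real.exp_nat_mul]; congr 1; push_cast; ring

lemma exp_q (p : Par α β q m B t) (j : ℕ) : Real.exp (-(q j : ℝ)) ≤ (1/2) ^ j := by
  have h1 : (j : ℝ) ≤ q j := by
    exact_mod_cast (Nat.lt_two_pow_self (n := j)).le.trans (p.Q.two_pow j)
  calc Real.exp (-(q j : ℝ)) ≤ Real.exp (-(j:ℝ)) := by rw [Real.exp_le_exp]; linarith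
    _ = (Real.exp (-1)) ^ j := by rw [← Real.exp_nat_mul]; congr 1; ring
    _ ≤ _ := by
      gcongr
      rw [Real.exp_neg, ← one_div]
      gcongr
      have := Real.add_one_le_exp (1:ℝ); linarith

lemma incr_step (p : Par α β q m B t) {l : ℕ} {K C : ℝ} (hBl : B = 2 * l * β + 1) (j : ℕ)
    (hC0 : 0 ≤ C) (hC : ∀ x, jn l 1 (chi q (j+1)) x ≤ C / eps q (j+1) ^ l)
    (hK : ∀ x, jn l 1 (PP α q m B t (j+1)) x ≤ K)
    (hρ : (K+1) ^ l / GG β q m t ^ (l+1) ≤ Real.exp (-B)) (x : ℝ) :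
    jn l 1 (fun y => PP α q m B t (j+2) y - PP α q m B t (j+1) y) x ≤
      C * 16 ^ l * (4 * (l+1) + 1) * (1/2) ^ j := by
  have e : (fun y => PP α q m B t (j+2) y - PP α q m B t (j+1) y) =
      fun y => chi q (j+1) y * brk α q m B t (j+1) y := by
    funext y
    rw [show j + 2 = (j+1) + 1 by rfl, succ_eq (j+1)]
    unfold brk; ring
  have he := eta_pos (B := B) (q := q) j
  rw [e]
  refine (p.jn_chi_mul (j+1) hC (p.brk_contDiff (j+1) l) (by positivity)
    (fun x hx => p.jn_brk j hK hρ hx) x).trans ?_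
  have h1 := p.eps_inv_pow l j
  have h2 : Real.exp (2 * l * β * q j) * eta B q j ≤ (1/2)^j := by
    refine le_trans (le_of_eq ?_) (p.exp_q j)
    rw [eta, ← Real.exp_add, hBl]; congr 1; ring
  calc C / eps q (j+1) ^ l * ((4 * (l+1) + 1) * eta B q j)
      = C * (4 * (l+1) + 1) * eta B q j * (1 / eps q (j+1) ^ l) := by ring
    _ ≤ C * (4 * (l+1) + 1) * eta B q j * (16 ^ l * Real.exp (2 * l * β * q j)) := by gcongr
    _ = C * 16 ^ l * (4 * (l+1) + 1) * (Real.exp (2 * l * β * q j) * eta B q j) := by ring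
    _ ≤ _ := by gcongr

lemma base_const (n : ℕ) (x : ℝ) : cocIter α (Sc (PP α q m B t 0)) n x = cocIter α (Sc (PP α q m B t 0)) n 0 := by
  induction n with
  | zero => rfl
  | succ n ih => rw [cocIter, cocIter, ih]; rfl

lemma jn_P1 (p : Par α β q m B t) {l : ℕ} {C : ℝ}
    (hC : ∀ x, jn l 1 (chi q 0) x ≤ C / eps q 0 ^ l) (hC0 : 0 ≤ C) (x : ℝ) :
    jn l 1 (PP α q m B t 1) x ≤ (1 + C / eps q 0 ^ l * (4 + ((l+1) * 7 ^ l) ^ m)) * Lam t := by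
  have hep := p.Q.eps_pos 0
  have hL : 1 ≤ Lam t := by have := p.exp_t; unfold Lam; linarith
  set U : ℝ := ((l+1) * 7 ^ l) ^ m with hU
  have hU0 : 0 ≤ U := by positivity
  have hRc : ∀ n, Rr α (PP α q m B t 0) n = fun _ => Rr α (PP α q m B t 0) n 0 := by
    intro n; funext z
    unfold Rr ea eb
    rw [base_const n (z + α), base_const n (0 + α)]
  have e : PP α q m B t 1 = fun y => PP α q m B t 0 y + chi q 0 y * brk α q m B t 0 y := by
    funext y; exact succ_eq 0 y
  rw [e]
  refine (jn_add zero_le_one ((p.inv 0).smooth l) ((chi_contDiff q 0 l).mul (p.brk_contDiff 0 l)) x).trans ?_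
  have h0 : ∀ x, jn l 1 (PP α q m B t 0) x = Lam t := by
    intro x
    have : PP α q m B t 0 = fun _ => Lam t := by funext y; rfl
    rw [this, jn_const, abs_of_pos (by linarith)]
  have hb : ∀ x, jn l 1 (brk α q m B t 0) x ≤ (4 + U) * Lam t := by
    intro x
    have c1 := p.R_contDiff 0 (q 0 - 1) l
    have c2 : ContDiff ℝ l (fun y => Rr α (PP α q m B t 0) (q 0 - 1) (-y)) := c1.comp contDiff_neg
    have c3 : ContDiff ℝ l (fun y => us y ^ m) := us_contDiff.pow m
    have c4 := (p.inv 0).smooth l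
    have a1 := jn_sub (r := 1) zero_le_one (((c1.add c2).add c3).add (contDiff_const (c := eta B q 0))) c4 x
    have a2 := jn_add (r := 1) zero_le_one ((c1.add c2).add c3) (contDiff_const (c := eta B q 0)) x
    have a3 := jn_add (r := 1) zero_le_one (c1.add c2) c3 x
    have a4 := jn_add (r := 1) zero_le_one c1 c2 x
    have b1 : ∀ x, jn l 1 (Rr α (PP α q m B t 0) (q 0 - 1)) x ≤ 1 := by
      intro x
      rw [hRc, jn_const, abs_le]
      have := p.base_R (q 0 - 1) 0
      constructor <;> linarith
    have b2 : jn l 1 (fun y => Rr α (PP α q m B t 0) (q 0 - 1) (-y)) x ≤ 1 := by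
      rw [jn_comp_neg]; exact b1 _
    have b3 : jn l 1 (fun y => us y ^ m) x ≤ U :=
      (jn_pow zero_le_one us_contDiff x m).trans
        (pow_le_pow_left₀ (jn_nonneg l zero_le_one _ _) (jn_us_one l x) m)
    have b4 : jn l 1 (fun _ => eta B q 0) x ≤ 1 := by
      rw [jn_const, abs_of_pos (eta_pos 0)]; exact p.eta_le_one 0
    have b5 := h0 x
    have b1x := b1 x
    have : jn l 1 (brk α q m B t 0) x ≤ 3 + U + Lam t := by
      unfold brk
      linarith
    refine this.trans ?_
    nlinarith
  have h1 := p.jn_chi_mul 0 hC (p.brk_contDiff 0 l) (by positivity : 0 ≤ (4 + U) * Lam t) (fun x _ => hb x) x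
  rw [h0]
  refine (add_le_add_right h1 _).trans (le_of_eq ?_)
  ring

/-- all increments -/
lemma incr (p : Par α β q m B t) {l : ℕ} {K C : ℝ} (hBl : B = 2 * l * β + 1) (hC0 : 0 ≤ C)
    (hC : ∀ j x, jn l 1 (chi q j) x ≤ C / eps q j ^ l)
    (hK : (1 + C / eps q 0 ^ l * (4 + ((l+1) * 7 ^ l) ^ m)) * Lam t + 2 * (C * 16 ^ l * (4 * (l+1) + 1)) ≤ K)
    (hρ : (K+1) ^ l / GG β q m t ^ (l+1) ≤ Real.exp (-B)) (j : ℕ) (x : ℝ) :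
    jn l 1 (fun y => PP α q m B t (j+2) y - PP α q m B t (j+1) y) x ≤
      C * 16 ^ l * (4 * (l+1) + 1) * (1/2) ^ j := by
  set C4 := C * 16 ^ l * (4 * (l+1) + 1) with hC4
  have hC40 : 0 ≤ C4 := by positivity
  have key : ∀ j x, jn l 1 (PP α q m B t (j+1)) x ≤ K - 2 * C4 * (1/2) ^ j := by
    intro j
    induction j with
    | zero =>
      intro x
      have := p.jn_P1 (hC 0) hC0 x
      simp only [pow_zero, mul_one]
      rw [zero_add]
      linarith
    | succ j ih =>
      intro x
      have hK' : ∀ x, jn l 1 (PP α q m B t (j+1)) x ≤ K := by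
        intro x
        have := ih x
        have : 0 ≤ 2 * C4 * (1/2)^j := by positivity
        linarith
      have h1 := p.incr_step hBl j hC0 (hC (j+1)) hK' hρ x
      have e : PP α q m B t (j+1+1) = fun y => PP α q m B t (j+1) y +
          (PP α q m B t (j+2) y - PP α q m B t (j+1) y) := by funext y; ring
      rw [e]
      refine (jn_add zero_le_one ((p.inv (j+1)).smooth l)
        (((p.inv (j+2)).smooth l).sub ((p.inv (j+1)).smooth l)) x).trans ?_
      have h2 := ih x
      rw [← hC4] at h1
      have e2 : 2 * C4 * (1/2 : ℝ) ^ (j+1) = C4 * (1/2) ^ j := by rw [pow_succ]; ring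
      rw [e2]
      linarith
  apply p.incr_step hBl j hC0 (hC (j+1)) _ hρ x
  intro x
  have := key j x
  have : 0 ≤ 2 * C4 * (1/2)^j := by positivity
  linarith

end Par




/-- the approximating potentials -/
def aa (α : ℝ) (q : ℕ → ℕ) (m : ℕ) (B t : ℝ) (j : ℕ) (x : ℝ) : ℝ :=
  PP α q m B t (j+1) x - chi q j x * (us x ^ m + eta B q j)

def hbd (C : ℝ) (l m : ℕ) (B : ℝ) (q : ℕ → ℕ) (j : ℕ) : ℝ :=
  C / eps q j ^ l * ((4 * q j : ℝ) ^ l * ((l+1) * (7 ^ (l+1) * eps q j)) ^ m + eta B q j)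

namespace Par
variable {α β : ℝ} {q : ℕ → ℕ} {m : ℕ} {B t : ℝ}

lemma aa_eq (j : ℕ) (x : ℝ) : aa α q m B t j x = PP α q m B t j x + chi q j x *
      (Rr α (PP α q m B t j) (q j - 1) x + Rr α (PP α q m B t j) (q j - 1) (-x) - PP α q m B t j x) := by
  unfold aa; rw [succ_eq]; ring

lemma aa_off (p : Par α β q m B t) (j : ℕ) {x : ℝ} (hx : ¬ Ij q j x) :
    aa α q m B t j x = PP α q m B t j x := by
  rw [aa_eq, chi_off (p.Q.eps_pos j) hx]; ring

lemma aa_core (p : Par α β q m B t) (j : ℕ) {x : ℝ} (hx : us x ≤ eps q j / 2) :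
    aa α q m B t j x =
      Rr α (PP α q m B t j) (q j - 1) x + Rr α (PP α q m B t j) (q j - 1) (-x) := by
  rw [aa_eq, chi_core (p.Q.eps_pos j) hx]; ring

lemma aa_bd (p : Par α β q m B t) (j : ℕ) (x : ℝ) : 0 ≤ aa α q m B t j x ∧ aa α q m B t j x ≤ Lam t := by
  have iv := p.inv j
  have n0 := iv.nonneg x
  have n1 := iv.le x
  by_cases hx : Ij q j x
  · have h2 := p.R_nonneg j iv j _ hx (p.noret j hx)
    have h3 := p.R_nonneg j iv j _ (Ij_neg hx) (p.noret j (Ij_neg hx))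
    have h4 := pow_nonneg (us_nonneg x) m
    have h5 := eta_pos (B := B) (q := q) j
    have hc := iv.cond x hx
    have c1 := chi_nonneg q j x
    have c2 := chi_le_one q j x
    rw [aa_eq]
    constructor <;> nlinarith
  · rw [p.aa_off j hx]; exact ⟨n0, n1⟩

lemma aa_per (p : Par α β q m B t) (j : ℕ) (x : ℝ) : aa α q m B t j (x+1) = aa α q m B t j x := by
  unfold aa; rw [(p.inv (j+1)).per, chi_per, us_per]

lemma hterm_contDiff (j l : ℕ) : ContDiff ℝ l (fun x => chi q j x * (us x ^ m + eta B q j)) :=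
  (chi_contDiff q j l).mul ((us_contDiff.pow m).add contDiff_const)

lemma aa_contDiff (p : Par α β q m B t) (j l : ℕ) : ContDiff ℝ l (aa α q m B t j) :=
  ((p.inv (j+1)).smooth l).sub (hterm_contDiff j l)

lemma hterm (p : Par α β q m B t) {l : ℕ} {C : ℝ} (j : ℕ)
    (hC : ∀ x, jn l 1 (chi q j) x ≤ C / eps q j ^ l) (x : ℝ) :
    jn l 1 (fun x => chi q j x * (us x ^ m + eta B q j)) x ≤ hbd C l m B q j := by
  have hep := p.Q.eps_pos j
  have hq := p.Q.posR j
  have he := eta_pos (B := B) (q := q) j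
  have hu : ContDiff ℝ l (fun x => us x ^ m) := us_contDiff.pow m
  refine p.jn_chi_mul j hC (hu.add contDiff_const) (by positivity) ?_ x
  intro z hz
  refine (jn_add zero_le_one hu contDiff_const z).trans ?_
  rw [jn_const, abs_of_pos he]
  gcongr
  have hr : (0:ℝ) < 1 / (4 * q j) := by positivity
  have hr1 : 1 / (4 * q j : ℝ) ≤ 1 := by
    rw [div_le_one (by positivity)]; linarith
  have hr2 : (1 / (4 * q j : ℝ)) ^ 2 = eps q j := by unfold eps; field_simp; norm_num
  refine (jn_rescale hr hr1 _ z).trans ?_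
  rw [one_div, inv_inv, ← one_div]
  gcongr
  refine (jn_pow hr.le us_contDiff z m).trans ?_
  refine pow_le_pow_left₀ (jn_nonneg l hr.le _ _) ?_ m
  have := jn_us l hr hr1 (x := z) (by rw [hr2]; exact le_of_lt hz)
  rwa [hr2] at this

lemma q_tendsto (p : Par α β q m B t) : Tendsto (fun j => (q j : ℝ)) atTop atTop := by
  refine tendsto_atTop_mono (f := fun j : ℕ => (j : ℝ)) ?_ tendsto_natCast_atTop_atTop
  intro j
  exact_mod_cast (Nat.lt_two_pow_self (n := j)).le.trans (p.Q.two_pow j)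

lemma hbd_tendsto (p : Par α β q m B t) {l : ℕ} {C : ℝ} (hC0 : 0 ≤ C) (hm : m = 2 * l + 1) :
    Tendsto (fun j => hbd C l m B q j) atTop (nhds 0) := by
  set c : ℝ := (l+1) * 7 ^ (l+1) with hc
  have hc0 : 0 ≤ c := by positivity
  have hq := p.q_tendsto
  have h1 : Tendsto (fun j => C * c ^ m * (q j : ℝ)⁻¹ + C * 16 ^ l * ((q j : ℝ) ^ (2 * l) * Real.exp (-(q j : ℝ))))
      atTop (nhds 0) := by
    have a := (tendsto_inv_atTop_zero.comp hq).const_mul (C * c ^ m)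
    have b := ((Real.tendsto_pow_mul_exp_neg_atTop_nhds_zero (2*l)).comp hq).const_mul (C * 16 ^ l)
    have := a.add b
    simpa using this
  refine squeeze_zero (fun j => ?_) (fun j => ?_) h1
  · have hep := p.Q.eps_pos j
    have he := eta_pos (B := B) (q := q) j
    unfold hbd; positivity
  · have hq1 := p.Q.posR j
    have hB := p.hB
    have he : eta B q j ≤ Real.exp (-(q j : ℝ)) := by
      unfold eta; rw [Real.exp_le_exp]; nlinarith
    obtain ⟨Q, hQ⟩ : ∃ Q : ℝ, Q = (q j : ℝ) := ⟨_, rfl⟩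
    rw [← hQ] at hq1 he
    have hQ0 : 0 < Q := by linarith
    have e : hbd C l m B q j = C * c ^ m * ((4 * Q) ^ l * ((4*Q)^2)⁻¹ ^ (l+1)) +
        C * 16 ^ l * (Q ^ (2*l) * eta B q j) := by
      unfold hbd
      have e1 : eps q j = ((4*Q)^2)⁻¹ := by unfold eps; rw [← hQ, mul_pow, one_div]; norm_num
      have e2 : C / eps q j ^ l = C * 16 ^ l * Q ^ (2*l) := by
        rw [e1, inv_pow, div_inv_eq_mul, mul_pow, mul_pow, ← pow_mul Q]; norm_num; ring
      have e3 : ((l+1 : ℝ) * (7 ^ (l+1) * eps q j)) ^ m = c ^ m * (eps q j ^ l * eps q j ^ (l+1)) := by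
        rw [← mul_assoc, ← hc, mul_pow, ← pow_add, hm]; congr 2; ring
      rw [mul_add, e3]
      have hep := p.Q.eps_pos j
      congr 1
      · rw [← e1, ← hQ]; field_simp
      · rw [e2]; ring
    rw [e, ← hQ]
    have h2 : (4 * Q) ^ l * ((4*Q)^2)⁻¹ ^ (l+1) ≤ Q⁻¹ := by
      have e4 : ((4*Q)^2)⁻¹ ^ (l+1) = ((4*Q)^l)⁻¹ * ((4*Q)^(l+2))⁻¹ := by
        rw [inv_pow, ← mul_inv, ← pow_mul, ← pow_add]; congr 2; ring
      rw [e4, ← mul_assoc, mul_inv_cancel₀ (by positivity), one_mul]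
      apply inv_anti₀ hQ0
      calc Q ≤ 4 * Q := by linarith
        _ ≤ (4 * Q) ^ (l+2) := le_self_pow₀ (by linarith) (by omega)
    gcongr

end Par

/-- convergence of `ea` under pointwise convergence of the potential -/
lemma ea_tendsto {α : ℝ} {F : ℕ → ℝ → ℝ} {P : ℝ → ℝ} (h : ∀ x, Tendsto (fun j => F j x) atTop (nhds (P x)))
    (n : ℕ) (x : ℝ) : Tendsto (fun j => ea α (F j) n x) atTop (nhds (ea α P n x)) ∧
      Tendsto (fun j => ec α (F j) n x) atTop (nhds (ec α P n x)) := by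
  induction n with
  | zero => simp [ea_zero, ec_zero]
  | succ n ih =>
    simp only [ea_succ, ec_succ]
    exact ⟨((h _).mul ih.1).sub ih.2, ih.1⟩

def winf (q : ℕ → ℕ) (m : ℕ) (t : ℝ) (x : ℝ) : ℝ := if us x < eps q 0 then us x ^ m else Real.exp t

namespace Par
variable {α β : ℝ} {q : ℕ → ℕ} {m : ℕ} {B t : ℝ}

/-- the limit potential -/
lemma limit_pot (p : Par α β q m B t) {l : ℕ} {C4 : ℝ}
    (h : ∀ j x, jn l 1 (fun y => PP α q m B t (j+2) y - PP α q m B t (j+1) y) x ≤ C4 * (1/2) ^ j) :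
    ∃ g : ℝ → ℝ, ContDiff ℝ l g ∧ (∀ x, g (x+1) = g x) ∧
      (∀ x n, ∏ i ∈ Finset.range n, winf q m t (x + i * α) ≤ ea α g n x) ∧
      ∀ j, ∀ i ≤ l, ∀ x, |iteratedDeriv i (fun y => PP α q m B t (j+1) y - g y) x| ≤
        2 * (l.factorial * C4) * (1/2) ^ j := by
  obtain ⟨g, hg, hb⟩ := limit_lemma l (fun j => PP α q m B t (j+1)) (l.factorial * C4)
    (fun j => (p.inv (j+1)).smooth l) (by
      intro j i hi x
      refine (deriv_le_jn _ x hi).trans ?_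
      rw [mul_assoc]
      gcongr
      exact h j x)
  have hlim : ∀ x, Tendsto (fun j => PP α q m B t (j+1) x) atTop (nhds (g x)) := by
    intro x
    rw [tendsto_iff_norm_sub_tendsto_zero]
    have h1 : Tendsto (fun j : ℕ => 2 * (l.factorial * C4) * (1/2 : ℝ) ^ j) atTop (nhds 0) := by
      have := (tendsto_pow_atTop_nhds_zero_of_lt_one (by norm_num : (0:ℝ) ≤ 1/2) (by norm_num)).const_mul
        (2 * (l.factorial * C4))
      simpa using this
    refine squeeze_zero (fun j => norm_nonneg _) (fun j => ?_) h1
    have := hb j 0 (Nat.zero_le _) x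
    simpa using this
  refine ⟨g, hg, fun x => ?_, fun x n => ?_, hb⟩
  · refine tendsto_nhds_unique (hlim (x+1)) ?_
    simp only [(p.inv _).per]
    exact hlim x
  · refine ge_of_tendsto' ((ea_tendsto hlim n x).1) fun j => ?_
    refine le_trans ?_ ((p.inv (j+1)).prod x n)
    refine Finset.prod_le_prod (fun i _ => ?_) (fun i _ => ?_)
    · unfold winf
      split_ifs
      · exact pow_nonneg (us_nonneg _) m
      · exact (Real.exp_pos t).le
    · unfold winf ww
      have := eta_pos (B := B) (q := q) (j+1)
      split_ifs
      · linarith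
      · exact le_rfl

end Par




lemma entry_bd {α M : ℝ} {P : ℝ → ℝ} (h0 : ∀ x, 0 ≤ P x) (h1 : ∀ x, P x ≤ M - 1) (n : ℕ) (x : ℝ) :
    |ea α P n x| ≤ M ^ n ∧ |eb α P n x| ≤ M ^ n ∧ |ec α P n x| ≤ M ^ n ∧ |ed α P n x| ≤ M ^ n := by
  have hM : 1 ≤ M := by linarith [h0 0, h1 0]
  have key : ∀ p a c T : ℝ, 0 ≤ p → p ≤ M - 1 → |a| ≤ T → |c| ≤ T → |p * a - c| ≤ T * M := by
    intro p a c T hp hp1 ha hc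
    have := abs_sub (p * a) c
    rw [abs_mul, abs_of_nonneg hp] at this
    have : p * |a| ≤ (M - 1) * T := mul_le_mul hp1 ha (abs_nonneg _) (by linarith)
    linarith
  induction n with
  | zero => simp [ea_zero, eb_zero, ec_zero, ed_zero]
  | succ n ih =>
    obtain ⟨a, b, c, d⟩ := ih
    have hs : M ^ n ≤ M ^ (n+1) := pow_le_pow_right₀ hM (by omega)
    rw [ea_succ, eb_succ, ec_succ, ed_succ]
    refine ⟨?_, ?_, a.trans hs, b.trans hs⟩
    · rw [pow_succ]; exact key _ _ _ _ (h0 _) (h1 _) a c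
    · rw [pow_succ]; exact key _ _ _ _ (h0 _) (h1 _) b d

namespace Par
variable {α β : ℝ} {q : ℕ → ℕ} {m : ℕ} {B t : ℝ}

lemma opn_bd (p : Par α β q m B t) (j n : ℕ) (x : ℝ) :
    opNorm (cocIter α (Sc (aa α q m B t j)) n x) ≤ 20 * (Lam t + 1) ^ n := by
  have hL : 1 ≤ Lam t := by unfold Lam; linarith [Real.exp_pos t]
  obtain ⟨a, b, c, d⟩ := entry_bd (α := α) (M := Lam t + 1) (fun x => (p.aa_bd j x).1)
    (fun x => by linarith [(p.aa_bd j x).2]) n x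
  refine (opNorm_le_sum _).trans ?_
  simp only [ea, eb, ec, ed] at a b c d
  have : 0 ≤ (Lam t + 1) ^ n := by positivity
  linarith

set_option maxHeartbeats 1000000 in
lemma opn_core (p : Par α β q m B t) (j i k : ℕ) (x : ℝ) (hx : us (x + i * α) ≤ eps q j / 2)
    (hk : k ≤ i) (hk2 : i + k + 1 ≤ q j) :
    opNorm (cocIter α (Sc (aa α q m B t j)) (q j) x) ≤ 20 * (Lam t + 1) ^ (q j) / GG β q m t ^ k := by
  have iv := p.inv j
  have hG := p.hG2
  have hgr := p.grow j iv j
  have hep := p.Q.eps_pos j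
  obtain ⟨z, hz⟩ : ∃ z, z = x + i * α := ⟨_, rfl⟩
  rw [← hz] at hx
  have hzI : Ij q j z := by unfold Ij; linarith
  obtain ⟨m', hm'⟩ : ∃ m', q j = m' + 1 + i := ⟨q j - 1 - i, by omega⟩
  obtain ⟨A, hA⟩ : ∃ A, A = aa α q m B t j := ⟨_, rfl⟩
  obtain ⟨P, hP⟩ : ∃ P, P = PP α q m B t j := ⟨_, rfl⟩
  have nr := p.noret j hzI
  have nr' := p.noret j (Ij_neg hzI)
  have offp : ∀ r : ℕ, 1 ≤ r → r ≤ m' → A (z + r * α) = P (z + r * α) := by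
    intro r h1 h2
    rw [hA, hP]; exact p.aa_off j (nr r h1 (by omega))
  have offm : ∀ r : ℕ, r < i → A (x + r * α) = P (x + r * α) := by
    intro r h1
    rw [hA, hP]; apply p.aa_off j
    intro h
    have := nr' (i - r) (by omega) (by omega)
    apply this
    have e : -z + ((i - r : ℕ) : ℝ) * α = -(x + r * α) := by
      rw [hz, Nat.cast_sub h1.le]; ring
    rw [e]; exact Ij_neg h
  have c1 : cocIter α (Sc A) i x = cocIter α (Sc P) i x := Sc_congr _ _ _ _ _ offm
  have c2 : cocIter α (Sc A) m' (z + α) = cocIter α (Sc P) m' (z + α) := by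
    apply Sc_congr
    intro r hr
    have := offp (r+1) (by omega) (by omega)
    push_cast at this
    rw [show z + α + r * α = z + (r + 1) * α by ring]; exact this
  have c3 : Rr α A m' z = Rr α P m' z := by simp only [Rr, ea, eb, c2]
  have hev : ∀ x, P (-x) = P x := by rw [hP]; exact iv.even
  have ga : GG β q m t ^ i ≤ ea α A i x := by
    have := hgr (-z) i (Ij_neg hzI) (nr'.mono (by omega))
    rw [← hP, hz, (reflect α P hev i x).1] at this
    simpa only [ea, c1] using this
  have ga' : GG β q m t ^ m' ≤ ea α A m' (z + α) := by
    have := hgr z m' hzI (nr.mono (by omega))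
    rw [← hP] at this
    simpa only [ea, c2] using this
  have hr : ec α A i x / ea α A i x = Rr α P i (-z) := by
    rw [hz, ← ratio_reflect α P hev]; simp only [ea, ec, c1]
  have t1 := Rr_tele hG hgr hzI m' (q j - 1) (by omega) nr
  have t2 := Rr_tele hG hgr (Ij_neg hzI) i (q j - 1) (by omega) nr'
  rw [← hP] at t1 t2
  have hpv : piv α A m' i x = (Rr α P (q j - 1) z - Rr α P m' z) + (Rr α P (q j - 1) (-z) - Rr α P i (-z)) := by
    unfold piv
    rw [hr, ← hz, c3]
    have := p.aa_core j hx
    rw [← hA, ← hP] at this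
    rw [this]; ring
  have hG1 : 1 ≤ GG β q m t := by linarith
  have hGp : 0 < GG β q m t := by linarith
  obtain ⟨g, hg⟩ : ∃ g, g = GG β q m t ^ k := ⟨_, rfl⟩
  have hg1 : 1 ≤ g := by rw [hg]; exact one_le_pow₀ hG1
  have hg0 : 0 < g := by linarith
  have gi : g ≤ GG β q m t ^ i := by rw [hg]; exact pow_le_pow_right₀ hG1 hk
  have gm : g ≤ GG β q m t ^ m' := by rw [hg]; exact pow_le_pow_right₀ hG1 (by omega)
  have p0 : 0 ≤ piv α A m' i x := by rw [hpv]; linarith [t1.1, t2.1]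
  have p1 : piv α A m' i x ≤ 4 / g := by
    have e0 : 0 < 2 / GG β q m t ^ (2 * (q j - 1)) := by positivity
    have e1 : 2 / GG β q m t ^ (2 * m') ≤ 2 / g := by
      apply div_le_div_of_nonneg_left (by norm_num) hg0
      exact gm.trans (pow_le_pow_right₀ hG1 (by omega))
    have e2 : 2 / GG β q m t ^ (2 * i) ≤ 2 / g := by
      apply div_le_div_of_nonneg_left (by norm_num) hg0
      exact gi.trans (pow_le_pow_right₀ hG1 (by omega))
    have : 4 / g = 2 / g + 2 / g := by ring
    rw [hpv]; linarith [t1.2, t2.2]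
  have a0 : 0 < ea α A i x := lt_of_lt_of_le (by positivity) ga
  have a0' : 0 < ea α A m' (z + α) := lt_of_lt_of_le (by positivity) ga'
  rw [hz] at a0'
  obtain ⟨s1, s2, s3, s4⟩ := split_piv α A m' i x a0.ne' a0'.ne'
  rw [← hz] at s1 s2 s3 s4 a0'
  have hAb0 : ∀ x, 0 ≤ A x := by rw [hA]; exact fun x => (p.aa_bd j x).1
  have hAb1 : ∀ x, A x ≤ (Lam t + 1) - 1 := by
    rw [hA]; exact fun x => by linarith [(p.aa_bd j x).2]
  obtain ⟨a, b, c, -⟩ := entry_bd (α := α) hAb0 hAb1 i x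
  obtain ⟨a', b', c', -⟩ := entry_bd (α := α) hAb0 hAb1 m' (z + α)
  have hM : 1 ≤ Lam t + 1 := by linarith [hAb0 0, hAb1 0]
  have hMi := one_le_pow₀ hM (n := i)
  have hMm := one_le_pow₀ hM (n := m')
  obtain ⟨U, hU⟩ : ∃ U, U = (Lam t + 1) ^ i := ⟨_, rfl⟩
  obtain ⟨V, hV⟩ : ∃ V, V = (Lam t + 1) ^ m' := ⟨_, rfl⟩
  rw [← hU] at a b c hMi
  rw [← hV] at a' b' c' hMm
  have hW : U * V ≤ (Lam t + 1) ^ (q j) := by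
    rw [hU, hV, ← pow_add]; exact pow_le_pow_right₀ hM (by omega)
  have hUW : U ≤ (Lam t + 1) ^ (q j) := (le_mul_of_one_le_right (by linarith) hMm).trans hW
  have hVW : V ≤ (Lam t + 1) ^ (q j) := (le_mul_of_one_le_left (by linarith) hMi).trans hW
  obtain ⟨W, hWd⟩ : ∃ W, W = (Lam t + 1) ^ (q j) := ⟨_, rfl⟩
  rw [← hWd] at hW hUW hVW
  have T1 : ∀ u v : ℝ, |u| ≤ U → |v| ≤ V → |u * v * piv α A m' i x| ≤ 4 * (W / g) := by
    intro u v hu hv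
    rw [abs_mul, abs_mul, abs_of_nonneg p0]
    calc |u| * |v| * piv α A m' i x ≤ (U * V) * (4 / g) := by gcongr
      _ ≤ W * (4 / g) := by gcongr
      _ = _ := by ring
  have T2 : ∀ u v : ℝ, |u| ≤ W → g ≤ v → |u / v| ≤ W / g := by
    intro u v hu hv
    rw [abs_div, abs_of_pos (hg0.trans_le hv)]
    have := abs_nonneg u
    gcongr
    linarith
  have f1 := T1 _ _ a a'
  have f2 := T1 _ _ b a'
  have f3 := T1 _ _ a c'
  have f4 := T1 _ _ b c'
  have g2 := T2 (ea α A m' (z+α)) _ (a'.trans hVW) (gi.trans ga)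
  have g3 := T2 (ea α A i x) _ (a.trans hUW) (gm.trans ga')
  have g4 := T2 (ec α A m' (z+α)) _ (c'.trans hVW) (gi.trans ga)
  have g5 := T2 (eb α A i x) _ (b.trans hUW) (gm.trans ga')
  have k2 := abs_sub (eb α A i x * ea α A m' (z+α) * piv α A m' i x) (ea α A m' (z+α) / ea α A i x)
  have k3 := abs_add_le (ea α A i x * ec α A m' (z+α) * piv α A m' i x) (ea α A i x / ea α A m' (z+α))
  have k4 := abs_sub (eb α A i x * ec α A m' (z+α) * piv α A m' i x) (ec α A m' (z+α) / ea α A i x)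
  have k5 := abs_add_le (eb α A i x * ec α A m' (z+α) * piv α A m' i x - ec α A m' (z+α) / ea α A i x)
    (eb α A i x / ea α A m' (z+α))
  rw [← s1] at f1
  rw [← s2] at k2
  rw [← s3] at k3
  rw [← s4] at k5
  have := opNorm_le_sum (cocIter α (Sc A) (m' + 1 + i) x)
  have e : 20 * (Lam t + 1) ^ (q j) / GG β q m t ^ k = 20 * (W / g) := by rw [hWd, hg]; ring
  rw [e, ← hA]
  rw [hm']
  refine this.trans ?_
  simp only [ea, eb, ec, ed] at *
  linarith

end Par




def phi (q : ℕ → ℕ) (j : ℕ) (x : ℝ) : ℝ := max 0 (1 - 2 * us x / eps q j)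

lemma us_cont : Continuous us := (us_contDiff (n := 0)).continuous

lemma phi_cont (q : ℕ → ℕ) (j : ℕ) : Continuous (phi q j) :=
  continuous_const.max (continuous_const.sub ((continuous_const.mul us_cont).div_const _))

lemma phi_per (q : ℕ → ℕ) (j : ℕ) : Function.Periodic (phi q j) 1 := by
  intro x; simp [phi, us_per]

lemma us_upper (x : ℝ) : us x ≤ 10 * x ^ 2 := by
  have h1 : |Real.sin (Real.pi * x)| ≤ |Real.pi * x| := Real.abs_sin_le_abs
  have h2 := sq_le_sq.2 h1
  have h3 : Real.pi ^ 2 ≤ 10 := by nlinarith [Real.pi_lt_d2, Real.pi_pos]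
  unfold us
  rw [mul_pow] at h2
  nlinarith [sq_nonneg x]

lemma phi_int {α β : ℝ} {q : ℕ → ℕ} (Q : QS α β q) (j : ℕ) :
    1 / (80 * q j : ℝ) ≤ ∫ x in (0:ℝ)..1, phi q j x := by
  have hq := Q.posR j
  have hep := Q.eps_pos j
  have hi : ∀ a b, IntervalIntegrable (phi q j) volume a b := fun a b => (phi_cont q j).intervalIntegrable a b
  obtain ⟨r, hr⟩ : ∃ r : ℝ, r = 1 / (40 * q j) := ⟨_, rfl⟩
  have hr0 : 0 < r := by rw [hr]; positivity
  have hr1 : r ≤ 1 := by rw [hr, div_le_one (by positivity)]; linarith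
  rw [← intervalIntegral.integral_add_adjacent_intervals (hi 0 r) (hi r 1)]
  have h1 : 0 ≤ ∫ x in r..1, phi q j x :=
    intervalIntegral.integral_nonneg hr1 (fun x _ => le_max_left _ _)
  have h2 : ∫ x in (0:ℝ)..r, (1/2 : ℝ) ≤ ∫ x in (0:ℝ)..r, phi q j x := by
    apply intervalIntegral.integral_mono_on hr0.le (by simp) (hi 0 r)
    intro x hx
    refine le_trans ?_ (le_max_right _ _)
    have hu := us_upper x
    have hx2 : x ^ 2 ≤ r ^ 2 := pow_le_pow_left₀ hx.1 hx.2 2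
    have e : eps q j = 100 * r ^ 2 := by rw [hr]; unfold eps; field_simp; norm_num
    have : 2 * us x / eps q j ≤ 1 / 2 := by
      rw [div_le_iff₀ hep, e]; nlinarith
    linarith
  rw [intervalIntegral.integral_const, sub_zero, smul_eq_mul] at h2
  have e : 1 / (80 * q j : ℝ) = r * (1/2) := by rw [hr]; field_simp; norm_num
  rw [e]; linarith

namespace Par
variable {α β : ℝ} {q : ℕ → ℕ} {m : ℕ} {B t : ℝ}

lemma goodA (p : Par α β q m B t) (j : ℕ) : GoodC α (Sc (aa α q m B t j)) where
  c := by
    have h : Continuous (aa α q m B t j) := (p.aa_contDiff j 0).continuous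
    refine continuous_matrix fun a b => ?_
    fin_cases a <;> fin_cases b <;> simp [Sc] <;> first | exact h | exact continuous_const
  p := by intro x; simp [Sc, p.aa_per]
  d := Sc_det _

lemma log_pt (p : Par α β q m B t) (j k : ℕ) (x : ℝ) :
    Real.log (opNorm (cocIter α (Sc (aa α q m B t j)) (q j) x)) ≤
      (Real.log 20 + q j * Real.log (Lam t + 1)) -
        k * gg β q m t * ∑ i ∈ Finset.Ico k (q j - k), phi q j (x + i * α) := by
  have hep := p.Q.eps_pos j
  have h1 := (p.goodA j).one_le (q j) x
  have hM : 0 < Lam t + 1 := by unfold Lam; linarith [Real.exp_pos t]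
  have hgg : 0 ≤ gg β q m t := by linarith [p.hg, p.hB]
  have posl : ∀ y, 0 < phi q j y → us y < eps q j / 2 := by
    intro y hy
    unfold phi at hy
    rcases lt_max_iff.1 hy with h | h
    · exact absurd h (lt_irrefl _)
    · have : 2 * us y / eps q j < 1 := by linarith
      rw [div_lt_one hep] at this; linarith
  by_cases h : ∃ i ∈ Finset.Ico k (q j - k), 0 < phi q j (x + i * α)
  · obtain ⟨i, hi, hp⟩ := h
    have hu := posl _ hp
    have hi' := Finset.mem_Ico.1 hi
    have hs : ∑ i ∈ Finset.Ico k (q j - k), phi q j (x + i * α) = phi q j (x + i * α) := by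
      apply Finset.sum_eq_single_of_mem i hi
      intro r hr hri
      by_contra hne
      have hr' := Finset.mem_Ico.1 hr
      have hpr : 0 < phi q j (x + r * α) := lt_of_le_of_ne (le_max_left _ _) (Ne.symm hne)
      have hur := posl _ hpr
      have I1 : Ij q j (x + i * α) := by unfold Ij; linarith
      have I2 : Ij q j (x + r * α) := by unfold Ij; linarith
      rcases lt_or_gt_of_ne hri with hlt | hlt
      · have := p.Q.ret j (k := i - r) I2 (by
          rw [Nat.cast_sub hlt.le]
          convert I1 using 1; ring) (by omega)
        omega
      · have := p.Q.ret j (k := r - i) I1 (by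
          rw [Nat.cast_sub hlt.le]
          convert I2 using 1; ring) (by omega)
        omega
    have hb := p.opn_core j i k x hu.le hi'.1 (by omega)
    have hl := Real.log_le_log (by linarith) hb
    have hGp : (0:ℝ) < GG β q m t := Real.exp_pos _
    rw [Real.log_div (by positivity) (by positivity), Real.log_mul (by norm_num) (by positivity),
      Real.log_pow, Real.log_pow, GG, Real.log_exp] at hl
    rw [hs]
    have hph : phi q j (x + i * α) ≤ 1 := by
      unfold phi
      apply max_le zero_le_one
      have : 0 ≤ 2 * us (x + i * α) / eps q j := by
        have := us_nonneg (x + i * α); positivity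
      linarith
    have : k * gg β q m t * phi q j (x + i * α) ≤ k * gg β q m t * 1 := by gcongr
    linarith
  · push Not at h
    have hs : ∑ i ∈ Finset.Ico k (q j - k), phi q j (x + i * α) = 0 :=
      Finset.sum_eq_zero fun i hi => le_antisymm (h i hi) (le_max_left _ _)
    rw [hs]
    have hl := Real.log_le_log (by linarith) (p.opn_bd j (q j) x)
    rw [Real.log_mul (by norm_num) (by positivity), Real.log_pow] at hl
    linarith

lemma upper (p : Par α β q m B t) (hq0 : 1000 ≤ q 0) (j : ℕ) :
    lyap α (Sc (aa α q m B t j)) ≤ t + 2 - gg β q m t / 800 := by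
  have g := p.goodA j
  have hn : 1000 ≤ q j := hq0.trans (p.Q.mono (Nat.zero_le j))
  have hgg : 0 ≤ gg β q m t := by linarith [p.hg, p.hB]
  obtain ⟨n, hnn⟩ : ∃ n, n = q j := ⟨_, rfl⟩
  obtain ⟨k, hk⟩ : ∃ k, k = q j / 4 := ⟨_, rfl⟩
  have ic : ∀ i : ℕ, IntervalIntegrable (fun x => phi q j (x + i * α)) volume 0 1 := fun i =>
    ((phi_cont q j).comp (continuous_id.add continuous_const)).intervalIntegrable 0 1
  have is : IntervalIntegrable (fun x => ∑ i ∈ Finset.Ico k (q j - k), phi q j (x + i * α)) volume 0 1 :=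
    (continuous_finsetSum _ fun i _ =>
      (phi_cont q j).comp (continuous_id.add continuous_const)).intervalIntegrable 0 1
  have h1 : lint α (Sc (aa α q m B t j)) (q j) ≤ ∫ x in (0:ℝ)..1,
      ((Real.log 20 + q j * Real.log (Lam t + 1)) -
        k * gg β q m t * ∑ i ∈ Finset.Ico k (q j - k), phi q j (x + i * α)) := by
    unfold lint
    apply intervalIntegral.integral_mono_on zero_le_one ((g.log_cont (q j)).intervalIntegrable 0 1)
      (intervalIntegrable_const.sub (is.const_mul _))
    exact fun x _ => p.log_pt j k x
  rw [intervalIntegral.integral_sub intervalIntegrable_const (is.const_mul _),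
    intervalIntegral.integral_const_mul, intervalIntegral.integral_finsetSum (fun i _ => ic i),
    intervalIntegral.integral_const] at h1
  simp only [GoodC.int_shift (phi_per q j)] at h1
  rw [Finset.sum_const, Nat.card_Ico, sub_zero, one_smul, nsmul_eq_mul] at h1
  have hlam : Real.log (Lam t + 1) ≤ t + 1 := by
    rw [Real.log_le_iff_le_exp (by unfold Lam; positivity), Real.exp_add]
    have := p.exp_t
    have := Real.add_one_le_exp (1:ℝ)
    unfold Lam; nlinarith
  have hl20 : Real.log 20 ≤ 19 := by
    have := Real.log_le_sub_one_of_pos (show (0:ℝ) < 20 by norm_num); linarith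
  have h2 := phi_int p.Q j
  have hnR : (1000:ℝ) ≤ q j := by exact_mod_cast hn
  have hc : (q j : ℝ) / 2 ≤ ((q j - k - k : ℕ) : ℝ) := by
    have : q j ≤ 2 * (q j - k - k) := by omega
    have : (q j : ℝ) ≤ 2 * ((q j - k - k : ℕ) : ℝ) := by exact_mod_cast this
    linarith
  have hk5 : (q j : ℝ) / 5 ≤ k := by
    have : q j ≤ 5 * k := by omega
    have : (q j : ℝ) ≤ 5 * k := by exact_mod_cast this
    linarith
  have h3 : (q j : ℝ) / 5 * gg β q m t * ((q j : ℝ) / 2 * (1 / (80 * q j))) ≤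
      k * gg β q m t * (((q j - k - k : ℕ) : ℝ) * ∫ x in (0:ℝ)..1, phi q j x) := by
    gcongr
  have e : (q j : ℝ) / 5 * gg β q m t * ((q j : ℝ) / 2 * (1 / (80 * q j))) = q j * (gg β q m t / 800) := by
    field_simp; ring
  refine (g.lyap_le (n := q j) (by omega)).trans ?_
  rw [div_le_iff₀ (by linarith)]
  have h4 : (q j : ℝ) * Real.log (Lam t + 1) ≤ q j * (t + 1) := by gcongr
  linarith

end Par




lemma log_us_eq (x : ℝ) : Real.log (us x) = 2 * (Real.log ∘ Real.sin) (Real.pi * x) := by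
  simp [us, Real.log_pow]

lemma log_us_per : Function.Periodic (fun x => Real.log (us x)) 1 := by
  intro x; simp only [us_per]

lemma log_us_ii (a b : ℝ) : IntervalIntegrable (fun x => Real.log (us x)) volume a b := by
  have h : IntervalIntegrable (Real.log ∘ Real.sin) volume (Real.pi * a) (Real.pi * b) :=
    intervalIntegrable_log_sin
  have h2 := h.comp_mul_left (c := Real.pi)
  rw [mul_div_cancel_left₀ _ Real.pi_ne_zero, mul_div_cancel_left₀ _ Real.pi_ne_zero] at h2
  have := h2.const_mul 2
  simpa only [log_us_eq] using this

lemma log_us_int : ∫ x in (0:ℝ)..1, Real.log (us x) = -2 * Real.log 2 := by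
  simp only [log_us_eq]
  rw [intervalIntegral.integral_const_mul,
    intervalIntegral.integral_comp_mul_left (Real.log ∘ Real.sin) Real.pi_ne_zero, mul_zero, mul_one]
  simp only [Function.comp_def]
  rw [integral_log_sin_zero_pi, smul_eq_mul]
  have := Real.pi_ne_zero
  field_simp

lemma us_ae (c : ℝ) : ∀ᵐ x : ℝ, us (x + c) ≠ 0 := by
  rw [ae_iff]
  have : {x : ℝ | ¬ us (x + c) ≠ 0} ⊆ Set.range (fun k : ℤ => (k : ℝ) - c) := by
    intro x hx
    simp only [ne_eq, not_not, Set.mem_ofPred_eq, us] at hx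
    have hs : Real.sin (Real.pi * (x + c)) = 0 := by simpa using hx
    obtain ⟨k, hk⟩ := Real.sin_eq_zero_iff.1 hs
    refine ⟨k, ?_⟩
    have h2 : (k : ℝ) = x + c := by
      have := Real.pi_ne_zero
      apply mul_right_cancel₀ this; rw [hk]; ring
    simp only; linarith
  exact measure_mono_null this ((Set.countable_range _).measure_zero _)

lemma log_winf {q : ℕ → ℕ} {m : ℕ} {t x : ℝ} (ht : 0 ≤ t) (he : 0 < eps q 0) (he1 : eps q 0 < 1)
    (hx : us x ≠ 0) :
    0 < winf q m t x ∧ t + (m + t / (-Real.log (eps q 0))) * Real.log (us x) ≤ Real.log (winf q m t x) := by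
  have h0 : 0 < us x := lt_of_le_of_ne (us_nonneg x) (Ne.symm hx)
  have hl : 0 < -Real.log (eps q 0) := by linarith [Real.log_neg he he1]
  have hu : Real.log (us x) ≤ 0 := Real.log_nonpos h0.le (us_le_one x)
  have hk : 0 ≤ t / (-Real.log (eps q 0)) := by positivity
  unfold winf
  split_ifs with h
  · refine ⟨by positivity, ?_⟩
    rw [Real.log_pow]
    have h2 : Real.log (us x) ≤ Real.log (eps q 0) := Real.log_le_log h0 h.le
    have h3 : t / (-Real.log (eps q 0)) * Real.log (us x) ≤ t / (-Real.log (eps q 0)) * Real.log (eps q 0) := by gcongr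
    have h4 : t / (-Real.log (eps q 0)) * Real.log (eps q 0) = -t := by
      have : Real.log (eps q 0) ≠ 0 := by linarith
      field_simp
    linarith
  · refine ⟨Real.exp_pos t, ?_⟩
    rw [Real.log_exp]
    have : (m + t / (-Real.log (eps q 0))) * Real.log (us x) ≤ 0 :=
      mul_nonpos_of_nonneg_of_nonpos (by positivity) hu
    linarith

lemma lower {α t : ℝ} {q : ℕ → ℕ} {m : ℕ} {g : ℝ → ℝ} (gc : GoodC α (Sc g)) (ht : 0 ≤ t) (he : 0 < eps q 0)
    (he1 : eps q 0 < 1)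
    (hpr : ∀ x n, ∏ i ∈ Finset.range n, winf q m t (x + i * α) ≤ ea α g n x) :
    t - 2 * (m + t / (-Real.log (eps q 0))) ≤ lyap α (Sc g) := by
  obtain ⟨κ, hκ⟩ : ∃ κ, κ = m + t / (-Real.log (eps q 0)) := ⟨_, rfl⟩
  have hl : 0 < -Real.log (eps q 0) := by linarith [Real.log_neg he he1]
  have hκ0 : 0 ≤ κ := by rw [hκ]; positivity
  have hl2 : Real.log 2 ≤ 1 := by
    have := Real.log_le_sub_one_of_pos (show (0:ℝ) < 2 by norm_num); linarith
  rw [← hκ]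
  apply gc.le_lyap
  intro n
  have ii : ∀ i : ℕ, IntervalIntegrable (fun x => Real.log (us (x + i * α))) volume 0 1 := by
    intro i
    have := (log_us_ii (0 + i * α) (1 + i * α)).comp_add_right (i * α)
    simpa using this
  have i2 : ∀ i : ℕ, IntervalIntegrable (fun x => t + κ * Real.log (us (x + i * α))) volume 0 1 :=
    fun i => intervalIntegrable_const.add ((ii i).const_mul _)
  have h1 : ∫ x in (0:ℝ)..1, ∑ i ∈ Finset.range n, (t + κ * Real.log (us (x + i * α))) ≤ lint α (Sc g) n := by
    unfold lint
    apply intervalIntegral.integral_mono_ae zero_le_one _ ((gc.log_cont n).intervalIntegrable 0 1)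
    · have hae : ∀ᵐ x : ℝ, ∀ i : ℕ, us (x + i * α) ≠ 0 := ae_all_iff.2 fun i => us_ae _
      filter_upwards [hae] with x hx
      have hw := fun i : ℕ => log_winf (q := q) (m := m) ht he he1 (hx i)
      calc _ ≤ ∑ i ∈ Finset.range n, Real.log (winf q m t (x + i * α)) :=
            Finset.sum_le_sum fun i _ => by rw [hκ]; exact (hw i).2
        _ = Real.log (∏ i ∈ Finset.range n, winf q m t (x + i * α)) := by
            rw [Real.log_prod (fun i _ => (hw i).1.ne')]
        _ ≤ _ := by
            apply Real.log_le_log (Finset.prod_pos fun i _ => (hw i).1)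
            refine (hpr x n).trans ((le_abs_self _).trans (opNorm_entry _ 0 0))
    · have := IntervalIntegrable.sum (Finset.range n) (fun i _ => i2 i)
      have e : (fun x => ∑ i ∈ Finset.range n, (t + κ * Real.log (us (x + i * α)))) =
          ∑ i ∈ Finset.range n, fun x => (t + κ * Real.log (us (x + i * α))) := by
        ext x; simp only [Finset.sum_apply]
      rw [e]; exact this
  rw [intervalIntegral.integral_finsetSum (fun i _ => i2 i)] at h1
  have h2 : ∀ i ∈ Finset.range n, ∫ x in (0:ℝ)..1, (t + κ * Real.log (us (x + i * α))) = t + κ * (-2 * Real.log 2) := by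
    intro i _
    rw [intervalIntegral.integral_add intervalIntegrable_const ((ii i).const_mul _),
      intervalIntegral.integral_const_mul, GoodC.int_shift log_us_per, log_us_int]
    simp
  rw [Finset.sum_congr rfl h2, Finset.sum_const, Finset.card_range, nsmul_eq_mul] at h1
  refine le_trans ?_ h1
  rw [mul_comm]
  gcongr
  nlinarith





def E00 : Matrix (Fin 2) (Fin 2) ℝ := !![1, 0; 0, 0]

lemma Sc_eq (P : ℝ → ℝ) : Sc P = fun x => P x • E00 + !![0, -1; 1, 0] := by
  funext x
  ext i j
  fin_cases i <;> fin_cases j <;> simp [Sc, E00]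

lemma Sc_contDiff {P : ℝ → ℝ} {l : ℕ} (h : ContDiff ℝ l P) : ContDiff ℝ l (Sc P) := by
  rw [Sc_eq]
  exact (h.smul contDiff_const).add contDiff_const

lemma Sc_sub (P R : ℝ → ℝ) : (fun x => Sc P x - Sc R x) = fun x => (P x - R x) • E00 := by
  funext x
  ext i j
  fin_cases i <;> fin_cases j <;> simp [Sc, E00]

lemma cNorm_nonneg (l : ℕ) (A : ℝ → Matrix (Fin 2) (Fin 2) ℝ) : 0 ≤ cNorm l A :=
  Real.iSup_nonneg fun _ => Real.iSup_nonneg fun _ => norm_nonneg _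

lemma cNorm_le {l : ℕ} {P R : ℝ → ℝ} {b : ℝ} (hb : 0 ≤ b) (hP : ContDiff ℝ l (fun x => P x - R x))
    (h : ∀ i ≤ l, ∀ x, |iteratedDeriv i (fun x => P x - R x) x| ≤ b) :
    cNorm l (fun x => Sc P x - Sc R x) ≤ b * ‖E00‖ := by
  have h0 : 0 ≤ b * ‖E00‖ := mul_nonneg hb (norm_nonneg _)
  unfold cNorm
  refine Real.iSup_le (fun k => Real.iSup_le (fun x => ?_) h0) h0
  have hk : (k : ℕ) ≤ l := by have := k.2; omega
  rw [Sc_sub, iteratedDeriv_smul_const (hP.of_le (by exact_mod_cast hk)).contDiffAt, norm_smul, Real.norm_eq_abs]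
  exact mul_le_mul_of_nonneg_right (h _ hk x) (norm_nonneg _)

lemma params (l m : ℕ) (B β C : ℝ) (q : ℕ → ℕ) (hq : 2 * (l + 1) ≤ q 0) (hC : 0 ≤ C) (he : 0 < eps q 0)
    (hCs : 0 < QS.Cs β q) (hl : 1 ≤ l) :
    ∃ t K : ℝ, 2 ≤ t ∧ 2 * B + 4 ≤ gg β q m t ∧
      (1 + C / eps q 0 ^ l * (4 + ((l+1) * 7 ^ l) ^ m)) * Lam t + 2 * (C * 16 ^ l * (4 * (l+1) + 1)) ≤ K ∧
      (K+1) ^ l / GG β q m t ^ (l+1) ≤ Real.exp (-B) ∧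
      t + 2 - gg β q m t / 800 < t - 2 * m - t / 3200 ∧ 0 < t - 2 * m - t / 3200 := by
  obtain ⟨C5, h5⟩ : ∃ x : ℝ, x = 1 + C / eps q 0 ^ l * (4 + ((l+1) * 7 ^ l) ^ m) := ⟨_, rfl⟩
  obtain ⟨C4, h4⟩ : ∃ x : ℝ, x = C * 16 ^ l * (4 * (l+1) + 1) := ⟨_, rfl⟩
  obtain ⟨S, hS⟩ : ∃ x : ℝ, x = QS.Cs β q := ⟨_, rfl⟩
  have p5 : 0 ≤ C5 := by rw [h5]; positivity
  have p4 : 0 ≤ C4 := by rw [h4]; positivity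
  rw [← hS] at hCs
  rw [← h5, ← h4]
  obtain ⟨C7, h7⟩ : ∃ x : ℝ, x = 2 * C5 + 2 * C4 + 1 := ⟨_, rfl⟩
  have p7 : 0 < C7 := by rw [h7]; positivity
  obtain ⟨t, ht1, ht2, ht3, ht4⟩ : ∃ t : ℝ, 2 ≤ t ∧ 2 * (2 * B + 4 + m * S) ≤ t ∧
      2 * (l * Real.log C7 + (l+1) * (m * S) + B) ≤ t ∧ 3200 * (2 + 2 * m + m * S / 800) < t := by
    obtain ⟨t, h⟩ := ((eventually_ge_atTop (2:ℝ)).and ((eventually_ge_atTop (2 * (2 * B + 4 + m * S))).and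
      ((eventually_ge_atTop (2 * (l * Real.log C7 + (l+1) * (m * S) + B))).and
        (eventually_gt_atTop (3200 * (2 + 2 * m + m * S / 800)))))).exists
    exact ⟨t, h.1, h.2.1, h.2.2.1, h.2.2.2⟩
  have hqR : 2 * ((l:ℝ) + 1) ≤ q 0 := by exact_mod_cast hq
  have hl1 : (1:ℝ) ≤ l := by exact_mod_cast hl
  have hgg : t - t / (2 * (l+1)) - m * S ≤ gg β q m t := by
    unfold gg
    rw [← hS]
    have : t * (1 / (q 0 : ℝ)) ≤ t * (1 / (2 * (l+1))) := by gcongr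
    have e : t / (2 * ((l:ℝ)+1)) = t * (1 / (2 * (l+1))) := by ring
    rw [e]; linarith
  have hgg2 : t / 2 - m * S ≤ gg β q m t := by
    have : t / (2 * ((l:ℝ)+1)) ≤ t / 2 := by
      apply div_le_div_of_nonneg_left (by linarith) (by norm_num); linarith
    linarith
  have hmS : 0 ≤ (m:ℝ) * S := by positivity
  have hm0 : (0:ℝ) ≤ m := Nat.cast_nonneg m
  refine ⟨t, C5 * Lam t + 2 * C4, ht1, by linarith, le_rfl, ?_, by linarith, by linarith⟩
  have hex : 1 ≤ Real.exp t := Real.one_le_exp (by linarith)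
  have hK : C5 * Lam t + 2 * C4 + 1 ≤ Real.exp (Real.log C7 + t) := by
    rw [Real.exp_add, Real.exp_log p7, h7]; unfold Lam
    nlinarith
  have hL0 : 0 ≤ Lam t := by unfold Lam; positivity
  have hK2 : (C5 * Lam t + 2 * C4 + 1) ^ l ≤ Real.exp (l * (Real.log C7 + t)) := by
    rw [Real.exp_nat_mul]
    exact pow_le_pow_left₀ (by positivity) hK l
  have hG : GG β q m t ^ (l+1) = Real.exp (((l+1 : ℕ) : ℝ) * gg β q m t) := by
    rw [Real.exp_nat_mul]; rfl
  rw [hG, div_le_iff₀ (Real.exp_pos _), ← Real.exp_add]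
  refine hK2.trans (Real.exp_le_exp.2 ?_)
  push_cast
  have h8 : ((l:ℝ)+1) * (t - t / (2 * (l+1)) - m * S) ≤ (l+1) * gg β q m t := by gcongr
  have e : ((l:ℝ)+1) * (t - t / (2 * (l+1)) - m * S) = (l+1) * t - t / 2 - (l+1) * (m * S) := by
    have : (l:ℝ) + 1 ≠ 0 := by positivity
    field_simp
  rw [e] at h8
  nlinarith

theorem main_thm (α : ℝ) (hα : Irrational α)
    (hFL : ∃ β : ℝ, ∀ᶠ n in atTop,
      Real.log (cfq α (n + 1) : ℝ) ≤ β * (cfq α n : ℝ))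
    (l : ℕ) (hl : 1 ≤ l) :
    ∃ D : ℝ → Matrix (Fin 2) (Fin 2) ℝ, ∃ A : ℕ → ℝ → Matrix (Fin 2) (Fin 2) ℝ,
      Function.Periodic D 1 ∧ ContDiff ℝ (l : ℕ∞) D ∧ (∀ x, (D x).det = 1) ∧
      (∀ j, Function.Periodic (A j) 1 ∧ ContDiff ℝ (l : ℕ∞) (A j) ∧
        ∀ x, ((A j) x).det = 1) ∧
      0 < lyap α D ∧
      Tendsto (fun j : ℕ => cNorm l (fun x => A j x - D x)) atTop (nhds 0) ∧
      limsup (fun j : ℕ => lyap α (A j)) atTop < lyap α D := by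
  obtain ⟨β, hβ, har⟩ := arith α hα hFL
  obtain ⟨q, hq0, hq⟩ := har (⌈Real.exp 3200⌉₊ + 2 * (l+1) + 1000)
  have Q : QS α β q := ⟨by omega, hβ, fun j => (hq j).1, fun j => (hq j).2.1, fun j => (hq j).2.2⟩
  obtain ⟨C, hC1, hC⟩ := jn_chi l
  obtain ⟨B, hB⟩ : ∃ B, B = 2 * l * β + 1 := ⟨_, rfl⟩
  obtain ⟨m, hm⟩ : ∃ m, m = 2 * l + 1 := ⟨_, rfl⟩
  have he := Q.eps_pos 0
  obtain ⟨t, K, ht, hg, hK, hρ, gap, hpos⟩ := params l m B β C q (by omega) (by linarith) he Q.Cs_pos hl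
  have hB1 : 1 ≤ B := by rw [hB]; have : 0 ≤ 2 * (l:ℝ) * β := by positivity
                         linarith
  have p : Par α β q m B t := ⟨Q, by omega, hB1, ht, hg⟩
  have hC' : ∀ j x, jn l 1 (chi q j) x ≤ C / eps q j ^ l := fun j x =>
    hC q j (Q.eps_pos j) ((Q.eps_le j).trans (by norm_num)) x
  obtain ⟨C4, hC4⟩ : ∃ x : ℝ, x = C * 16 ^ l * (4 * (l+1) + 1) := ⟨_, rfl⟩
  have hC40 : 0 ≤ C4 := by rw [hC4]; positivity
  have hinc := p.incr hB (by linarith) hC' hK hρ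
  rw [← hC4] at hinc
  obtain ⟨g, gs, gp, gprod, gd⟩ := p.limit_pot hinc
  have gc : GoodC α (Sc g) :=
    ⟨(Sc_contDiff gs).continuous, fun x => by simp [Sc, gp], Sc_det g⟩
  have hlam : 6400 ≤ -Real.log (eps q 0) := by
    have h1 : Real.exp 3200 ≤ q 0 := by
      refine (Nat.le_ceil _).trans ?_
      exact_mod_cast (by omega : ⌈Real.exp 3200⌉₊ ≤ q 0)
    have hq1 := Q.posR 0
    have h2 : 3200 ≤ Real.log (q 0) := by
      rw [Real.le_log_iff_exp_le (by linarith)]; exact h1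
    unfold eps
    rw [one_div, Real.log_inv, neg_neg, Real.log_mul (by norm_num) (by positivity), Real.log_pow]
    have : 0 ≤ Real.log 16 := Real.log_nonneg (by norm_num)
    push_cast; linarith
  have hlow : t - 2 * m - t / 3200 ≤ lyap α (Sc g) := by
    have h1 := lower (q := q) (m := m) (t := t) gc (by linarith) he
      (lt_of_le_of_lt (Q.eps_le 0) (by norm_num)) gprod
    have h2 : t / (-Real.log (eps q 0)) ≤ t / 6400 :=
      div_le_div_of_nonneg_left (by linarith) (by norm_num) hlam
    linarith
  have hup := p.upper (by omega)
  refine ⟨Sc g, fun j => Sc (aa α q m B t j), gc.p, by exact_mod_cast Sc_contDiff gs, gc.d,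
    fun j => ⟨(p.goodA j).p, by exact_mod_cast Sc_contDiff (p.aa_contDiff j l), (p.goodA j).d⟩,
    by linarith, ?_, ?_⟩
  · have hlim : Tendsto (fun j => (l.factorial * hbd C l m B q j + 2 * (l.factorial * C4) * (1/2) ^ j) * ‖E00‖)
        atTop (nhds 0) := by
      have a := (p.hbd_tendsto (l := l) (C := C) (by linarith) hm).const_mul (l.factorial : ℝ)
      have b := (tendsto_pow_atTop_nhds_zero_of_lt_one (r := (1/2 : ℝ)) (by norm_num) (by norm_num)).const_mul
        (2 * (l.factorial * C4))
      have := (a.add b).mul_const ‖E00‖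
      simpa using this
    refine squeeze_zero (fun j => cNorm_nonneg _ _) (fun j => ?_) hlim
    have hs1 : ContDiff ℝ l (fun y => PP α q m B t (j+1) y - g y) := ((p.inv (j+1)).smooth l).sub gs
    have hs2 := Par.hterm_contDiff (q := q) (m := m) (B := B) j l
    have hbd0 : 0 ≤ hbd C l m B q j :=
      (jn_nonneg l zero_le_one _ 0).trans (p.hterm j (hC' j) 0)
    have e : (fun x => aa α q m B t j x - g x) =
        fun x => (PP α q m B t (j+1) x - g x) - chi q j x * (us x ^ m + eta B q j) := by
      funext x; unfold aa; ring
    refine cNorm_le (by positivity) ((p.aa_contDiff j l).sub gs) ?_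
    intro i hi x
    have hil : ((i : ℕ) : WithTop ℕ∞) ≤ l := by exact_mod_cast hi
    rw [e, iteratedDeriv_fun_sub (hs1.of_le hil).contDiffAt (hs2.of_le hil).contDiffAt]
    refine (abs_sub _ _).trans ?_
    have h1 := gd j i hi x
    have h2 := (deriv_le_jn (fun x => chi q j x * (us x ^ m + eta B q j)) x hi).trans
      (mul_le_mul_of_nonneg_left (p.hterm j (hC' j) x) (by positivity))
    linarith
  · refine lt_of_le_of_lt ?_ (gap.trans_le hlow)
    refine limsup_le_of_le ?_ (Eventually.of_forall hup)
    exact isCoboundedUnder_le_of_le atTop (x := 0) fun j => (p.goodA j).lyap_nonneg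


/-- Discontinuity of the Lyapunov exponent in `C^ℓ(S¹, SL(2,ℝ))` for any fixed
finite-Liouvillean frequency `α` (i.e. `limsup (log q_{n+1})/q_n < ∞`): there are
`D` with `L(α,D) > 0` and `A_j → D` in `C^ℓ` with `limsup_j L(α,A_j) < L(α,D)`. -/
theorem statement0 (α : ℝ) (hα : Irrational α)
    (hFL : ∃ β : ℝ, ∀ᶠ n in atTop,
      Real.log (cfq α (n + 1) : ℝ) ≤ β * (cfq α n : ℝ))
    (l : ℕ) (hl : 1 ≤ l) :
    ∃ D : ℝ → Matrix (Fin 2) (Fin 2) ℝ, ∃ A : ℕ → ℝ → Matrix (Fin 2) (Fin 2) ℝ,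
      Function.Periodic D 1 ∧ ContDiff ℝ (l : ℕ∞) D ∧ (∀ x, (D x).det = 1) ∧
      (∀ j, Function.Periodic (A j) 1 ∧ ContDiff ℝ (l : ℕ∞) (A j) ∧
        ∀ x, ((A j) x).det = 1) ∧
      0 < lyap α D ∧
      Tendsto (fun j : ℕ => cNorm l (fun x => A j x - D x)) atTop (nhds 0) ∧
      limsup (fun j : ℕ => lyap α (A j)) atTop < lyap α D :=
  main_thm α hα hFL l hl
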